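/- Existence of non-stationary periodic solutions, nondegenerate nonresonant case (Theorem 5.6): Let T > 0 and let V : ℝⁿ → ℝ be C² such that: (i) (∇V)⁻¹(0) = {p₁, …, p_q} with det D²V(p_i) ≠ 0 for every i; (ii) there is a real symmetric n×n matrix B with det B ≠ 0 and ‖∇V(x) − B·x‖/‖x‖ → 0 as ‖x‖ → ∞; (iii) no eigenvalue of B nor of any D²V(p_i) belongs to {4k²π²/T² : k ∈ ℕ, k ≥ 1}; (iv) there exists an integer k ≥ 1 with (−1)^{j₀(B,T)}·j_k(B,T) ≠ Σ_{i=1}^{q} (−1)^{j₀(D²V(p_i),T)}·j_k(D²V(p_i),T). Then the system ẍ = −∇V(x) has at least one non-stationary T-periodic solution. -/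

import Mathlib

open Real RealInnerProductSpace

/-- The number of eigenvalues of `f`, counted with multiplicity, that are
strictly greater than `c`.  For a symmetric matrix `A` and `c = 4k²π²/T²`
this is `j_k(A,T)` of the paper; for `c = 0` it is `j₀(A,T)`. -/
noncomputable def eigCountAbove {E : Type*} [NormedAddCommGroup E]
    [NormedSpace ℝ E] (f : E →L[ℝ] E) (c : ℝ) : ℕ :=
  ∑ᶠ μ ∈ {μ : ℝ | c < μ},
    Module.finrank ℝ
      (LinearMap.ker ((f : E →ₗ[ℝ] E) - μ • (LinearMap.id : E →ₗ[ℝ] E)))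

set_option linter.unusedSectionVars false

section
open MeasureTheory Set Topology Filter
open scoped ContDiff

section Deg
variable {E : Type*} [NormedAddCommGroup E] [NormedSpace ℝ E] [FiniteDimensional ℝ E]
  [MeasurableSpace E] [BorelSpace E]

lemma integral_fderiv_eq_zero_of_support (μ : Measure E) [μ.IsAddHaarMeasure] (f : E → ℝ)
    (hf : ContDiff ℝ 1 f) {K : Set E} (hK : IsCompact K) (hfK : ∀ x ∉ K, f x = 0) (v : E) :
    ∫ x, fderiv ℝ f x v ∂μ = 0 := by
  have hs : HasCompactSupport f := HasCompactSupport.intro hK hfK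
  have hi : Integrable (fun x => fderiv ℝ f x v) μ := by
    apply Continuous.integrable_of_hasCompactSupport
    · exact (hf.continuous_fderiv one_ne_zero).clm_apply continuous_const
    · exact hs.fderiv_apply ℝ v
  have h := integral_mul_fderiv_eq_neg_fderiv_mul_of_integrable (μ := μ) (𝕜 := ℝ)
    (f := fun _ : E => (1:ℝ)) (g := f) (v := v) (by simp) (by simpa using hi)
    (by simpa using hf.continuous.integrable_of_hasCompactSupport hs)
    (fun x _ => differentiableAt_const _) (fun x _ => hf.differentiable one_ne_zero x)
  simpa using h

lemma integral_slice_eq_of_closed (μ : Measure E) [μ.IsAddHaarMeasure] {M : ℕ}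
    (α : ℝ × E → (ℝ × E) [⋀^Fin M]→L[ℝ] ℝ) (hαd : Differentiable ℝ α)
    (hαc : ∀ u : Fin M → ℝ × E, ContDiff ℝ 1 (fun w => α w u))
    (hcl : ∀ w, extDeriv α w = 0) {K : Set E} (hK : IsCompact K)
    (hαK : ∀ t, ∀ x ∉ K, α (t, x) = 0) (b : Fin M → E) :
    ∫ x, α (1, x) (fun i => (0, b i)) ∂μ = ∫ x, α (0, x) (fun i => (0, b i)) ∂μ := by
  set v : Fin (M+1) → ℝ × E := Fin.cons (1, 0) (fun i => (0, b i)) with hv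
  set f : Fin (M+1) → ℝ × E → ℝ := fun i w => α w (i.removeNth v) with hfdef
  have hf : ∀ i, ContDiff ℝ 1 (f i) := fun i => hαc _
  have hrel : ∀ w, fderiv ℝ (f 0) w (1, 0) =
      - ∑ j : Fin M, (-1 : ℝ) ^ (j.succ : ℕ) * fderiv ℝ (f j.succ) w (0, b j) := by
    intro w
    have h := extDeriv_apply (hαd w) v
    rw [hcl w, Fin.sum_univ_succ] at h
    simp only [show ∀ i, (fun x => α x (i.removeNth v)) = f i from fun _ => rfl] at h
    simp [hv] at h ⊢
    linarith
  have hfK : ∀ i t, ∀ x ∉ K, f i (t, x) = 0 := fun i t x hx => by simp [hfdef, hαK t x hx]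
  have hf0 : f 0 = fun w => α w (fun i => (0, b i)) := by
    funext w; simp [hfdef, hv]
  have hzero : ∀ t, ∫ x, fderiv ℝ (f 0) (t, x) (1, 0) ∂μ = 0 := by
    intro t
    have key : ∀ j : Fin M, (∫ x, fderiv ℝ (f j.succ) (t, x) (0, b j) ∂μ = 0) ∧
        Integrable (fun x => fderiv ℝ (f j.succ) (t, x) (0, b j)) μ := by
      intro j
      have hc : ContDiff ℝ 1 (fun x => f j.succ (t, x)) :=
        (hf j.succ).comp (contDiff_prodMk_right t)
      have hd : ∀ x, fderiv ℝ (fun x => f j.succ (t, x)) x (b j)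
          = fderiv ℝ (f j.succ) (t, x) (0, b j) := by
        intro x
        have := (((hf j.succ).differentiable one_ne_zero (t, x)).hasFDerivAt.comp x
          (hasFDerivAt_prodMk_right t x)).fderiv
        have h2 : (fun x => f j.succ (t, x)) = f j.succ ∘ (fun x => (t, x)) := rfl
        rw [h2, this]; simp
      simp only [← hd]
      refine ⟨integral_fderiv_eq_zero_of_support μ _ hc hK (hfK _ t) _, ?_⟩
      apply Continuous.integrable_of_hasCompactSupport
      · exact (hc.continuous_fderiv one_ne_zero).clm_apply continuous_const
      · exact (HasCompactSupport.intro hK (hfK _ t)).fderiv_apply ℝ _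
    simp only [hrel]
    rw [integral_neg, integral_finsetSum _ (fun j _ => (key j).2.const_mul _)]
    simp [integral_const_mul, (key _).1]
  have hF : Continuous fun w : ℝ × E => fderiv ℝ (f 0) w (1, 0) :=
    ((hf 0).continuous_fderiv one_ne_zero).clm_apply continuous_const
  have hF0 : ∀ t, ∀ x ∉ K, fderiv ℝ (f 0) (t, x) (1, 0) = 0 := by
    intro t x hx
    have hd : HasDerivAt (fun s => f 0 (s, x)) (fderiv ℝ (f 0) (t, x) (1, 0)) t := by
      have := ((hf 0).differentiable one_ne_zero (t, x)).hasFDerivAt.comp_hasDerivAt t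
        ((hasDerivAt_id t).prodMk (hasDerivAt_const t x))
      exact this
    have : (fun s => f 0 (s, x)) = fun _ => 0 := by funext s; exact hfK 0 s x hx
    rw [this] at hd
    exact hd.unique (hasDerivAt_const t 0)
  have hftc : ∀ x, f 0 (1, x) - f 0 (0, x) = ∫ t in (0:ℝ)..1, fderiv ℝ (f 0) (t, x) (1, 0) := by
    intro x
    symm
    apply intervalIntegral.integral_eq_sub_of_hasDerivAt (f := fun s => f 0 (s, x))
    · intro t _
      exact ((hf 0).differentiable one_ne_zero (t, x)).hasFDerivAt.comp_hasDerivAt t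
        ((hasDerivAt_id t).prodMk (hasDerivAt_const t x))
    · exact (hF.comp (by fun_prop : Continuous fun t : ℝ => (t, x))).intervalIntegrable _ _
  have hfint : ∀ t, Integrable (fun x => f 0 (t, x)) μ := fun t =>
    ((hf 0).continuous.comp (by fun_prop : Continuous fun x : E => (t, x))).integrable_of_hasCompactSupport
      (HasCompactSupport.intro hK (hfK _ t))
  have : ∫ x, f 0 (1, x) ∂μ - ∫ x, f 0 (0, x) ∂μ = 0 := by
    rw [← integral_sub (hfint 1) (hfint 0)]
    simp only [hftc]
    rw [← setIntegral_eq_integral_of_forall_compl_eq_zero (s := K)]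
    · simp only [intervalIntegral.integral_of_le zero_le_one]
      rw [integral_integral_swap]
      · have : ∀ t, ∫ x in K, fderiv ℝ (f 0) (t, x) (1, 0) ∂μ = 0 := by
          intro t
          rw [setIntegral_eq_integral_of_forall_compl_eq_zero (hF0 t), hzero]
        simp [this]
      · rw [Measure.prod_restrict]
        refine IntegrableOn.mono_set (t := K ×ˢ Icc 0 1) ?_
          (prod_mono le_rfl Ioc_subset_Icc_self)
        apply ContinuousOn.integrableOn_compact (hK.prod isCompact_Icc)
        exact (hF.comp continuous_swap).continuousOn
    · intro x hx
      simp [hF0 _ x hx]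
  rw [hf0] at this
  simpa using sub_eq_zero.1 this
end Deg

end

section
open MeasureTheory Set Topology Filter
open scoped ContDiff

section Deg
variable {E : Type*} [NormedAddCommGroup E] [NormedSpace ℝ E] [FiniteDimensional ℝ E]
  [MeasurableSpace E] [BorelSpace E]

lemma exists_volumeForm (E : Type*) [NormedAddCommGroup E] [NormedSpace ℝ E]
    [FiniteDimensional ℝ E] : ∃ (b : Fin (Module.finrank ℝ E) → E)
    (D : E [⋀^Fin (Module.finrank ℝ E)]→L[ℝ] ℝ), ∀ L : E →L[ℝ] E, D (fun i => L (b i)) = L.det := by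
  let b := Module.finBasis ℝ E
  refine ⟨b, { b.det with
    cont := ?_ }, fun L => ?_⟩
  · change Continuous fun v => b.det v
    simp only [Module.Basis.det_apply]
    apply Continuous.matrix_det
    refine continuous_matrix fun i j => ?_
    simp only [Module.Basis.toMatrix_apply]
    exact (LinearMap.continuous_of_finiteDimensional (b.coord i)).comp (continuous_apply j)
  · change b.det (fun i => L (b i)) = L.det
    have := Module.Basis.det_comp b (L : E →ₗ[ℝ] E) b
    rw [b.det_self, mul_one] at this
    exact this

lemma integral_homotopy (μ : Measure E) [μ.IsAddHaarMeasure] (φ : E → ℝ) (hφ : ContDiff ℝ ∞ φ)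
    (hφs : ∀ y, 2 ≤ ‖y‖ → φ =ᶠ[𝓝 y] 0) (h₀ h₁ : E → E) (h₀s : ContDiff ℝ ∞ h₀)
    (h₁s : ContDiff ℝ ∞ h₁) {Ω : Set E} (hΩ : IsOpen Ω) (hb : Bornology.IsBounded Ω)
    (hfr : ∀ x ∈ frontier Ω, ∀ t ∈ Icc (0:ℝ) 1, 2 ≤ ‖h₀ x + t • (h₁ x - h₀ x)‖) :
    ∫ x in Ω, φ (h₁ x) * (fderiv ℝ h₁ x).det ∂μ = ∫ x in Ω, φ (h₀ x) * (fderiv ℝ h₀ x).det ∂μ := by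
  classical
  obtain ⟨b, D, hD⟩ := exists_volumeForm E
  set form : E → E [⋀^Fin (Module.finrank ℝ E)]→L[ℝ] ℝ := fun y => φ y • D with hform
  have hforms : ContDiff ℝ ∞ form := hφ.smul contDiff_const
  set H : ℝ × E → E := fun w => h₀ w.2 + Real.smoothTransition w.1 • (h₁ w.2 - h₀ w.2) with hH
  have hHs : ContDiff ℝ ∞ H := by
    have h0 : ContDiff ℝ ∞ fun w : ℝ × E => h₀ w.2 := h₀s.comp contDiff_snd
    have h1 : ContDiff ℝ ∞ fun w : ℝ × E => h₁ w.2 := h₁s.comp contDiff_snd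
    exact h0.add ((Real.smoothTransition.contDiff.comp contDiff_fst).smul (h1.sub h0))
  set α₀ : ℝ × E → (ℝ × E) [⋀^Fin (Module.finrank ℝ E)]→L[ℝ] ℝ :=
    fun w => (form (H w)).compContinuousLinearMap (fderiv ℝ H w) with hα₀
  have hα₀cl : ∀ w, extDeriv α₀ w = 0 := by
    intro w
    rw [hα₀, extDeriv_pullback (r := ∞) (hforms.differentiable (by simp) _) hHs.contDiffAt (by simp only [minSmoothness_of_isRCLikeNormedField]; norm_cast)]
    have : extDeriv form (H w) = 0 := by
      ext v
      apply AlternatingMap.map_linearDependent (extDeriv form (H w)).toAlternatingMap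
      intro hli
      have := hli.fintype_card_le_finrank
      simp at this
    rw [this]; rfl
  have hα₀d : Differentiable ℝ α₀ := fun w =>
    DifferentiableAt.continuousAlternatingMapCompContinuousLinearMap
      ((hforms.comp hHs).differentiable (by simp) w)
      ((hHs.fderiv_right (m := ∞) (by simp)).differentiable (by simp) w)
  have hα₀c : ∀ u : Fin (Module.finrank ℝ E) → ℝ × E, ContDiff ℝ 1 fun w => α₀ w u := by
    intro u
    have h1 : ∀ w, α₀ w u = φ (H w) * D (fun i => fderiv ℝ H w (u i)) := fun w => rfl
    simp only [h1]
    have h2 : ContDiff ℝ ∞ D := D.toContinuousMultilinearMap.contDiff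
    have h3 : ContDiff ℝ 1 (fderiv ℝ H) := hHs.fderiv_right (by norm_cast)
    refine ((hφ.comp hHs).of_le (by norm_cast)).mul ((h2.of_le (by norm_cast)).comp ?_)
    exact contDiff_pi.2 fun i => h3.clm_apply contDiff_const
  set α : ℝ × E → (ℝ × E) [⋀^Fin (Module.finrank ℝ E)]→L[ℝ] ℝ := fun w => if w.2 ∈ Ω then α₀ w else 0 with hα
  have hloc : ∀ w, α =ᶠ[𝓝 w] α₀ ∨ α =ᶠ[𝓝 w] fun _ => 0 := by
    intro w
    by_cases hw : w.2 ∈ Ω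
    · left
      filter_upwards [(hΩ.preimage continuous_snd).mem_nhds hw] with z hz
      simp only [hα]; exact if_pos hz
    · right
      by_cases hw2 : w.2 ∈ closure Ω
      · have hwf : w.2 ∈ frontier Ω := ⟨hw2, by rwa [hΩ.interior_eq]⟩
        have := hφs _ (hfr _ hwf (Real.smoothTransition w.1)
          ⟨Real.smoothTransition.nonneg _, Real.smoothTransition.le_one _⟩)
        filter_upwards [(hHs.continuous.continuousAt (x := w)).eventually this] with z hz
        simp only [Pi.zero_apply] at hz
        simp only [hα, hα₀, hform, hz]
        split_ifs
        · rw [zero_smul]; rfl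
        · rfl
      · filter_upwards [(isClosed_closure.preimage continuous_snd).isOpen_compl.mem_nhds hw2]
          with z hz
        simp only [hα]
        rw [if_neg]
        exact fun h => hz (subset_closure h)
  have hαd : Differentiable ℝ α := fun w => by
    rcases hloc w with h | h
    · exact (hα₀d w).congr_of_eventuallyEq h
    · exact (differentiableAt_const _).congr_of_eventuallyEq h
  have hαc : ∀ u : Fin (Module.finrank ℝ E) → ℝ × E, ContDiff ℝ 1 fun w => α w u := fun u => by
    rw [contDiff_iff_contDiffAt]
    intro w
    rcases hloc w with h | h
    · exact (hα₀c u).contDiffAt.congr_of_eventuallyEq (h.fun_comp (fun a => a u))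
    · exact contDiffAt_const.congr_of_eventuallyEq (h.fun_comp (fun a => a u))
  have hαcl : ∀ w, extDeriv α w = 0 := fun w => by
    rcases hloc w with h | h
    · rw [h.extDeriv_eq, hα₀cl]
    · rw [h.extDeriv_eq]
      have := extDeriv_smul (0:ℝ) (fun _ : ℝ × E => (0 : (ℝ × E) [⋀^Fin (Module.finrank ℝ E)]→L[ℝ] ℝ)) (x := w)
      rw [zero_smul, zero_smul] at this
      exact this
  have hmain := integral_slice_eq_of_closed μ α hαd hαc hαcl hb.isCompact_closure
    (fun t x hx => by simp only [hα]; rw [if_neg]; exact fun h => hx (subset_closure h)) b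
  have hend : ∀ t h, ContDiff ℝ ∞ h → (∀ x, H (t, x) = h x) →
      ∫ x, α (t, x) (fun i => (0, b i)) ∂μ = ∫ x in Ω, φ (h x) * (fderiv ℝ h x).det ∂μ := by
    intro t h hh he
    rw [← integral_indicator hΩ.measurableSet]
    congr 1
    funext x
    by_cases hx : x ∈ Ω
    · rw [indicator_of_mem hx]
      have hd : ∀ u, fderiv ℝ H (t, x) (0, u) = fderiv ℝ h x u := by
        intro u
        have := ((hHs.differentiable (by simp) (t, x)).hasFDerivAt.comp x
          (hasFDerivAt_prodMk_right t x)).fderiv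
        have h2 : h = H ∘ (fun x => (t, x)) := funext fun x => (he x).symm
        rw [h2, this]; simp
      have : α (t, x) (fun i => (0, b i)) = φ (H (t, x)) * D (fun i => fderiv ℝ H (t, x) (0, b i)) := by
        simp only [hα]; rw [if_pos hx]; rfl
      rw [this, he]
      simp only [hd]
      rw [hD]
    · rw [indicator_of_notMem hx]
      simp only [hα]; rw [if_neg hx]; rfl
  rw [hend 1 h₁ h₁s (fun x => by simp [hH]), hend 0 h₀ h₀s (fun x => by simp [hH])] at hmain
  exact hmain
end Deg

end

section
open MeasureTheory Set Topology Filter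
open scoped ContDiff

section Deg
variable {E : Type*} [NormedAddCommGroup E] [NormedSpace ℝ E] [FiniteDimensional ℝ E]
  [MeasurableSpace E] [BorelSpace E]

/-- A normalized smooth bump function supported near the origin. -/
noncomputable def unitBump (E : Type*) [NormedAddCommGroup E] [NormedSpace ℝ E]
    [FiniteDimensional ℝ E] [MeasurableSpace E] [BorelSpace E] : E → ℝ :=
  (⟨1 / 4, 1 / 2, by norm_num, by norm_num⟩ : ContDiffBump (0 : E)).normed Measure.addHaar

lemma contDiff_unitBump : ContDiff ℝ ∞ (unitBump E) := ContDiffBump.contDiff_normed _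

lemma integral_unitBump : ∫ x, unitBump E x ∂Measure.addHaar = 1 := ContDiffBump.integral_normed _

lemma unitBump_eq_zero {y : E} (hy : 1 / 2 ≤ ‖y‖) : unitBump E y = 0 := by
  by_contra h
  have : y ∈ Function.support (unitBump E) := h
  rw [unitBump, ContDiffBump.support_normed_eq] at this
  simp only [Metric.mem_ball, dist_zero_right] at this
  linarith

lemma unitBump_eventuallyEq {y : E} (hy : 2 ≤ ‖y‖) : unitBump E =ᶠ[𝓝 y] 0 := by
  filter_upwards [(isOpen_lt continuous_const continuous_norm).mem_nhds
    (show (1:ℝ) < ‖y‖ by linarith)] with z hz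
  exact unitBump_eq_zero (le_trans (by norm_num) (le_of_lt hz))

/-- The degree integral of a smooth map on a set. -/
noncomputable def degInt (h : E → E) (Ω : Set E) : ℝ :=
  ∫ x in Ω, unitBump E (h x) * (fderiv ℝ h x).det ∂Measure.addHaar

/-- `g` is a smooth map uniformly close on `Ω` to a large multiple of `h`. -/
def IsDegApprox (h : E → E) (Ω : Set E) (g : E → E) : Prop :=
  ContDiff ℝ ∞ g ∧ ∃ s > 0, (∀ x ∈ frontier Ω, 3 ≤ s * ‖h x‖) ∧ ∀ x ∈ closure Ω, ‖g x - s • h x‖ ≤ 1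

open Classical in
/-- The Brouwer degree of `h` on `Ω` at `0`. -/
noncomputable def deg (h : E → E) (Ω : Set E) : ℝ :=
  if hg : ∃ g, IsDegApprox h Ω g then degInt hg.choose Ω else 0

lemma degInt_eq_of_isDegApprox {h : E → E} {Ω : Set E} (hΩ : IsOpen Ω)
    (hb : Bornology.IsBounded Ω) {g₀ g₁ : E → E} (h₀ : IsDegApprox h Ω g₀)
    (h₁ : IsDegApprox h Ω g₁) : degInt g₁ Ω = degInt g₀ Ω := by
  obtain ⟨hs0, s0, hs0p, hf0, hc0⟩ := h₀
  obtain ⟨hs1, s1, hs1p, hf1, hc1⟩ := h₁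
  refine integral_homotopy _ _ contDiff_unitBump (fun y => unitBump_eventuallyEq) g₀ g₁ hs0 hs1 hΩ hb ?_
  intro x hx t ht
  have hxc := frontier_subset_closure hx
  have e : g₀ x + t • (g₁ x - g₀ x) = ((1 - t) * s0 + t * s1) • h x +
      ((1 - t) • (g₀ x - s0 • h x) + t • (g₁ x - s1 • h x)) := by module
  have h1 : ‖(1 - t) • (g₀ x - s0 • h x) + t • (g₁ x - s1 • h x)‖ ≤ 1 := by
    refine (norm_add_le _ _).trans ?_
    rw [norm_smul, norm_smul, Real.norm_of_nonneg ht.1, Real.norm_of_nonneg (by linarith [ht.2])]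
    nlinarith [hc0 x hxc, hc1 x hxc, ht.1, ht.2]
  have h2 : 3 ≤ ‖((1 - t) * s0 + t * s1) • h x‖ := by
    rw [norm_smul, Real.norm_of_nonneg (by nlinarith [ht.1, ht.2])]
    nlinarith [hf0 x hx, hf1 x hx, ht.1, ht.2]
  rw [e]
  have := norm_sub_norm_le (((1 - t) * s0 + t * s1) • h x)
    (-((1 - t) • (g₀ x - s0 • h x) + t • (g₁ x - s1 • h x)))
  rw [norm_neg, sub_neg_eq_add] at this
  linarith

lemma deg_eq_degInt {h : E → E} {Ω : Set E} (hΩ : IsOpen Ω)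
    (hb : Bornology.IsBounded Ω) {g : E → E} (hg : IsDegApprox h Ω g) :
    deg h Ω = degInt g Ω := by
  have : ∃ g, IsDegApprox h Ω g := ⟨g, hg⟩
  rw [deg, dif_pos this]
  exact degInt_eq_of_isDegApprox hΩ hb hg this.choose_spec

lemma exists_smooth_approx {h : E → E} (hh : Continuous h) :
    ∃ g, ContDiff ℝ ∞ g ∧ ∀ x, ‖g x - h x‖ ≤ 1 := by
  obtain ⟨g, hg, hd, -⟩ := hh.exists_contDiff_approx ⊤ (ε := fun _ => 1) continuous_const (by simp)
  exact ⟨g, hg, fun x => by rw [← dist_eq_norm]; exact (hd x).le⟩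

lemma exists_scale {K : Set E} (hK : IsCompact K) {h : E → E} (hh : ContinuousOn h K)
    (h0 : ∀ x ∈ K, h x ≠ 0) : ∃ s₀ > 0, ∀ s ≥ s₀, ∀ x ∈ K, 3 ≤ s * ‖h x‖ := by
  rcases K.eq_empty_or_nonempty with rfl | hne
  · exact ⟨1, one_pos, by simp⟩
  · obtain ⟨x₀, hx₀, hmin⟩ := hK.exists_isMinOn hne hh.norm
    have hp : 0 < ‖h x₀‖ := norm_pos_iff.2 (h0 x₀ hx₀)
    refine ⟨3 / ‖h x₀‖, by positivity, fun s hs x hx => ?_⟩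
    have h1 : ‖h x₀‖ ≤ ‖h x‖ := hmin hx
    have h2 : 3 ≤ s * ‖h x₀‖ := (div_le_iff₀ hp).1 hs
    have h3 : 0 < s := lt_of_lt_of_le (by positivity) hs
    nlinarith

/-- Invariance of the degree under straight-line homotopies. -/
lemma deg_homotopy {h₀ h₁ : E → E} (hc₀ : Continuous h₀) (hc₁ : Continuous h₁) {Ω : Set E}
    (hΩ : IsOpen Ω) (hb : Bornology.IsBounded Ω)
    (hfr : ∀ x ∈ frontier Ω, ∀ t ∈ Icc (0:ℝ) 1, h₀ x + t • (h₁ x - h₀ x) ≠ 0) :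
    deg h₁ Ω = deg h₀ Ω := by
  have hfc : IsCompact (frontier Ω) :=
    hb.isCompact_closure.of_isClosed_subset isClosed_frontier frontier_subset_closure
  obtain ⟨s, hs, hS⟩ : ∃ s > 0, ∀ x ∈ frontier Ω, ∀ t ∈ Icc (0:ℝ) 1,
      3 ≤ s * ‖h₀ x + t • (h₁ x - h₀ x)‖ := by
    rcases (frontier Ω).eq_empty_or_nonempty with he | hne
    · exact ⟨1, one_pos, by simp [he]⟩
    · have hcont : Continuous fun w : E × ℝ => ‖h₀ w.1 + w.2 • (h₁ w.1 - h₀ w.1)‖ := by fun_prop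
      obtain ⟨w₀, hw₀, hmin⟩ := (hfc.prod (isCompact_Icc (a := (0:ℝ)) (b := 1))).exists_isMinOn
        (hne.prod ⟨0, by simp⟩) hcont.continuousOn
      have hp := norm_pos_iff.2 (hfr w₀.1 hw₀.1 w₀.2 hw₀.2)
      refine ⟨3 / ‖h₀ w₀.1 + w₀.2 • (h₁ w₀.1 - h₀ w₀.1)‖, by positivity, fun x hx t ht => ?_⟩
      have h1 : _ ≤ ‖h₀ x + t • (h₁ x - h₀ x)‖ := hmin (show (x, t) ∈ _ from ⟨hx, ht⟩)
      simp only at h1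
      rw [div_mul_eq_mul_div, le_div_iff₀ hp]
      linarith
  obtain ⟨g₀, hg₀, ha₀⟩ := exists_smooth_approx (hc₀.const_smul s)
  simp only [Pi.smul_apply] at ha₀
  obtain ⟨g₁, hg₁, ha₁⟩ := exists_smooth_approx (hc₁.const_smul s)
  simp only [Pi.smul_apply] at ha₁
  have happ₀ : IsDegApprox h₀ Ω g₀ := ⟨hg₀, s, hs, fun x hx => by
    simpa using hS x hx 0 (by simp), fun x _ => ha₀ x⟩
  have happ₁ : IsDegApprox h₁ Ω g₁ := ⟨hg₁, s, hs, fun x hx => by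
    simpa using hS x hx 1 (by simp), fun x _ => ha₁ x⟩
  rw [deg_eq_degInt hΩ hb happ₀, deg_eq_degInt hΩ hb happ₁]
  refine integral_homotopy _ _ contDiff_unitBump (fun y => unitBump_eventuallyEq) g₀ g₁ hg₀ hg₁ hΩ hb ?_
  intro x hx t ht
  have e : g₀ x + t • (g₁ x - g₀ x) = s • (h₀ x + t • (h₁ x - h₀ x)) +
      ((1 - t) • (g₀ x - s • h₀ x) + t • (g₁ x - s • h₁ x)) := by module
  have h1 : ‖(1 - t) • (g₀ x - s • h₀ x) + t • (g₁ x - s • h₁ x)‖ ≤ 1 := by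
    refine (norm_add_le _ _).trans ?_
    rw [norm_smul, norm_smul, Real.norm_of_nonneg ht.1, Real.norm_of_nonneg (by linarith [ht.2])]
    nlinarith [ha₀ x, ha₁ x, ht.1, ht.2]
  have h2 : 3 ≤ ‖s • (h₀ x + t • (h₁ x - h₀ x))‖ := by
    rw [norm_smul, Real.norm_of_nonneg hs.le]; exact hS x hx t ht
  rw [e]
  have := norm_sub_norm_le (s • (h₀ x + t • (h₁ x - h₀ x)))
    (-((1 - t) • (g₀ x - s • h₀ x) + t • (g₁ x - s • h₁ x)))
  rw [norm_neg, sub_neg_eq_add] at this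
  linarith

lemma deg_congr {h h' : E → E} {Ω : Set E} (hh : ∀ x ∈ closure Ω, h x = h' x) :
    deg h Ω = deg h' Ω := by
  have : IsDegApprox h Ω = IsDegApprox h' Ω := by
    funext g
    simp only [IsDegApprox, eq_iff_iff]
    refine and_congr_right fun _ => exists_congr fun s => and_congr_right fun _ => and_congr ?_ ?_
    · exact forall₂_congr fun x hx => by rw [hh x (frontier_subset_closure hx)]
    · exact forall₂_congr fun x hx => by rw [hh x hx]
  unfold deg
  generalize IsDegApprox h Ω = P at this
  subst this
  rfl

/-- Additivity and excision. -/
lemma deg_additive {h : E → E} (hc : Continuous h) {Ω : Set E} (hb : Bornology.IsBounded Ω)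
    (hΩ : IsOpen Ω) {κ : Type*} [Fintype κ] (U : κ → Set E) (hU : ∀ i, IsOpen (U i))
    (hUΩ : ∀ i, U i ⊆ Ω) (hd : Pairwise fun i j => Disjoint (U i) (U j))
    (hz : ∀ x ∈ closure Ω, h x = 0 → ∃ i, x ∈ U i) : deg h Ω = ∑ i, deg h (U i) := by
  have hK : IsCompact (closure Ω \ ⋃ i, U i) :=
    hb.isCompact_closure.diff (isOpen_iUnion hU)
  obtain ⟨s, hs, hS⟩ := exists_scale hK hc.continuousOn (fun x hx h0 => by
    obtain ⟨i, hi⟩ := hz x hx.1 h0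
    exact hx.2 (mem_iUnion.2 ⟨i, hi⟩))
  obtain ⟨g, hg, ha⟩ := exists_smooth_approx (hc.const_smul s)
  simp only [Pi.smul_apply] at ha
  have hfU : ∀ i, frontier (U i) ⊆ closure Ω \ ⋃ i, U i := by
    intro i x hx
    refine ⟨closure_mono (hUΩ i) (frontier_subset_closure hx), fun hx2 => ?_⟩
    obtain ⟨j, hj⟩ := mem_iUnion.1 hx2
    by_cases hij : i = j
    · subst hij
      exact hx.2 (by rwa [(hU i).interior_eq])
    · obtain ⟨y, hy1, hy2⟩ := mem_closure_iff.1 (frontier_subset_closure hx) _ (hU j) hj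
      exact (disjoint_left.1 (hd hij)) hy2 hy1
  have hfΩ : frontier Ω ⊆ closure Ω \ ⋃ i, U i := fun x hx =>
    ⟨frontier_subset_closure hx, fun hx2 => by
      obtain ⟨j, hj⟩ := mem_iUnion.1 hx2
      exact hx.2 (by rw [hΩ.interior_eq]; exact hUΩ j hj)⟩
  have a1 : IsDegApprox h Ω g := ⟨hg, s, hs, fun x hx => hS s le_rfl x (hfΩ hx), fun x _ => ha x⟩
  have a2 : ∀ i, IsDegApprox h (U i) g := fun i =>
    ⟨hg, s, hs, fun x hx => hS s le_rfl x (hfU i hx), fun x _ => ha x⟩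
  rw [deg_eq_degInt hΩ hb a1, Finset.sum_congr rfl
    (fun i _ => deg_eq_degInt (hU i) (hb.subset (hUΩ i)) (a2 i))]
  have hcont : Continuous fun x => unitBump E (g x) * (fderiv ℝ g x).det :=
    (contDiff_unitBump.continuous.comp hg.continuous).mul
      (ContinuousLinearMap.continuous_det.comp (hg.continuous_fderiv (by simp)))
  have hfint : IntegrableOn (fun x => unitBump E (g x) * (fderiv ℝ g x).det) (closure Ω)
      Measure.addHaar := hcont.continuousOn.integrableOn_compact hb.isCompact_closure
  simp only [degInt]
  rw [← integral_iUnion_fintype (fun i => (hU i).measurableSet) hd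
    (fun i => hfint.mono_set ((hUΩ i).trans subset_closure))]
  refine setIntegral_eq_of_subset_of_forall_sdiff_eq_zero hΩ.measurableSet (iUnion_subset hUΩ) ?_
  intro x hx
  rw [unitBump_eq_zero, zero_mul]
  have h1 := hS s le_rfl x ⟨subset_closure hx.1, hx.2⟩
  have h2 := norm_sub_norm_le (s • h x) (s • h x - g x)
  rw [sub_sub_cancel, norm_smul, Real.norm_of_nonneg hs.le, norm_sub_rev] at h2
  linarith [ha x]

end Deg

end

section
open MeasureTheory Set Topology Filter
open scoped ContDiff

section Deg
variable {E : Type*} [NormedAddCommGroup E] [NormedSpace ℝ E] [FiniteDimensional ℝ E]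
  [MeasurableSpace E] [BorelSpace E]

lemma exists_lower_bound_of_det_ne_zero (L : E →L[ℝ] E) (hL : L.det ≠ 0) :
    ∃ c > 0, ∀ v, c * ‖v‖ ≤ ‖L v‖ := by
  have hker : LinearMap.ker (L : E →ₗ[ℝ] E) = ⊥ :=
    LinearMap.ker_eq_bot_of_injective
      (LinearMap.equivOfDetNeZero (L : E →ₗ[ℝ] E) hL).injective
  obtain ⟨K, hK, hK'⟩ := LinearMap.exists_antilipschitzWith (L : E →ₗ[ℝ] E) hker
  have hKp : (0:ℝ) < K := by exact_mod_cast hK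
  refine ⟨(K:ℝ)⁻¹, by positivity, fun v => ?_⟩
  have := hK'.le_mul_dist v 0
  simp only [dist_zero_right, map_zero, ContinuousLinearMap.coe_coe] at this
  rw [inv_mul_le_iff₀ hKp]
  exact this

lemma deg_linear (L : E →L[ℝ] E) (hL : L.det ≠ 0) (a : E) {r : ℝ} (hr : 0 < r) :
    deg (fun x => L (x - a)) (Metric.ball a r) = SignType.sign L.det := by
  have hcont : Continuous fun x => L (x - a) := by fun_prop
  obtain ⟨c, hc, hcL⟩ := exists_lower_bound_of_det_ne_zero L hL
  set s : ℝ := 3 / (c * r) with hs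
  have hsp : 0 < s := by positivity
  have hS : ∀ x, r ≤ ‖x - a‖ → 3 ≤ s * ‖L (x - a)‖ := by
    intro x hx
    calc (3:ℝ) = s * (c * r) := by rw [hs]; field_simp
      _ ≤ s * ‖L (x - a)‖ := by
        gcongr
        exact le_trans (by gcongr) (hcL _)
  set g : E → E := fun x => (s • L) (x - a) with hg
  have happ : IsDegApprox (fun x => L (x - a)) (Metric.ball a r) g := by
    refine ⟨?_, s, hsp, fun x hx => ?_, fun x _ => by simp [hg]⟩
    · exact (s • L).contDiff.comp (contDiff_id.sub contDiff_const)
    · rw [frontier_ball _ hr.ne', mem_sphere_iff_norm] at hx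
      exact hS x hx.ge
  rw [deg_eq_degInt Metric.isOpen_ball Metric.isBounded_ball happ, degInt]
  have hfd : ∀ x, fderiv ℝ g x = s • L := by
    intro x
    have : HasFDerivAt g ((s • L).comp (ContinuousLinearMap.id ℝ E)) x :=
      (s • L).hasFDerivAt.comp x ((hasFDerivAt_id x).sub_const a)
    rw [this.fderiv, ContinuousLinearMap.comp_id]
  simp only [hfd]
  rw [integral_mul_const, setIntegral_eq_integral_of_forall_compl_eq_zero]
  · have hdet : (s • L).det = s ^ Module.finrank ℝ E * L.det := by
      change LinearMap.det (s • (L : E →ₗ[ℝ] E)) = _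
      rw [LinearMap.det_smul]
    have hd0 : (s • L).det ≠ 0 := by rw [hdet]; positivity
    have h1 : ∫ x, unitBump E (g x) ∂Measure.addHaar = |((s • L).det)⁻¹| := by
      simp only [hg]
      rw [integral_sub_right_eq_self (fun x => unitBump E ((s • L) x)) a]
      have hm := Measure.map_linearMap_addHaar_eq_smul_addHaar
        (Measure.addHaar : Measure E) (f := ((s • L : E →L[ℝ] E) : E →ₗ[ℝ] E)) hd0
      have h2 := integral_map (μ := (Measure.addHaar : Measure E)) (φ := (s • L))
        (s • L).continuous.aemeasurable (f := unitBump E)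
        contDiff_unitBump.continuous.aestronglyMeasurable
      rw [← h2]
      change Measure.map (s • L) _ = _ at hm
      rw [hm, integral_smul_measure, integral_unitBump, smul_eq_mul, mul_one,
        ENNReal.toReal_ofReal (abs_nonneg _)]
    rw [h1, hdet]
    have hsM : 0 < s ^ Module.finrank ℝ E := by positivity
    rcases lt_or_gt_of_ne hL with h | h
    · rw [sign_neg h, abs_of_neg (inv_neg''.2 (mul_neg_of_pos_of_neg hsM h))]
      have : s ^ Module.finrank ℝ E * L.det ≠ 0 := by positivity
      simp only [SignType.coe_neg, SignType.coe_one]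
      rw [neg_mul, inv_mul_cancel₀ this]
    · rw [sign_pos h, abs_of_pos (by positivity)]
      have : s ^ Module.finrank ℝ E * L.det ≠ 0 := by positivity
      simp only [SignType.coe_one]
      rw [inv_mul_cancel₀ this]
  · intro x hx
    apply unitBump_eq_zero
    rw [Metric.mem_ball, dist_eq_norm, not_lt] at hx
    have := hS x hx
    simp only [hg, smul_apply, norm_smul, Real.norm_of_nonneg hsp.le]
    linarith

lemma deg_ball_of_hasFDerivAt {h : E → E} (hc : Continuous h) {a : E} (ha : h a = 0)
    {L : E →L[ℝ] E} (hL : L.det ≠ 0) (hd : HasFDerivAt h L a) :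
    ∀ᶠ r in 𝓝[>] (0:ℝ), deg h (Metric.ball a r) = SignType.sign L.det := by
  obtain ⟨c, hcp, hcL⟩ := exists_lower_bound_of_det_ne_zero L hL
  have h1 := (hasFDerivAt_iff_isLittleO.1 hd).def (half_pos hcp)
  obtain ⟨ρ, hρ, hball⟩ := Metric.eventually_nhds_iff.1 h1
  filter_upwards [Ioo_mem_nhdsGT hρ] with r hr
  rw [← deg_linear L hL a hr.1]
  refine deg_homotopy (by fun_prop) hc Metric.isOpen_ball Metric.isBounded_ball ?_
  intro x hx t ht h0
  rw [frontier_ball _ hr.1.ne', mem_sphere_iff_norm] at hx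
  have h2 := hball (y := x) (by rw [dist_eq_norm, hx]; exact hr.2)
  rw [ha, sub_zero] at h2
  have h3 := hcL (x - a)
  rw [hx] at h2 h3
  have h4 : ‖L (x - a)‖ = ‖t • (h x - L (x - a))‖ := by
    rw [← norm_neg (t • _), ← eq_neg_of_add_eq_zero_left h0]
  rw [norm_smul, Real.norm_of_nonneg ht.1] at h4
  have : t * ‖h x - L (x - a)‖ ≤ 1 * ‖h x - L (x - a)‖ := by gcongr; exact ht.2
  nlinarith [mul_pos hcp hr.1]

/-- The degree of a map with finitely many nondegenerate zeros. -/
lemma deg_eq_sum_sign {h : E → E} (hc : Continuous h) {Ω : Set E} (hb : Bornology.IsBounded Ω)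
    (hΩ : IsOpen Ω) {κ : Type*} [Fintype κ] (a : κ → E) (hinj : Function.Injective a)
    (haΩ : ∀ i, a i ∈ Ω) (ha : ∀ i, h (a i) = 0)
    (hz : ∀ x ∈ closure Ω, h x = 0 → ∃ i, x = a i)
    (L : κ → E →L[ℝ] E) (hL : ∀ i, (L i).det ≠ 0) (hd : ∀ i, HasFDerivAt h (L i) (a i)) :
    deg h Ω = ∑ i, (SignType.sign (L i).det : ℝ) := by
  have e1 : ∀ᶠ r in 𝓝[>] (0:ℝ), ∀ i, deg h (Metric.ball (a i) r) = SignType.sign (L i).det :=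
    eventually_all.2 fun i => deg_ball_of_hasFDerivAt hc (ha i) (hL i) (hd i)
  have e2 : ∀ᶠ r in 𝓝[>] (0:ℝ), ∀ i, Metric.ball (a i) r ⊆ Ω := by
    refine eventually_all.2 fun i => ?_
    obtain ⟨ρ, hρ, hsub⟩ := Metric.isOpen_iff.1 hΩ _ (haΩ i)
    filter_upwards [Ioo_mem_nhdsGT hρ] with r hr
    exact (Metric.ball_subset_ball hr.2.le).trans hsub
  have e3 : ∀ᶠ r in 𝓝[>] (0:ℝ), ∀ i j, i ≠ j →
      Disjoint (Metric.ball (a i) r) (Metric.ball (a j) r) := by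
    refine eventually_all.2 fun i => eventually_all.2 fun j => ?_
    by_cases hij : i = j
    · simp [hij]
    have hp : 0 < dist (a i) (a j) / 2 := half_pos (dist_pos.2 fun h => hij (hinj h))
    filter_upwards [Ioo_mem_nhdsGT hp] with r hr _
    exact Metric.ball_disjoint_ball (by linarith [hr.2])
  obtain ⟨r, ⟨h1, h2, h3⟩, hr⟩ := ((e1.and (e2.and e3)).and self_mem_nhdsWithin).exists
  rw [deg_additive hc hb hΩ (fun i => Metric.ball (a i) r) (fun i => Metric.isOpen_ball) h2
    (fun i j hij => h3 i j hij) (fun x hx h0 => ?_)]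
  · exact Finset.sum_congr rfl fun i _ => h1 i
  · obtain ⟨i, rfl⟩ := hz x hx h0
    exact ⟨i, Metric.mem_ball_self hr⟩

end Deg

end

section
open MeasureTheory Set Topology Filter
open scoped ContDiff

/-- The weighted circle action on `ι → ℂ`. -/
def rot {ι : Type*} (k : ι → ℕ) (θ : ℂ) (z : ι → ℂ) : ι → ℂ := fun i => θ ^ k i * z i

lemma exists_rot_real {ι : Type*} (k : ι → ℕ) {j : ι} (hk : 1 ≤ k j) (z : ι → ℂ) :
    ∃ θ : ℂ, ‖θ‖ = 1 ∧ (rot k θ z j).im = 0 := by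
  refine ⟨Complex.exp ((-(Complex.arg (z j)) / k j : ℝ) * Complex.I),
    Complex.norm_exp_ofReal_mul_I _, ?_⟩
  have hk0 : (k j : ℂ) ≠ 0 := by exact_mod_cast (by omega : k j ≠ 0)
  have : rot k (Complex.exp ((-(Complex.arg (z j)) / k j : ℝ) * Complex.I)) z j = (‖z j‖ : ℂ) := by
    rw [rot, ← Complex.exp_nat_mul]
    have h0 : (‖z j‖ : ℂ) = Complex.exp ((k j : ℂ) * (((-(z j).arg / k j : ℝ) : ℂ) * Complex.I) +
        (z j).arg * Complex.I) * ‖z j‖ := by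
      have : (k j : ℂ) * (((-(z j).arg / k j : ℝ) : ℂ) * Complex.I) + (z j).arg * Complex.I = 0 := by
        push_cast; field_simp; ring
      rw [this]; simp
    rw [h0, Complex.exp_add, mul_assoc, mul_comm (Complex.exp ((z j).arg * Complex.I)),
      Complex.norm_mul_exp_arg_mul_I]
  rw [this, Complex.ofReal_im]

lemma rot_ne_zero {ι : Type*} (k : ι → ℕ) {θ : ℂ} (hθ : ‖θ‖ = 1) (z : ι → ℂ) (i : ι) :
    rot k θ z i ≠ 0 ↔ z i ≠ 0 := by
  have : θ ≠ 0 := by rintro rfl; simp at hθ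
  simp [rot, this]

section Genericity
variable {X ι : Type*} [NormedAddCommGroup X] [NormedSpace ℝ X] [FiniteDimensional ℝ X] [Fintype ι]

/-- The set of parameters for which the perturbed system has a zero with `z ≠ 0`. -/
def badParams (q : ι → ℕ) (v₀ : X × (ι → ℂ) → X) (vz : X × (ι → ℂ) → ι → ℂ) :
    Set (X × (ι → ℂ) × (ι → ℂ)) :=
  {p | ∃ (x : X) (z : ι → ℂ) (ν : ℂ), z ≠ 0 ∧ v₀ (x, z) + p.1 = 0 ∧
    (∀ i, vz (x, z) i + ν * z i + p.2.1 i * z i = 0) ∧ ∑ i, p.2.2 i * z i ^ q i = 0}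

lemma dense_compl_badParams (k q : ι → ℕ) (K : ℕ) (hk : ∀ i, 1 ≤ k i) (hq : ∀ i, k i * q i = K)
    (v₀ : X × (ι → ℂ) → X) (vz : X × (ι → ℂ) → ι → ℂ)
    (hv₀ : LocallyLipschitz v₀) (hvz : LocallyLipschitz vz)
    (he₀ : ∀ x z (θ : ℂ), ‖θ‖ = 1 → v₀ (x, rot k θ z) = v₀ (x, z))
    (hez : ∀ x z (θ : ℂ), ‖θ‖ = 1 → vz (x, rot k θ z) = rot k θ (vz (x, z))) :
    Dense (badParams q v₀ vz)ᶜ := by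
  classical
  rcases isEmpty_or_nonempty ι with hι | ⟨⟨i₀⟩⟩
  · have : badParams q v₀ vz = ∅ := by
      refine eq_empty_of_forall_notMem ?_
      rintro p ⟨x, z, ν, hz, -⟩
      exact hz (Subsingleton.elim _ _)
    rw [this, compl_empty]; exact dense_univ
  let l : ι → ((X × (ι → ℂ) × (ι → ℂ)) →ₗ[ℝ] ℝ) := fun j =>
    { toFun := fun p => (p.2.1 j).im
      map_add' := fun _ _ => Complex.add_im _ _
      map_smul' := fun r x => by simp }
  let G : Finset ι → ι → (X × (ι → ℂ) × (ι → ℂ)) × (X × (ι → ℂ)) → (X × (ι → ℂ) × (ι → ℂ)) := fun S j w =>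
    (-w.2.1, fun i => if i ∈ S then -w.2.2 i / w.1.2.1 i - w.1.2.2 j else w.1.2.1 i,
      fun i => if i = j then -(∑ m ∈ Finset.univ.erase j, w.1.2.2 m *
        (if m ∈ S then w.1.2.1 m else 0) ^ q m) / w.1.2.1 j ^ q j else w.1.2.2 i)
  let A : Finset ι → (X × (ι → ℂ) × (ι → ℂ)) → X × (ι → ℂ) := fun S p => (p.1, fun i => if i ∈ S then p.2.1 i else 0)
  let D : Finset ι → ι → Set (X × (ι → ℂ) × (ι → ℂ)) := fun S j => {p | (p.2.1 j).im = 0 ∧ (∀ i ∈ S, p.2.1 i ≠ 0)}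
  let Ψ : Finset ι → ι → (X × (ι → ℂ) × (ι → ℂ)) → (X × (ι → ℂ) × (ι → ℂ)) := fun S j p => G S j (p, (v₀ (A S p), vz (A S p)))
  have hsub : badParams q v₀ vz ⊆ ⋃ a : {a : Finset ι × ι // a.2 ∈ a.1}, Ψ a.1.1 a.1.2 '' D a.1.1 a.1.2 := by
    rintro ⟨ex, e, ε⟩ ⟨x, z, ν, hz, h1, h2, h3⟩
    obtain ⟨j, hj⟩ : ∃ j, z j ≠ 0 := by
      by_contra! h; exact hz (funext h)
    obtain ⟨θ, hθ, him⟩ := exists_rot_real k (hk j) z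
    set y := rot k θ z with hy
    have hynz : ∀ i, y i ≠ 0 ↔ z i ≠ 0 := fun i => rot_ne_zero k hθ z i
    have h1' : v₀ (x, y) + ex = 0 := by rw [hy, he₀ x z θ hθ]; exact h1
    have h2' : ∀ i, vz (x, y) i + ν * y i + e i * y i = 0 := by
      intro i
      rw [hy, hez x z θ hθ]
      simp only [rot]
      linear_combination θ ^ k i * h2 i
    have h3' : ∑ i, ε i * y i ^ q i = 0 := by
      have : ∑ i, ε i * y i ^ q i = θ ^ K * ∑ i, ε i * z i ^ q i := by
        rw [Finset.mul_sum]
        refine Finset.sum_congr rfl fun i _ => ?_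
        rw [hy, rot, mul_pow, ← pow_mul, hq i]; ring
      rw [this, h3, mul_zero]
    set S : Finset ι := Finset.univ.filter fun i => z i ≠ 0 with hS
    have hyS : ∀ i, i ∈ S ↔ y i ≠ 0 := fun i => by simp [hS, hynz]
    have hjS : j ∈ S := by simp [hS, hj]
    have hyj : y j ≠ 0 := (hyS j).1 hjS
    refine mem_iUnion.2 ⟨⟨(S, j), hjS⟩, ⟨(x, fun i => if i ∈ S then y i else e i,
      fun i => if i = j then ν else ε i), ⟨?_, ?_⟩, ?_⟩⟩
    · simp only [hjS, if_true]; exact him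
    · intro i hi; simp only [hi, if_true]; exact (hyS i).1 hi
    · have hyy : (fun i => if i ∈ S then (if i ∈ S then y i else e i) else 0) = y := by
        funext i
        by_cases hi : i ∈ S
        · simp [hi]
        · have := (hyS i).not.1 hi; push Not at this; simp [hi, this]
      simp only [Ψ, A, G, hyy]
      refine Prod.ext ?_ (Prod.ext ?_ ?_)
      · exact neg_eq_of_add_eq_zero_right h1'
      · funext i
        by_cases hi : i ∈ S
        · simp only [hi, if_true]
          have := (hyS i).1 hi
          field_simp
          linear_combination -(h2' i)
        · simp [hi]
      · funext i
        by_cases hi : i = j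
        · subst hi
          simp only [if_true, hjS]
          rw [div_eq_iff (pow_ne_zero _ hyj)]
          rw [← Finset.add_sum_erase _ _ (Finset.mem_univ i)] at h3'
          rw [neg_eq_iff_add_eq_zero]
          refine Eq.trans ?_ h3'
          rw [add_comm]
          congr 1
          refine Finset.sum_congr rfl fun m hm => ?_
          have hmi := Finset.ne_of_mem_erase hm
          simp only [hmi, if_false]
          by_cases hmS : m ∈ S
          · simp [hmS]
          · have := (hyS m).not.1 hmS; push Not at this; simp [hmS, this]
        · simp only [hi, if_false]
  have hdiv : ∀ (a b : (X × (ι → ℂ) × (ι → ℂ)) × X × (ι → ℂ) → ℂ) w, b w ≠ 0 → ContDiffAt ℝ 1 a w →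
      ContDiffAt ℝ 1 b w → ContDiffAt ℝ 1 (fun w => a w / b w) w := by
    intro a b w hw ha hb
    simp only [div_eq_mul_inv]
    exact ha.mul (hb.inv hw)
  have hG : ∀ S j, j ∈ S → ∀ w : (X × (ι → ℂ) × (ι → ℂ)) × (X × (ι → ℂ)), (∀ i ∈ S, w.1.2.1 i ≠ 0) →
      ContDiffAt ℝ 1 (G S j) w := by
    intro S j hj w hw
    refine ContDiffAt.prodMk (by fun_prop) (ContDiffAt.prodMk ?_ ?_)
    · refine contDiffAt_pi.2 fun i => ?_
      by_cases hi : i ∈ S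
      · simp only [hi, if_true]
        have := hw i hi
        exact ContDiffAt.sub (hdiv _ _ _ this (by fun_prop) (by fun_prop)) (by fun_prop)
      · simp only [hi, if_false]; fun_prop
    · refine contDiffAt_pi.2 fun i => ?_
      by_cases hi : i = j
      · simp only [hi, if_true]
        have := pow_ne_zero (q j) (hw j hj)
        refine hdiv _ _ _ this (ContDiffAt.neg (ContDiffAt.sum fun m _ => ?_)) (by fun_prop)
        by_cases hm : m ∈ S
        · simp only [hm, if_true]; fun_prop
        · simp only [hm, if_false]; fun_prop
      · simp only [hi, if_false]; fun_prop
  have hA : ∀ S, LocallyLipschitz (A S) := by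
    intro S
    have : ContDiff ℝ 1 (A S) := by
      refine ContDiff.prodMk (by fun_prop) (contDiff_pi.2 fun i => ?_)
      by_cases hi : i ∈ S
      · simp only [hi, if_true]; fun_prop
      · simp only [hi, if_false]; fun_prop
    exact this.locallyLipschitz
  refine _root_.dense_compl_of_dimH_lt_finrank ?_
  have hfin : ∀ S j, j ∈ S → dimH (Ψ S j '' D S j) ≤ ((Module.finrank ℝ (X × (ι → ℂ) × (ι → ℂ)) - 1 : ℕ) : ENNReal) := by
    intro S j hj
    let W := LinearMap.ker (l j)
    have hWlt : Module.finrank ℝ W ≤ Module.finrank ℝ (X × (ι → ℂ) × (ι → ℂ)) - 1 := by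
      have : W ≠ ⊤ := by
        intro h
        have h2 : ((0, fun _ => Complex.I, 0) : (X × (ι → ℂ) × (ι → ℂ))) ∈ W := by rw [h]; trivial
        have h3 : (Complex.I).im = 0 := h2
        simp at h3
      have := Submodule.finrank_lt this
      omega
    have himg : Ψ S j '' D S j = (fun w : W => Ψ S j w) '' {w : W | (w : (X × (ι → ℂ) × (ι → ℂ))) ∈ D S j} := by
      ext p
      constructor
      · rintro ⟨w, hw, rfl⟩
        exact ⟨⟨w, hw.1⟩, hw, rfl⟩
      · rintro ⟨w, hw, rfl⟩
        exact ⟨w, hw, rfl⟩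
    rw [himg]
    refine (dimH_image_le_of_locally_lipschitzOn ?_).trans ((dimH_mono (subset_univ _)).trans ?_)
    · intro w hw
      have hin : LocallyLipschitz (fun p : (X × (ι → ℂ) × (ι → ℂ)) => ((p, (v₀ (A S p), vz (A S p))) : (X × (ι → ℂ) × (ι → ℂ)) × X × (ι → ℂ))) :=
        LocallyLipschitz.id.prodMk ((hv₀.comp (hA S)).prodMk (hvz.comp (hA S)))
      obtain ⟨C₁, t₁, ht₁, hl₁⟩ := hin w
      obtain ⟨C₂, t₂, ht₂, hl₂⟩ := (hG S j hj _ hw.2).exists_lipschitzOnWith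
        (x := ((w : (X × (ι → ℂ) × (ι → ℂ))), (v₀ (A S w), vz (A S w))))
      have ht : (fun p : (X × (ι → ℂ) × (ι → ℂ)) => ((p, (v₀ (A S p), vz (A S p))) : (X × (ι → ℂ) × (ι → ℂ)) × X × (ι → ℂ))) ⁻¹' t₂ ∩ t₁ ∈ 𝓝 (w : (X × (ι → ℂ) × (ι → ℂ))) :=
        inter_mem (hin.continuous.continuousAt ht₂) ht₁
      refine ⟨C₂ * (C₁ * 1), Subtype.val ⁻¹' _, mem_nhdsWithin_of_mem_nhds
        (continuous_subtype_val.continuousAt ht), ?_⟩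
      exact (hl₂.comp (t := t₂) (hl₁.comp (LipschitzWith.subtype_val _).lipschitzOnWith
        (fun u hu => hu.2)) (fun u hu => hu.1))
    · rw [Real.dimH_univ_eq_finrank]
      exact_mod_cast hWlt
  refine (dimH_mono hsub).trans_lt ?_
  rw [dimH_iUnion]
  refine (iSup_le fun a => hfin _ _ a.2).trans_lt ?_
  have : 0 < Module.finrank ℝ (X × (ι → ℂ) × (ι → ℂ)) :=
    Module.finrank_pos_iff_exists_ne_zero.2 ⟨(0, fun _ => 1, 0), fun h => by
      have := congrFun (congrArg (fun p => p.2.1) h) i₀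
      simp at this⟩
  exact_mod_cast Nat.sub_lt this one_pos

end Genericity

end

section
open MeasureTheory Set Topology Filter
open scoped ContDiff

/-- A linear zone of an equivariant map: an isomorphism `A` on the fixed space and a
diagonalizable operator with simple real spectrum `b` on the weight spaces. -/
structure LinModel (X : Type*) [NormedAddCommGroup X] [NormedSpace ℝ X] {ι : Type*}
    [DecidableEq ι] (k : ι → ℕ) where
  A : X →L[ℝ] X
  det_ne : A.det ≠ 0
  Y : (ι → ℂ) ≃ₗ[ℂ] (ι → ℂ)
  b : ι → ℝ
  b_inj : Function.Injective b
  b_ne : ∀ j, b j ≠ 0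
  weight : ∀ i j, Y.symm (Pi.single j 1) i ≠ 0 → k i = k j

/-- The linear functional `ε ↦ ∑ ε i * z i ^ q i`. -/
def weightedSum {ι : Type*} [Fintype ι] (q : ι → ℕ) (ε z : ι → ℂ) : ℂ := ∑ i, ε i * z i ^ q i

namespace LinModel
variable {X ι : Type*} [NormedAddCommGroup X] [NormedSpace ℝ X] [Fintype ι]
  [DecidableEq ι] {k : ι → ℕ} (M : LinModel X k)

/-- The operator on the weight spaces. -/
def op : (ι → ℂ) →ₗ[ℂ] (ι → ℂ) :=
  M.Y.symm.toLinearMap ∘ₗ (LinearMap.pi fun j => (M.b j : ℂ) • LinearMap.proj j) ∘ₗ M.Y.toLinearMap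

/-- The eigenvectors of `M.op`. -/
def vec (j : ι) : ι → ℂ := M.Y.symm (Pi.single j 1)

/-- The contribution of `M` to the degree. -/
noncomputable def index (q : ι → ℕ) : ℝ :=
  (SignType.sign M.A.det : ℝ) * ∑ j with M.b j < 0, (q j : ℝ)

lemma Y_op (z : ι → ℂ) (j : ι) : M.Y (M.op z) j = M.b j * M.Y z j := by
  simp [op]

lemma Y_vec (j : ι) : M.Y (M.vec j) = Pi.single j 1 := by simp [vec]

lemma vec_ne (j : ι) : M.vec j ≠ 0 := by
  intro h
  have := M.Y_vec j
  rw [h, map_zero] at this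
  simpa using congrFun this j

lemma op_vec (j : ι) : M.op (M.vec j) = (M.b j : ℂ) • M.vec j := by
  apply M.Y.injective
  funext i
  rw [Y_op, map_smul, Y_vec]
  by_cases h : i = j
  · subst h; simp
  · simp [h]

lemma eq_smul_vec {z : ι → ℂ} {j : ι} (h : ∀ i, i ≠ j → M.Y z i = 0) : z = M.Y z j • M.vec j := by
  apply M.Y.injective
  funext i
  rw [map_smul, Y_vec]
  by_cases hi : i = j
  · subst hi; simp
  · simp [hi, h i hi]

lemma exists_eq_smul_vec {z : ι → ℂ} (hz : z ≠ 0) {ν : ℂ} (h : ∀ i, M.op z i + ν * z i = 0) :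
    ∃ j, ∃ ζ : ℂ, ζ ≠ 0 ∧ z = ζ • M.vec j ∧ ν = -(M.b j : ℂ) := by
  have h1 : M.op z + ν • z = 0 := funext fun i => by simpa using h i
  have h2 : ∀ i, ((M.b i : ℂ) + ν) * M.Y z i = 0 := fun i => by
    have := congrFun (congrArg M.Y h1) i
    rw [map_add, Pi.add_apply, Y_op, map_smul, map_zero, Pi.smul_apply, smul_eq_mul] at this
    simpa [add_mul] using this
  obtain ⟨j, hj⟩ : ∃ j, M.Y z j ≠ 0 := by
    by_contra! hc
    exact hz (M.Y.injective (by rw [map_zero]; exact funext hc))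
  have hν : ν = -(M.b j : ℂ) := by
    have := (mul_eq_zero.1 (h2 j)).resolve_right hj
    linear_combination this
  refine ⟨j, M.Y z j, hj, M.eq_smul_vec fun i hi => ?_, hν⟩
  refine (mul_eq_zero.1 (h2 i)).resolve_left fun hc => hi (M.b_inj ?_)
  rw [hν] at hc
  have : (M.b i : ℂ) = M.b j := by linear_combination hc
  exact_mod_cast this

lemma op_injective {z : ι → ℂ} (h : M.op z = 0) : z = 0 := by
  by_contra hz
  obtain ⟨j, ζ, -, -, hν⟩ := M.exists_eq_smul_vec hz (ν := 0) (fun i => by simp [h])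
  exact M.b_ne j (by exact_mod_cast (neg_eq_zero.1 hν.symm))

lemma A_injective {x : X} [FiniteDimensional ℝ X] (h : M.A x = 0) : x = 0 :=
  (LinearMap.equivOfDetNeZero (M.A : X →ₗ[ℝ] X) M.det_ne).injective (by simpa using h)

variable {q : ι → ℕ} {K : ℕ}

lemma q_eq (hk : ∀ i, 1 ≤ k i) (hq : ∀ i, k i * q i = K) {i j : ι} (h : M.vec j i ≠ 0) :
    q i = q j := by
  have h1 := M.weight i j h
  have h2 := (hq i).trans (hq j).symm
  rw [h1] at h2
  exact Nat.eq_of_mul_eq_mul_left (hk j) h2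

lemma weightedSum_smul_vec (hk : ∀ i, 1 ≤ k i) (hq : ∀ i, k i * q i = K) (hq1 : ∀ i, 1 ≤ q i)
    (ε : ι → ℂ) (ζ : ℂ) (j : ι) :
    weightedSum q ε (ζ • M.vec j) = ζ ^ q j * weightedSum q ε (M.vec j) := by
  rw [weightedSum, weightedSum, Finset.mul_sum]
  refine Finset.sum_congr rfl fun i _ => ?_
  by_cases h : M.vec j i = 0
  · have := hq1 i
    simp [h, zero_pow (by omega : q i ≠ 0)]
  · rw [← M.q_eq hk hq h, Pi.smul_apply, smul_eq_mul, mul_pow]; ring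

end LinModel

lemma exists_weightedSum_ne_zero {X ι κ : Type*} [NormedAddCommGroup X] [NormedSpace ℝ X] [Fintype ι]
    [DecidableEq ι] [Finite κ] {k : ι → ℕ} (M : κ → LinModel X k) (q : ι → ℕ) :
    ∃ ε : ι → ℂ, ∀ a j, weightedSum q ε ((M a).vec j) ≠ 0 := by
  let f : κ × ι → Module.Dual ℂ (ι → ℂ) := fun a =>
    ∑ i, ((M a.1).vec a.2 i ^ q i) • LinearMap.proj i
  have hf : ∀ a ε, f a ε = weightedSum q ε ((M a.1).vec a.2) := fun a ε => by
    simp only [f, weightedSum, LinearMap.sum_apply, LinearMap.smul_apply, LinearMap.proj_apply,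
      smul_eq_mul]
    exact Finset.sum_congr rfl fun i _ => mul_comm _ _
  obtain ⟨ε, hε⟩ := Module.Dual.exists_forall_ne_zero_of_forall_exists f fun a => by
    obtain ⟨i, hi⟩ : ∃ i, (M a.1).vec a.2 i ≠ 0 := by
      by_contra! hc
      exact (M a.1).vec_ne a.2 (funext hc)
    refine ⟨Pi.single i 1, ?_⟩
    rw [hf, weightedSum, Finset.sum_eq_single i]
    · simp [hi]
    · intro m _ hm; simp [hm]
    · simp
  exact ⟨ε, fun a j => by rw [← hf (a, j)]; exact hε _⟩

lemma exists_roots {q : ℕ} (hq : 1 ≤ q) {w : ℂ} (hw : w ≠ 0) :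
    ∃ r : Fin q → ℂ, Function.Injective r ∧ ∀ ζ, ζ ^ q = w ↔ ∃ m, ζ = r m := by
  have hq0 : q ≠ 0 := by omega
  have : NeZero q := ⟨hq0⟩
  obtain ⟨z, hz⟩ := IsAlgClosed.exists_pow_nat_eq w (by omega : 0 < q)
  have hz0 : z ≠ 0 := by rintro rfl; exact hw (by rw [← hz, zero_pow hq0])
  have hη := Complex.isPrimitiveRoot_exp q hq0
  set η := Complex.exp (2 * π * Complex.I / q)
  refine ⟨fun m => z * η ^ (m : ℕ), fun a b hab => ?_, fun ζ => ⟨fun h => ?_, ?_⟩⟩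
  · exact Fin.ext (hη.pow_inj a.2 b.2 (mul_left_cancel₀ hz0 hab))
  · obtain ⟨i, hi, hi'⟩ := hη.eq_pow_of_pow_eq_one (ξ := ζ / z)
      (by rw [div_pow, h, hz, div_self hw])
    exact ⟨⟨i, hi⟩, by simp only; rw [hi']; field_simp⟩
  · rintro ⟨m, rfl⟩
    rw [mul_pow, ← pow_mul, mul_comm (m : ℕ), pow_mul, hη.pow_eq_one, one_pow, mul_one, hz]

lemma det_restrictScalars_pos {W : Type*} [AddCommGroup W] [Module ℂ W] [Module ℝ W]
    [IsScalarTower ℝ ℂ W] [FiniteDimensional ℂ W] (f : W →ₗ[ℂ] W) (hf : Function.Injective f) :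
    0 < LinearMap.det (f.restrictScalars ℝ) := by
  rw [LinearMap.det_restrictScalars, Algebra.norm_complex_apply, Complex.normSq_pos]
  have := LinearMap.isUnit_iff_ker_eq_bot f |>.2 (LinearMap.ker_eq_bot.2 hf)
  exact (LinearMap.isUnit_det f this).ne_zero

end

section
open MeasureTheory Set Topology Filter
open scoped ContDiff

section Sys
variable {X ι : Type*} [NormedAddCommGroup X] [NormedSpace ℝ X] [Fintype ι]

/-- The extended system with perturbation parameters. -/
def sysMap (v₀ : X × (ι → ℂ) → X) (vz : X × (ι → ℂ) → ι → ℂ) (q : ι → ℕ)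
    (P : X × (ι → ℂ) × (ι → ℂ)) (c : ℝ) (w : X × (ι → ℂ) × ℂ) : X × (ι → ℂ) × ℂ :=
  (v₀ (w.1, w.2.1) + P.1, fun i => vz (w.1, w.2.1) i + w.2.2 * w.2.1 i + P.2.1 i * w.2.1 i,
    weightedSum q P.2.2 w.2.1 + c)

lemma sysMap_eq_zero {v₀ : X × (ι → ℂ) → X} {vz : X × (ι → ℂ) → ι → ℂ} {q : ι → ℕ}
    {P : X × (ι → ℂ) × (ι → ℂ)} {c : ℝ} {w : X × (ι → ℂ) × ℂ} :
    sysMap v₀ vz q P c w = 0 ↔ v₀ (w.1, w.2.1) + P.1 = 0 ∧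
      (∀ i, vz (w.1, w.2.1) i + w.2.2 * w.2.1 i + P.2.1 i * w.2.1 i = 0) ∧
      weightedSum q P.2.2 w.2.1 + c = 0 := by
  simp only [sysMap, Prod.mk_eq_zero, funext_iff, Pi.zero_apply]

lemma continuous_weightedSum (q : ι → ℕ) :
    Continuous fun p : (ι → ℂ) × (ι → ℂ) => weightedSum q p.1 p.2 := by
  unfold weightedSum; fun_prop

lemma continuous_sysMap {v₀ : X × (ι → ℂ) → X} {vz : X × (ι → ℂ) → ι → ℂ} {q : ι → ℕ}
    (h₀ : Continuous v₀) (hz : Continuous vz) {Λ : Type*} [TopologicalSpace Λ]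
    {P : Λ → X × (ι → ℂ) × (ι → ℂ)} {c : Λ → ℝ} {w : Λ → X × (ι → ℂ) × ℂ}
    (hP : Continuous P) (hc : Continuous c) (hw : Continuous w) :
    Continuous fun l => sysMap v₀ vz q (P l) (c l) (w l) := by
  unfold sysMap
  refine (by fun_prop : Continuous _).prodMk (Continuous.prodMk ?_ ?_)
  · refine continuous_pi fun i => ?_
    fun_prop
  · exact ((continuous_weightedSum q).comp (by fun_prop : Continuous fun l => ((P l).2.2, (w l).2.1))).add
      (Complex.continuous_ofReal.comp hc)

variable [DecidableEq ι] [FiniteDimensional ℝ X] {k : ι → ℕ} (M : LinModel X k)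

/-- The derivative of the weight part of the extended system at a zero. -/
noncomputable def LinModel.weightDeriv (q : ι → ℕ) (ε : ι → ℂ) (z : ι → ℂ) (ν : ℂ) :
    ((ι → ℂ) × ℂ) →ₗ[ℂ] ((ι → ℂ) × ℂ) :=
  LinearMap.prod (M.op ∘ₗ LinearMap.fst ℂ _ _ + ν • LinearMap.fst ℂ _ _ +
    (LinearMap.snd ℂ _ _).smulRight z)
    (∑ i, (ε i * (q i * z i ^ (q i - 1))) • LinearMap.proj i ∘ₗ LinearMap.fst ℂ _ _)

lemma LinModel.weightDeriv_injective {q : ι → ℕ} {K : ℕ} (hk : ∀ i, 1 ≤ k i)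
    (hq : ∀ i, k i * q i = K) (hq1 : ∀ i, 1 ≤ q i) {ε : ι → ℂ} {j : ι}
    (hε : weightedSum q ε (M.vec j) ≠ 0) {ζ : ℂ} (hζ : ζ ≠ 0) :
    Function.Injective (M.weightDeriv q ε (ζ • M.vec j) (-(M.b j : ℂ))) := by
  rw [← LinearMap.ker_eq_bot, LinearMap.ker_eq_bot']
  rintro ⟨y, μ⟩ h
  have h1 : M.op y + (-(M.b j : ℂ)) • y + μ • ζ • M.vec j = 0 := congrArg Prod.fst h
  have h2 : ∑ i, (ε i * (q i * (ζ • M.vec j) i ^ (q i - 1))) * y i = 0 := by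
    have := congrArg Prod.snd h
    simpa [weightDeriv, LinearMap.sum_apply] using this
  have h3 : ∀ i, ((M.b i : ℂ) - M.b j) * M.Y y i + μ * ζ * (Pi.single j 1 : ι → ℂ) i = 0 := fun i => by
    have := congrFun (congrArg M.Y h1) i
    rw [map_add, map_add, Pi.add_apply, Pi.add_apply, M.Y_op, map_smul, map_smul, map_smul,
      map_zero, M.Y_vec] at this
    simp only [Pi.smul_apply, smul_eq_mul, Pi.zero_apply] at this
    linear_combination this
  have hμ : μ = 0 := by
    have := h3 j
    simpa [hζ] using this
  have hy : y = M.Y y j • M.vec j := M.eq_smul_vec fun i hi => by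
    have := h3 i
    simp only [hμ, zero_mul, add_zero] at this
    refine (mul_eq_zero.1 this).resolve_left fun hc => hi (M.b_inj ?_)
    exact_mod_cast sub_eq_zero.1 hc
  have h4 : ∑ i, (ε i * (q i * (ζ • M.vec j) i ^ (q i - 1))) * y i =
      q j * ζ ^ (q j - 1) * M.Y y j * weightedSum q ε (M.vec j) := by
    rw [weightedSum, Finset.mul_sum]
    refine Finset.sum_congr rfl fun i _ => ?_
    have hyi : y i = M.Y y j * M.vec j i := congrFun hy i
    rw [hyi]
    by_cases hv : M.vec j i = 0
    · simp [hv, zero_pow (by have := hq1 i; omega : q i ≠ 0)]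
    · rw [M.q_eq hk hq hv, Pi.smul_apply, smul_eq_mul, mul_pow]
      obtain ⟨m, hm⟩ := Nat.exists_eq_add_of_le' (hq1 j)
      rw [hm, Nat.add_sub_cancel, pow_succ (M.vec j i)]
      ring
  rw [h4] at h2
  have hqj : (q j : ℂ) ≠ 0 := by have := hq1 j; exact_mod_cast (by omega : q j ≠ 0)
  have hyj : M.Y y j = 0 := by
    simpa [hε, hqj, hζ] using h2
  rw [hyj, zero_smul] at hy
  rw [hy, hμ]; rfl

lemma hasFDerivAt_weightedSum (q : ι → ℕ) (ε z : ι → ℂ) :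
    HasFDerivAt (weightedSum q ε)
      (∑ i, (ε i * (q i * z i ^ (q i - 1))) • (ContinuousLinearMap.proj (R := ℂ) (φ := fun _ : ι => ℂ) i)) z := by
  unfold weightedSum
  refine HasFDerivAt.fun_sum fun i _ => ?_
  have h1 : HasFDerivAt (fun z : ι → ℂ => z i) (ContinuousLinearMap.proj (R := ℂ) (φ := fun _ : ι => ℂ) i) z :=
    hasFDerivAt_apply i z
  have := (h1.pow (q i)).const_mul (ε i)
  refine this.congr_fderiv ?_
  ext
  simp [mul_assoc]

/-- The derivative of the extended system at a zero in a linear zone. -/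
noncomputable def LinModel.fullDeriv (q : ι → ℕ) (ε : ι → ℂ) (z : ι → ℂ) (ν : ℂ) :
    (X × (ι → ℂ) × ℂ) →L[ℝ] (X × (ι → ℂ) × ℂ) :=
  M.A.prodMap (LinearMap.toContinuousLinearMap ((M.weightDeriv q ε z ν).restrictScalars ℝ))

lemma LinModel.sign_det_fullDeriv {q : ι → ℕ} {K : ℕ} (hk : ∀ i, 1 ≤ k i)
    (hq : ∀ i, k i * q i = K) (hq1 : ∀ i, 1 ≤ q i) {ε : ι → ℂ} {j : ι}
    (hε : weightedSum q ε (M.vec j) ≠ 0) {ζ : ℂ} (hζ : ζ ≠ 0) :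
    SignType.sign (M.fullDeriv q ε (ζ • M.vec j) (-(M.b j : ℂ))).det = SignType.sign M.A.det := by
  have h : (M.fullDeriv q ε (ζ • M.vec j) (-(M.b j : ℂ))).det = M.A.det *
      LinearMap.det ((M.weightDeriv q ε (ζ • M.vec j) (-(M.b j : ℂ))).restrictScalars ℝ) :=
    LinearMap.det_prodMap _ _
  rw [h, sign_mul, sign_pos (det_restrictScalars_pos _ (M.weightDeriv_injective hk hq hq1 hε hζ)), mul_one]

lemma LinModel.hasFDerivAt_fullDeriv (q : ι → ℕ) (ε : ι → ℂ) (c : ℝ) (p : X) (w : X × (ι → ℂ) × ℂ) :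
    HasFDerivAt (fun w : X × (ι → ℂ) × ℂ => ((M.A (w.1 - p), fun i => M.op w.2.1 i + w.2.2 * w.2.1 i,
      weightedSum q ε w.2.1 + c) : X × (ι → ℂ) × ℂ)) (M.fullDeriv q ε w.2.1 w.2.2) w := by
  have hop : HasFDerivAt (fun y : (ι → ℂ) × ℂ => M.op y.1)
      ((LinearMap.toContinuousLinearMap M.op).comp (ContinuousLinearMap.fst ℂ (ι → ℂ) ℂ)) w.2 :=
    ((LinearMap.toContinuousLinearMap M.op).comp (ContinuousLinearMap.fst ℂ (ι → ℂ) ℂ)).hasFDerivAt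
  have hf : HasFDerivAt (fun y : (ι → ℂ) × ℂ => y.1) (ContinuousLinearMap.fst ℂ (ι → ℂ) ℂ) w.2 :=
    hasFDerivAt_fst
  have hs : HasFDerivAt (fun y : (ι → ℂ) × ℂ => y.2) (ContinuousLinearMap.snd ℂ (ι → ℂ) ℂ) w.2 :=
    hasFDerivAt_snd
  have hsm := hs.fun_smul hf
  have hws := (hasFDerivAt_weightedSum q ε w.2.1).comp w.2 hf
  have hsnd := ((hop.add hsm).prodMk (hws.add_const (c : ℂ))).restrictScalars ℝ
  have hA : HasFDerivAt (fun x : X => M.A (x - p)) M.A w.1 := by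
    exact M.A.hasFDerivAt.comp w.1 ((hasFDerivAt_id w.1).sub_const p)
  have := hA.prodMap w hsnd
  refine this.congr_fderiv ?_
  refine ContinuousLinearMap.ext fun v => ?_
  refine Prod.ext rfl (Prod.ext ?_ ?_)
  · funext i
    simp [fullDeriv, weightDeriv]
    ring
  · simp [fullDeriv, weightDeriv]

end Sys

end

section
open MeasureTheory Set Topology Filter
open scoped ContDiff

section Box
variable {X ι : Type*} [NormedAddCommGroup X] [NormedSpace ℝ X] [Fintype ι]

/-- The closed box on which the extended system is studied. -/
def extBox (X ι : Type*) [NormedAddCommGroup X] [Fintype ι] (R C : ℝ) : Set (X × (ι → ℂ) × ℂ) :=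
  {w | ‖w.1‖ ≤ R ∧ ‖w.2.1‖ ≤ R ∧ 0 ≤ w.2.2.re ∧ ‖w.2.2‖ ≤ C}

/-- The open domain on which the extended system is studied. -/
def extDom (X ι : Type*) [NormedAddCommGroup X] [Fintype ι] (R C : ℝ) : Set (X × (ι → ℂ) × ℂ) :=
  {w | ‖w.1‖ < R ∧ ‖w.2.1‖ < R ∧ 0 < w.2.2.re ∧ ‖w.2.2‖ < C}

lemma isClosed_extBox (R C : ℝ) : IsClosed (extBox X ι R C) := by
  unfold extBox
  simp only [ofPred_and]
  exact (isClosed_le (by fun_prop) continuous_const).inter <|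
    (isClosed_le (by fun_prop) continuous_const).inter <|
    (isClosed_le continuous_const (Complex.continuous_re.comp (by fun_prop))).inter <|
    isClosed_le (by fun_prop) continuous_const

lemma isOpen_extDom (R C : ℝ) : IsOpen (extDom X ι R C) := by
  unfold extDom
  simp only [ofPred_and]
  exact (isOpen_lt (by fun_prop) continuous_const).inter <|
    (isOpen_lt (by fun_prop) continuous_const).inter <|
    (isOpen_lt continuous_const (Complex.continuous_re.comp (by fun_prop))).inter <|
    isOpen_lt (by fun_prop) continuous_const

lemma isBounded_extBox (R C : ℝ) : Bornology.IsBounded (extBox X ι R C) := by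
  refine (Metric.isBounded_closedBall (x := 0) (r := max R C)).subset fun w hw => ?_
  rw [mem_closedBall_zero_iff, Prod.norm_def, Prod.norm_def]
  exact max_le (hw.1.trans (le_max_left _ _)) (max_le (hw.2.1.trans (le_max_left _ _))
    (hw.2.2.2.trans (le_max_right _ _)))

lemma extDom_subset_extBox (R C : ℝ) : extDom X ι R C ⊆ extBox X ι R C :=
  fun _ h => ⟨h.1.le, h.2.1.le, h.2.2.1.le, h.2.2.2.le⟩

lemma closure_extDom_subset (R C : ℝ) : closure (extDom X ι R C) ⊆ extBox X ι R C :=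
  closure_minimal (extDom_subset_extBox R C) (isClosed_extBox R C)

lemma isBounded_extDom (R C : ℝ) : Bornology.IsBounded (extDom X ι R C) :=
  (isBounded_extBox R C).subset (extDom_subset_extBox R C)

lemma isCompact_extBox [FiniteDimensional ℝ X] (R C : ℝ) : IsCompact (extBox X ι R C) :=
  Metric.isCompact_of_isClosed_isBounded (isClosed_extBox R C) (isBounded_extBox R C)

lemma frontier_extDom {R C : ℝ} {w : X × (ι → ℂ) × ℂ} (hw : w ∈ frontier (extDom X ι R C)) :
    w ∈ extBox X ι R C ∧ (‖w.1‖ = R ∨ ‖w.2.1‖ = R ∨ w.2.2.re = 0 ∨ ‖w.2.2‖ = C) := by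
  rw [(isOpen_extDom R C).frontier_eq] at hw
  have h := closure_extDom_subset R C hw.1
  refine ⟨h, ?_⟩
  by_contra! hc
  exact hw.2 ⟨lt_of_le_of_ne h.1 hc.1, lt_of_le_of_ne h.2.1 hc.2.1,
    lt_of_le_of_ne h.2.2.1 (Ne.symm hc.2.2.1), lt_of_le_of_ne h.2.2.2 hc.2.2.2⟩

end Box

lemma eventually_forall_ne_zero {A B W : Type*} [TopologicalSpace A] [TopologicalSpace B]
    [TopologicalSpace W] [T1Space W] [Zero W] {Φ : A → B → W}
    (hΦ : Continuous fun p : A × B => Φ p.1 p.2) {K : Set B} (hK : IsCompact K) {a : A}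
    (h : ∀ b ∈ K, Φ a b ≠ 0) : ∀ᶠ a' in 𝓝 a, ∀ b ∈ K, Φ a' b ≠ 0 :=
  hK.eventually_forall_of_forall_eventually fun b hb =>
    hΦ.continuousAt.eventually_ne (h b hb)

/-- An equivariant system which is linear near its zeros and near infinity. -/
structure LinSys {X ι κ : Type*} [NormedAddCommGroup X] [NormedSpace ℝ X] [Fintype ι]
    [DecidableEq ι] (k : ι → ℕ) (v₀ : X × (ι → ℂ) → X) (vz : X × (ι → ℂ) → ι → ℂ) (p : κ → X)
    (M : κ → LinModel X k) (N : LinModel X k) (R₀ ρ : ℝ) : Prop where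
  lip₀ : LocallyLipschitz v₀
  lipz : LocallyLipschitz vz
  equiv₀ : ∀ x z (θ : ℂ), ‖θ‖ = 1 → v₀ (x, rot k θ z) = v₀ (x, z)
  equivz : ∀ x z (θ : ℂ), ‖θ‖ = 1 → vz (x, rot k θ z) = rot k θ (vz (x, z))
  orth : ∀ x z, ∑ i, (k i : ℝ) * (starRingEnd ℂ (z i) * vz (x, z) i).im = 0
  inj : Function.Injective p
  zeros : ∀ x z, v₀ (x, z) = 0 → vz (x, z) = 0 → ∃ i, x = p i ∧ z = 0
  rho_pos : 0 < ρ
  lin : ∀ i x z, ‖x - p i‖ < ρ → ‖z‖ < ρ → v₀ (x, z) = (M i).A (x - p i) ∧ vz (x, z) = (M i).op z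
  R_pos : 0 < R₀
  inf : ∀ x z, (R₀ ≤ ‖x‖ ∨ R₀ ≤ ‖z‖) → v₀ (x, z) = N.A x ∧ vz (x, z) = N.op z

namespace LinSys
variable {X ι κ : Type*} [NormedAddCommGroup X] [NormedSpace ℝ X] [Fintype ι]
    [DecidableEq ι] [FiniteDimensional ℝ X] {k : ι → ℕ} {v₀ : X × (ι → ℂ) → X} {vz : X × (ι → ℂ) → ι → ℂ} {p : κ → X}
    {M : κ → LinModel X k} {N : LinModel X k} {R₀ ρ : ℝ} (S : LinSys k v₀ vz p M N R₀ ρ)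
include S

lemma vz_zero (hk : ∀ i, 1 ≤ k i) (x : X) : vz (x, 0) = 0 := by
  funext i
  have hki : (k i : ℂ) ≠ 0 := by have := hk i; exact_mod_cast (by omega : k i ≠ 0)
  have hn : ‖Complex.exp ((π / k i : ℝ) * Complex.I)‖ = 1 := Complex.norm_exp_ofReal_mul_I _
  have h := congrFun (S.equivz x 0 _ hn) i
  have h0 : rot k (Complex.exp ((π / k i : ℝ) * Complex.I)) (0 : ι → ℂ) = 0 := by
    funext i; simp [rot]
  rw [h0, rot, ← Complex.exp_nat_mul] at h
  have h1 : (k i : ℂ) * (((π / k i : ℝ) : ℂ) * Complex.I) = π * Complex.I := by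
    push_cast; field_simp
  rw [h1, Complex.exp_pi_mul_I] at h
  have h2 : (2 : ℂ) * vz (x, 0) i = 0 := by linear_combination h
  simpa using h2

lemma v₀_ne {x : X} {z : ι → ℂ} (hx : R₀ ≤ ‖x‖) : v₀ (x, z) ≠ 0 := by
  rw [(S.inf x z (Or.inl hx)).1]
  intro h
  have := N.A_injective h
  rw [this, norm_zero] at hx
  exact absurd S.R_pos (not_lt.2 hx)

lemma z_zero_of_re {x : X} {z : ι → ℂ} {ν : ℂ} (hk : ∀ i, 1 ≤ k i) (hν : ν.re = 0) (h₀ : v₀ (x, z) = 0)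
    (h : ∀ i, vz (x, z) i + ν * z i = 0) : z = 0 := by
  by_contra hz
  have h1 : ∑ i, (k i : ℝ) * (ν.im * Complex.normSq (z i)) = 0 := by
    have := S.orth x z
    rw [← neg_eq_zero, ← this, ← Finset.sum_neg_distrib]
    refine Finset.sum_congr rfl fun i _ => ?_
    have hi : vz (x, z) i = -(ν * z i) := by linear_combination h i
    rw [hi]
    simp [Complex.normSq_apply, hν]
    ring
  have h2 : ν.im * ∑ i, (k i : ℝ) * Complex.normSq (z i) = 0 := by
    rw [← h1, Finset.mul_sum]
    exact Finset.sum_congr rfl fun i _ => by ring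
  obtain ⟨j, hj⟩ : ∃ j, z j ≠ 0 := by
    by_contra! hc; exact hz (funext hc)
  have h3 : 0 < ∑ i, (k i : ℝ) * Complex.normSq (z i) := by
    refine Finset.sum_pos' (fun i _ => mul_nonneg (Nat.cast_nonneg _) (Complex.normSq_nonneg _))
      ⟨j, Finset.mem_univ _, mul_pos ?_ (Complex.normSq_pos.2 hj)⟩
    have := hk j; exact_mod_cast this
  have h4 : ν = 0 := Complex.ext hν ((mul_eq_zero.1 h2).resolve_right h3.ne')
  obtain ⟨i, -, hzi⟩ := S.zeros x z h₀ (funext fun i => by simpa [h4] using h i)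
  exact hz hzi

lemma z_zero_of_norm {x : X} {z : ι → ℂ} {ν : ℂ} {R C : ℝ}
    (hC : ∀ x z, ‖x‖ ≤ R → ‖z‖ ≤ R → z ≠ 0 → ‖vz (x, z)‖ < C * ‖z‖) (hx : ‖x‖ ≤ R) (hzR : ‖z‖ ≤ R)
    (hν : ‖ν‖ = C) (h : ∀ i, vz (x, z) i + ν * z i = 0) : z = 0 := by
  by_contra hz
  have h1 := hC x z hx hzR hz
  have h2 : vz (x, z) = -(ν • z) := funext fun i => by
    simp only [Pi.neg_apply, Pi.smul_apply, smul_eq_mul]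
    linear_combination h i
  rw [h2, norm_neg, norm_smul, hν] at h1
  exact lt_irrefl _ h1

lemma p_norm_lt (i : κ) : ‖p i‖ < R₀ := by
  by_contra! h
  refine S.v₀_ne (z := 0) h ?_
  rw [(S.lin i (p i) 0 (by simpa using S.rho_pos) (by simpa using S.rho_pos)).1]
  simp

lemma b_lt {R C : ℝ} (hR : R₀ ≤ R) (hC : ∀ x z, ‖x‖ ≤ R → ‖z‖ ≤ R → z ≠ 0 → ‖vz (x, z)‖ < C * ‖z‖) (i : κ) (j : ι) :
    |(M i).b j| < C := by
  obtain ⟨s, hs, hs1⟩ : ∃ s : ℝ, 0 < s ∧ s * ‖(M i).vec j‖ < min ρ R := by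
    have hpos : 0 < min ρ R := lt_min S.rho_pos (S.R_pos.trans_le hR)
    have hv : 0 < ‖(M i).vec j‖ := norm_pos_iff.2 ((M i).vec_ne j)
    refine ⟨min ρ R / 2 / ‖(M i).vec j‖, by positivity, ?_⟩
    rw [div_mul_cancel₀ _ hv.ne']; linarith
  set z : ι → ℂ := (s : ℂ) • (M i).vec j with hz
  have hzn : ‖z‖ = s * ‖(M i).vec j‖ := by
    rw [hz, norm_smul, Complex.norm_real, Real.norm_of_nonneg hs.le]
  have hz0 : z ≠ 0 := smul_ne_zero (by exact_mod_cast hs.ne') ((M i).vec_ne j)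
  rw [← hzn] at hs1
  have h1 := hC (p i) z ((S.p_norm_lt i).le.trans hR) (hs1.le.trans (min_le_right _ _)) hz0
  rw [(S.lin i (p i) z (by simpa using S.rho_pos) (hs1.trans_le (min_le_left _ _))).2] at h1
  have h2 : (M i).op z = ((M i).b j : ℂ) • z := by
    rw [hz, map_smul, (M i).op_vec, smul_comm]
  rw [h2, norm_smul, Complex.norm_real, Real.norm_eq_abs] at h1
  exact lt_of_mul_lt_mul_right h1 (norm_nonneg _)

lemma exists_close (hk : ∀ i, 1 ≤ k i) [Finite κ] (R : ℝ) : ∃ t, 0 < t ∧ t < ρ ∧ t < R₀ ∧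
    ∀ x z, ‖x‖ ≤ R → ‖z‖ ≤ t → v₀ (x, z) = 0 → ∃ i, ‖x - p i‖ < ρ := by
  set Q : Set X := {x | ‖x‖ ≤ R ∧ ∀ i, ρ ≤ ‖x - p i‖} with hQ
  have hQc : IsCompact Q := by
    refine (isCompact_closedBall (0 : X) R).of_isClosed_subset ?_ fun x hx => by simpa using hx.1
    rw [hQ, ofPred_and, ofPred_forall]
    exact (isClosed_le continuous_norm continuous_const).inter
      (isClosed_iInter fun i => isClosed_le continuous_const (by fun_prop))
  have hc := S.lip₀.continuous
  have h := eventually_forall_ne_zero (Φ := fun (z : ι → ℂ) (x : X) => v₀ (x, z)) (by fun_prop) hQc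
    (a := 0) fun x hx h0 => by
      obtain ⟨i, hi, -⟩ := S.zeros x 0 h0 (S.vz_zero hk x)
      have := hx.2 i
      rw [hi, sub_self, norm_zero] at this
      exact absurd S.rho_pos (not_lt.2 this)
  obtain ⟨t, ht, ht'⟩ := Metric.eventually_nhds_iff_ball.1 h
  refine ⟨min (t / 2) (min (ρ / 2) (R₀ / 2)), ?_, ?_, ?_, ?_⟩
  · have := S.rho_pos; have := S.R_pos; positivity
  · have := S.rho_pos
    exact (min_le_right _ _).trans_lt ((min_le_left _ _).trans_lt (by linarith))
  · have := S.R_pos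
    exact (min_le_right _ _).trans_lt ((min_le_right _ _).trans_lt (by linarith))
  · intro x z hx hz h0
    by_contra! hcon
    refine ht' z ?_ x ⟨hx, hcon⟩ h0
    rw [mem_ball_zero_iff]
    exact (hz.trans (min_le_left _ _)).trans_lt (by linarith)

end LinSys

end

section
open MeasureTheory Set Topology Filter
open scoped ContDiff

section Cut
variable {X ι : Type*} [NormedAddCommGroup X] [NormedSpace ℝ X] [Fintype ι]

/-- A cut-off function, `0` for `‖z‖ ≤ t / 2` and `1` for `t ≤ ‖z‖`. -/
noncomputable def cutOff (t : ℝ) (z : ι → ℂ) : ℝ := max 0 (min 1 ((‖z‖ - t / 2) / (t / 2)))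

/-- The factor switching on the weighted sum near `‖z‖ = R`. -/
noncomputable def outerCut (R : ℝ) (z : ι → ℂ) : ℝ := max 0 (‖z‖ - (R - 1))

lemma cutOff_eq_zero {t : ℝ} (ht : 0 < t) {z : ι → ℂ} (hz : ‖z‖ ≤ t / 2) : cutOff t z = 0 := by
  refine max_eq_left (min_le_of_right_le ?_)
  exact div_nonpos_of_nonpos_of_nonneg (by linarith) (by linarith)

lemma cutOff_eq_one {t : ℝ} (ht : 0 < t) {z : ι → ℂ} (hz : t ≤ ‖z‖) : cutOff t z = 1 := by
  have : 1 ≤ (‖z‖ - t / 2) / (t / 2) := by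
    rw [le_div_iff₀ (by linarith)]; linarith
  rw [cutOff, min_eq_left this]; simp

lemma continuous_cutOff (t : ℝ) : Continuous (cutOff t : (ι → ℂ) → ℝ) := by
  unfold cutOff; fun_prop

lemma continuous_outerCut (R : ℝ) : Continuous (outerCut R : (ι → ℂ) → ℝ) := by
  unfold outerCut; fun_prop

/-- The parameters interpolating between the outer system (`s = 0`) and the generic one (`s = 1`). -/
noncomputable def homPar (ε₀ : ι → ℂ) (t R : ℝ) (P : X × (ι → ℂ) × (ι → ℂ)) (s : ℝ) (z : ι → ℂ) :
    X × (ι → ℂ) × (ι → ℂ) :=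
  ((s * cutOff t z) • P.1, (s * cutOff t z) • P.2.1,
    ((1 - s) * outerCut R z + s) • ε₀ + (s * cutOff t z) • (P.2.2 - ε₀))

lemma weightedSum_add (q : ι → ℕ) (ε ε' z : ι → ℂ) :
    weightedSum q (ε + ε') z = weightedSum q ε z + weightedSum q ε' z := by
  simp [weightedSum, add_mul, Finset.sum_add_distrib]

lemma weightedSum_smul (q : ι → ℕ) (r : ℝ) (ε z : ι → ℂ) :
    weightedSum q (r • ε) z = r * weightedSum q ε z := by
  simp [weightedSum, Finset.mul_sum, mul_assoc]

lemma weightedSum_zero_right (q : ι → ℕ) (hq1 : ∀ i, 1 ≤ q i) (ε : ι → ℂ) : weightedSum q ε 0 = 0 := by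
  refine Finset.sum_eq_zero fun i _ => ?_
  simp [zero_pow (by have := hq1 i; omega : q i ≠ 0)]

lemma sysMap_homPar (v₀ : X × (ι → ℂ) → X) (vz : X × (ι → ℂ) → ι → ℂ) (q : ι → ℕ) (ε₀ : ι → ℂ)
    (t R : ℝ) (P : X × (ι → ℂ) × (ι → ℂ)) (c s : ℝ) (w : X × (ι → ℂ) × ℂ) :
    sysMap v₀ vz q (homPar ε₀ t R P 0 w.2.1) c w +
      s • (sysMap v₀ vz q (homPar ε₀ t R P 1 w.2.1) c w - sysMap v₀ vz q (homPar ε₀ t R P 0 w.2.1) c w) =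
    sysMap v₀ vz q (homPar ε₀ t R P s w.2.1) c w := by
  refine Prod.ext ?_ (Prod.ext ?_ ?_)
  · simp only [sysMap, homPar, Prod.fst_add, Prod.smul_fst, Prod.fst_sub, zero_mul, zero_smul, add_zero,
      one_mul, add_sub_cancel_left, mul_smul]
  · funext i
    simp [sysMap, homPar]; ring
  · simp only [sysMap, homPar, Prod.snd_add, Prod.smul_snd, Prod.snd_sub, weightedSum_add,
      weightedSum_smul, Complex.real_smul]
    push_cast
    ring

lemma homPar_zero (ε₀ : ι → ℂ) (t R : ℝ) (P : X × (ι → ℂ) × (ι → ℂ)) (z : ι → ℂ) :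
    homPar ε₀ t R P 0 z = (0, 0, outerCut R z • ε₀) := by
  simp [homPar]

lemma homPar_base (ε₀ : ι → ℂ) (t R : ℝ) (s : ℝ) (z : ι → ℂ) :
    homPar ε₀ t R ((0, 0, ε₀) : X × (ι → ℂ) × (ι → ℂ)) s z = (0, 0, ((1 - s) * outerCut R z + s) • ε₀) := by
  simp [homPar]

lemma homPar_one_of_le (ε₀ : ι → ℂ) {t : ℝ} (ht : 0 < t) (R : ℝ) (P : X × (ι → ℂ) × (ι → ℂ)) {z : ι → ℂ}
    (hz : t ≤ ‖z‖) : homPar ε₀ t R P 1 z = P := by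
  refine Prod.ext ?_ (Prod.ext ?_ ?_) <;> simp [homPar, cutOff_eq_one ht hz]

lemma homPar_of_le (ε₀ : ι → ℂ) {t : ℝ} (ht : 0 < t) (R : ℝ) (P : X × (ι → ℂ) × (ι → ℂ)) (s : ℝ) {z : ι → ℂ}
    (hz : ‖z‖ ≤ t / 2) : homPar ε₀ t R P s z = (0, 0, ((1 - s) * outerCut R z + s) • ε₀) := by
  simp [homPar, cutOff_eq_zero ht hz]

lemma continuous_homPar (ε₀ : ι → ℂ) (t R : ℝ) :
    Continuous fun a : (X × (ι → ℂ) × (ι → ℂ)) × ℝ × (ι → ℂ) => homPar ε₀ t R a.1 a.2.1 a.2.2 := by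
  have h1 := continuous_cutOff (ι := ι) t
  have h2 := continuous_outerCut (ι := ι) R
  unfold homPar
  fun_prop

end Cut

namespace LinSys
variable {X ι κ : Type*} [NormedAddCommGroup X] [NormedSpace ℝ X] [Fintype ι]
    [DecidableEq ι] [FiniteDimensional ℝ X] {k : ι → ℕ} {v₀ : X × (ι → ℂ) → X} {vz : X × (ι → ℂ) → ι → ℂ} {p : κ → X}
    {M : κ → LinModel X k} {N : LinModel X k} {R₀ ρ : ℝ} (S : LinSys k v₀ vz p M N R₀ ρ)
include S

lemma wall_ne {q : ι → ℕ} {ε₀ : ι → ℂ} {R C : ℝ} (hk : ∀ i, 1 ≤ k i) (hR : R₀ ≤ R)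
    (hC : ∀ x z, ‖x‖ ≤ R → ‖z‖ ≤ R → z ≠ 0 → ‖vz (x, z)‖ < C * ‖z‖)
    {w : X × (ι → ℂ) × ℂ} (hw : w ∈ extBox X ι R C) (hwall : ‖w.1‖ = R ∨ w.2.2.re = 0 ∨ ‖w.2.2‖ = C)
    {c : ℝ} (hz : w.2.1 ≠ 0 ∨ weightedSum q ε₀ w.2.1 + c ≠ 0) : sysMap v₀ vz q (0, 0, ε₀) c w ≠ 0 := by
  rw [Ne, sysMap_eq_zero]
  rintro ⟨h0, h1, h2⟩
  have hz := hz.resolve_right (fun h => h h2)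
  simp only [Pi.zero_apply, zero_mul, add_zero] at h0 h1
  rcases hwall with h | h | h
  · exact S.v₀_ne (hR.trans h.ge) h0
  · exact hz (S.z_zero_of_re hk h h0 h1)
  · exact hz (S.z_zero_of_norm hC hw.1 hw.2.1 h h1)

lemma outer_ne {q : ι → ℕ} {K : ℕ} {ε₀ : ι → ℂ} (hk : ∀ i, 1 ≤ k i)
    (hq : ∀ i, k i * q i = K) (hq1 : ∀ i, 1 ≤ q i) (hεN : ∀ j, weightedSum q ε₀ (N.vec j) ≠ 0)
    {w : X × (ι → ℂ) × ℂ} (hw : R₀ ≤ ‖w.2.1‖) {r : ℝ} (hr : r ≠ 0) :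
    sysMap v₀ vz q (0, 0, r • ε₀) 0 w ≠ 0 := by
  rw [Ne, sysMap_eq_zero]
  rintro ⟨h0, h1, h2⟩
  simp only [Pi.zero_apply, zero_mul, add_zero, Complex.ofReal_zero] at h0 h1 h2
  rw [(S.inf _ _ (Or.inr hw)).2] at h1
  have hz : w.2.1 ≠ 0 := norm_pos_iff.1 (S.R_pos.trans_le hw)
  obtain ⟨j, ζ, hζ, hzj, -⟩ := N.exists_eq_smul_vec hz h1
  rw [weightedSum_smul, hzj, N.weightedSum_smul_vec hk hq hq1] at h2
  simp [hr, hζ, hεN j] at h2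

lemma inner_zero {x : X} {z : ι → ℂ} {ν : ℂ} {t R : ℝ}
    (ht : t < ρ) (hclose : ∀ x z, ‖x‖ ≤ R → ‖z‖ ≤ t → v₀ (x, z) = 0 → ∃ i, ‖x - p i‖ < ρ)
    (hx : ‖x‖ ≤ R) (hz : ‖z‖ ≤ t) (hz0 : z ≠ 0) (h0 : v₀ (x, z) = 0) (h1 : ∀ i, vz (x, z) i + ν * z i = 0) :
    ∃ i, x = p i ∧ ∃ j, ∃ ζ : ℂ, ζ ≠ 0 ∧ z = ζ • (M i).vec j ∧ ν = -((M i).b j : ℂ) := by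
  obtain ⟨i, hi⟩ := hclose x z hx hz h0
  have h := S.lin i x z hi (hz.trans_lt ht)
  rw [h.1] at h0
  rw [h.2] at h1
  exact ⟨i, sub_eq_zero.1 ((M i).A_injective h0), (M i).exists_eq_smul_vec hz0 h1⟩

lemma shell_ne {q : ι → ℕ} {K : ℕ} {ε₀ : ι → ℂ} (hk : ∀ i, 1 ≤ k i)
    (hq : ∀ i, k i * q i = K) (hq1 : ∀ i, 1 ≤ q i) (hε : ∀ i j, weightedSum q ε₀ ((M i).vec j) ≠ 0) {t R : ℝ}
    (ht : t < ρ) (hclose : ∀ x z, ‖x‖ ≤ R → ‖z‖ ≤ t → v₀ (x, z) = 0 → ∃ i, ‖x - p i‖ < ρ)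
    {w : X × (ι → ℂ) × ℂ} (hx : ‖w.1‖ ≤ R) (hz : ‖w.2.1‖ ≤ t) (hz0 : w.2.1 ≠ 0) :
    sysMap v₀ vz q (0, 0, ε₀) 0 w ≠ 0 := by
  rw [Ne, sysMap_eq_zero]
  rintro ⟨h0, h1, h2⟩
  simp only [Pi.zero_apply, zero_mul, add_zero, Complex.ofReal_zero] at h0 h1 h2
  obtain ⟨i, -, j, ζ, hζ, hzj, -⟩ := S.inner_zero ht hclose hx hz hz0 h0 h1
  rw [hzj, (M i).weightedSum_smul_vec hk hq hq1] at h2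
  simp [hζ, hε i j] at h2

variable [Fintype κ] [MeasurableSpace X] [BorelSpace X] [SecondCountableTopology X]

/-- The zeros of the generic system, all with small `z`, counted with sign. -/
lemma deg_inner {q : ι → ℕ} {K : ℕ} {ε₀ : ι → ℂ} (hk : ∀ i, 1 ≤ k i)
    (hq : ∀ i, k i * q i = K) (hq1 : ∀ i, 1 ≤ q i) (hε : ∀ i j, weightedSum q ε₀ ((M i).vec j) ≠ 0)
    {t R C : ℝ} (hR : R₀ ≤ R) (ht0 : 0 < t) (htR : t < R)
    (ht : t < ρ) (hclose : ∀ x z, ‖x‖ ≤ R → ‖z‖ ≤ t → v₀ (x, z) = 0 → ∃ i, ‖x - p i‖ < ρ)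
    (hC : ∀ x z, ‖x‖ ≤ R → ‖z‖ ≤ R → z ≠ 0 → ‖vz (x, z)‖ < C * ‖z‖)
    (P : X × (ι → ℂ) × (ι → ℂ)) {c : ℝ} (hc : 0 < c)
    (hcs : ∀ i j, c < ‖weightedSum q ε₀ ((M i).vec j)‖ * (t / 2 / ‖(M i).vec j‖) ^ q j)
    (hne : ∀ w ∈ extBox X ι R C, t / 2 ≤ ‖w.2.1‖ → sysMap v₀ vz q (homPar ε₀ t R P 1 w.2.1) c w ≠ 0) :
    deg (fun w => sysMap v₀ vz q (homPar ε₀ t R P 1 w.2.1) c w) (extDom X ι R C) = ∑ i, (M i).index q := by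
  classical
  have hΓ : ∀ i j, -(c : ℂ) / weightedSum q ε₀ ((M i).vec j) ≠ 0 := fun i j =>
    div_ne_zero (neg_ne_zero.2 (by exact_mod_cast hc.ne')) (hε i j)
  choose r hrinj hr using fun i j => exists_roots (hq1 j) (hΓ i j)
  have hr' : ∀ i j ζ, ζ ^ q j * weightedSum q ε₀ ((M i).vec j) + c = 0 ↔ ∃ m, ζ = r i j m := by
    intro i j ζ
    rw [← hr i j ζ, eq_div_iff (hε i j), eq_neg_iff_add_eq_zero]
  have hr0 : ∀ i j m, r i j m ≠ 0 := fun i j m h0 => by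
    have := (hr i j (r i j m)).2 ⟨m, rfl⟩
    rw [h0, zero_pow (by have := hq1 j; omega : q j ≠ 0)] at this
    exact hΓ i j this.symm
  have hrn : ∀ i j m, ‖r i j m • (M i).vec j‖ < t / 2 := fun i j m => by
    have hv : 0 < ‖(M i).vec j‖ := norm_pos_iff.2 ((M i).vec_ne j)
    rw [norm_smul, ← lt_div_iff₀ hv]
    refine lt_of_pow_lt_pow_left₀ (q j) (by positivity) ?_
    have := (hr i j (r i j m)).2 ⟨m, rfl⟩
    rw [← norm_pow, this, norm_div, norm_neg, Complex.norm_real, Real.norm_of_nonneg hc.le,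
      div_lt_iff₀' (norm_pos_iff.2 (hε i j))]
    exact hcs i j
  let a : (Σ i : κ, Σ j : {j // (M i).b j < 0}, Fin (q j)) → X × (ι → ℂ) × ℂ :=
    fun s => (p s.1, r s.1 s.2.1 s.2.2 • (M s.1).vec s.2.1, -((M s.1).b s.2.1 : ℂ))
  have hcont : Continuous fun w : X × (ι → ℂ) × ℂ => sysMap v₀ vz q (homPar ε₀ t R P 1 w.2.1) c w := by
    refine continuous_sysMap S.lip₀.continuous S.lipz.continuous ?_ continuous_const continuous_id
    exact (continuous_homPar ε₀ t R).comp (by fun_prop : Continuous fun w : X × (ι → ℂ) × ℂ => (P, (1:ℝ), w.2.1))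
  have hin : ∀ w : X × (ι → ℂ) × ℂ, ‖w.2.1‖ < t / 2 →
      sysMap v₀ vz q (homPar ε₀ t R P 1 w.2.1) c w = sysMap v₀ vz q (0, 0, ε₀) c w := fun w hw => by
    rw [homPar_of_le ε₀ ht0 R P 1 hw.le]; simp
  have hlin : ∀ i (w : X × (ι → ℂ) × ℂ), ‖w.1 - p i‖ < ρ → ‖w.2.1‖ < t / 2 →
      sysMap v₀ vz q (homPar ε₀ t R P 1 w.2.1) c w = ((M i).A (w.1 - p i), fun m => (M i).op w.2.1 m + w.2.2 * w.2.1 m,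
      weightedSum q ε₀ w.2.1 + c) := fun i w hw1 hw2 => by
    have h := S.lin i w.1 w.2.1 hw1 (by linarith)
    rw [hin w hw2, sysMap, h.1, h.2]
    simp
  rw [deg_eq_sum_sign hcont (isBounded_extDom R C) (isOpen_extDom R C) a ?_ ?_ ?_ ?_
    (fun s => (M s.1).fullDeriv q ε₀ (r s.1 s.2.1 s.2.2 • (M s.1).vec s.2.1) (-((M s.1).b s.2.1 : ℂ))) ?_ ?_]
  · rw [Fintype.sum_sigma]
    refine Finset.sum_congr rfl fun i _ => ?_
    rw [Fintype.sum_sigma]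
    simp only [(M i).sign_det_fullDeriv hk hq hq1 (hε i _) (hr0 i _ _), Finset.sum_const, Finset.card_univ,
      Fintype.card_fin, nsmul_eq_mul]
    rw [← Finset.sum_mul, mul_comm, LinModel.index]
    congr 1
    exact (Finset.sum_subtype (Finset.univ.filter fun j => (M i).b j < 0) (by simp) fun j => (q j : ℝ)).symm
  · rintro ⟨i, ⟨j, hj⟩, m⟩ ⟨i', ⟨j', hj'⟩, m'⟩ h
    obtain rfl : i = i' := S.inj (congrArg Prod.fst h)
    have h3 : -((M i).b j : ℂ) = -((M i).b j' : ℂ) := congrArg (fun w => w.2.2) h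
    obtain rfl : j = j' := (M i).b_inj (by exact_mod_cast neg_injective h3)
    have h2 : r i j m • (M i).vec j = r i j m' • (M i).vec j := congrArg (fun w => w.2.1) h
    obtain rfl : m = m' := hrinj i j (smul_left_injective ℂ ((M i).vec_ne j) h2)
    rfl
  · rintro ⟨i, ⟨j, hj⟩, m⟩
    refine ⟨(S.p_norm_lt i).trans_le hR, (hrn i j m).trans (by linarith), ?_, ?_⟩
    · simpa [a] using hj
    · simpa [a] using S.b_lt hR hC i j
  · rintro ⟨i, ⟨j, hj⟩, m⟩
    have hpi : ‖p i - p i‖ < ρ := by simpa using S.rho_pos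
    refine (hlin i (p i, r i j m • (M i).vec j, -((M i).b j : ℂ)) hpi (hrn i j m)).trans ?_
    refine Prod.ext ?_ (Prod.ext ?_ ?_)
    · simp
    · funext l
      simp only [map_smul, (M i).op_vec, Pi.smul_apply, smul_eq_mul, Prod.snd_zero, Prod.fst_zero, Pi.zero_apply]
      ring
    · simp only [(M i).weightedSum_smul_vec hk hq hq1]
      exact (hr' i j _).2 ⟨m, rfl⟩
  · intro w hw hw0
    have hwb := closure_extDom_subset R C hw
    have hz : ‖w.2.1‖ < t / 2 := by
      by_contra! h
      exact hne w hwb h hw0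
    rw [hin w hz, sysMap_eq_zero] at hw0
    simp only [Pi.zero_apply, zero_mul, add_zero] at hw0
    obtain ⟨h0, h1, h2⟩ := hw0
    have hz0 : w.2.1 ≠ 0 := fun h => by
      rw [h, weightedSum_zero_right q hq1, zero_add] at h2
      exact hc.ne' (by exact_mod_cast h2)
    obtain ⟨i, hxi, j, ζ, hζ, hzj, hν⟩ := S.inner_zero ht hclose hwb.1 (by linarith) hz0 h0 h1
    rw [hzj, (M i).weightedSum_smul_vec hk hq hq1, hr'] at h2
    obtain ⟨m, rfl⟩ := h2
    have hbj : (M i).b j < 0 := by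
      have := hwb.2.2.1
      rw [hν] at this
      simp only [Complex.neg_re, Complex.ofReal_re] at this
      exact lt_of_le_of_ne (by linarith) ((M i).b_ne j)
    exact ⟨⟨i, ⟨j, hbj⟩, m⟩, Prod.ext hxi (Prod.ext hzj hν)⟩
  · rintro ⟨i, ⟨j, hj⟩, m⟩ h0
    have h := (M i).sign_det_fullDeriv hk hq hq1 (hε i j) (hr0 i j m)
    rw [h0, _root_.sign_zero] at h
    exact (M i).det_ne (sign_eq_zero_iff.1 h.symm)
  · rintro ⟨i, ⟨j, hj⟩, m⟩
    have h0 := (M i).hasFDerivAt_fullDeriv q ε₀ c (p i) (p i, r i j m • (M i).vec j, -((M i).b j : ℂ))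
    refine HasFDerivAt.congr_of_eventuallyEq (x := (p i, r i j m • (M i).vec j, -((M i).b j : ℂ))) h0 ?_
    have e1 : ∀ᶠ w in 𝓝 (p i, r i j m • (M i).vec j, -((M i).b j : ℂ)), ‖w.1 - p i‖ < ρ :=
      (by fun_prop : Continuous fun w : X × (ι → ℂ) × ℂ => ‖w.1 - p i‖).continuousAt.eventually_lt
        continuousAt_const (by change ‖p i - p i‖ < ρ; simpa using S.rho_pos)
    have e2 : ∀ᶠ w in 𝓝 (p i, r i j m • (M i).vec j, -((M i).b j : ℂ)), ‖w.2.1‖ < t / 2 :=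
      (by fun_prop : Continuous fun w : X × (ι → ℂ) × ℂ => ‖w.2.1‖).continuousAt.eventually_lt
        continuousAt_const (hrn i j m)
    filter_upwards [e1, e2] with w h1 h2
    exact hlin i w h1 h2

end LinSys

end

section
open MeasureTheory Set Topology Filter
open scoped ContDiff

namespace LinSys
variable {X ι κ : Type*} [NormedAddCommGroup X] [NormedSpace ℝ X] [Fintype ι]
    [DecidableEq ι] [FiniteDimensional ℝ X] {k : ι → ℕ} {v₀ : X × (ι → ℂ) → X} {vz : X × (ι → ℂ) → ι → ℂ} {p : κ → X}
    {M : κ → LinModel X k} {N : LinModel X k} {R₀ ρ : ℝ} (S : LinSys k v₀ vz p M N R₀ ρ)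
    [Fintype κ] [MeasurableSpace X] [BorelSpace X] [SecondCountableTopology X]
include S

lemma eventually_deg_outer {q : ι → ℕ} {K : ℕ} {ε₀ : ι → ℂ} (hk : ∀ i, 1 ≤ k i)
    (hq : ∀ i, k i * q i = K) (hq1 : ∀ i, 1 ≤ q i) (hε : ∀ i j, weightedSum q ε₀ ((M i).vec j) ≠ 0)
    (hεN : ∀ j, weightedSum q ε₀ (N.vec j) ≠ 0) {R C : ℝ} (hR : R₀ + 2 ≤ R)
    (hC : ∀ x z, ‖x‖ ≤ R → ‖z‖ ≤ R → z ≠ 0 → ‖vz (x, z)‖ < C * ‖z‖) :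
    ∀ᶠ c : ℝ in 𝓝[>] 0, deg (fun w => sysMap v₀ vz q (0, 0, outerCut R w.2.1 • ε₀) c w) (extDom X ι R C) =
      ∑ i, (M i).index q ∧ ∀ w ∈ frontier (extDom X ι R C),
        sysMap v₀ vz q (0, 0, outerCut R w.2.1 • ε₀) c w ≠ 0 := by
  obtain ⟨t, ht0, htρ, htR, hclose⟩ := S.exists_close hk R
  have hR₀ := S.R_pos
  set Q₁ : Set ((X × (ι → ℂ) × ℂ) × ℝ) := ({w | w ∈ extBox X ι R C ∧ t / 2 ≤ ‖w.2.1‖ ∧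
    (‖w.1‖ = R ∨ w.2.2.re = 0 ∨ ‖w.2.2‖ = C)} ∪ {w | w ∈ extBox X ι R C ∧ ‖w.2.1‖ = R}) ×ˢ Icc 0 1 with hQ₁
  set Q₂ : Set ((X × (ι → ℂ) × ℂ) × ℝ) := {w | w ∈ extBox X ι R C ∧ t / 2 ≤ ‖w.2.1‖ ∧ ‖w.2.1‖ ≤ t} ×ˢ {1} with hQ₂
  have hbc := isCompact_extBox (X := X) (ι := ι) R C
  have hre : Continuous fun w : X × (ι → ℂ) × ℂ => w.2.2.re := Complex.continuous_re.comp (by fun_prop)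
  have hcl1 : IsClosed {w : X × (ι → ℂ) × ℂ | t / 2 ≤ ‖w.2.1‖} := isClosed_le continuous_const (by fun_prop)
  have hcl2 : IsClosed {w : X × (ι → ℂ) × ℂ | ‖w.2.1‖ = R} := isClosed_eq (by fun_prop) continuous_const
  have hcl3 : IsClosed {w : X × (ι → ℂ) × ℂ | ‖w.2.1‖ ≤ t} := isClosed_le (by fun_prop) continuous_const
  have hcl4 : IsClosed {w : X × (ι → ℂ) × ℂ | ‖w.1‖ = R ∨ w.2.2.re = 0 ∨ ‖w.2.2‖ = C} := by
    simp only [ofPred_or]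
    exact (isClosed_eq (by fun_prop) continuous_const).union
      ((isClosed_eq hre continuous_const).union (isClosed_eq (by fun_prop) continuous_const))
  have hQc : IsCompact (Q₁ ∪ Q₂) := by
    refine IsCompact.union ?_ ?_
    · refine IsCompact.prod (IsCompact.union ?_ ?_) isCompact_Icc
      · simp only [ofPred_and]
        exact hbc.inter_right (hcl1.inter hcl4)
      · simp only [ofPred_and]
        exact hbc.inter_right hcl2
    · refine IsCompact.prod ?_ isCompact_singleton
      simp only [ofPred_and]
      exact hbc.inter_right (hcl1.inter hcl3)
  let Φ : (X × (ι → ℂ) × (ι → ℂ)) × ℝ → (X × (ι → ℂ) × ℂ) × ℝ → X × (ι → ℂ) × ℂ := fun a b =>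
    sysMap v₀ vz q (homPar ε₀ t R a.1 b.2 b.1.2.1) a.2 b.1
  have hΦ : Continuous fun a : ((X × (ι → ℂ) × (ι → ℂ)) × ℝ) × ((X × (ι → ℂ) × ℂ) × ℝ) => Φ a.1 a.2 := by
    refine continuous_sysMap S.lip₀.continuous S.lipz.continuous ?_ (by fun_prop) (by fun_prop)
    exact (continuous_homPar ε₀ t R).comp (by fun_prop : Continuous fun a : ((X × (ι → ℂ) × (ι → ℂ)) × ℝ) ×
      ((X × (ι → ℂ) × ℂ) × ℝ) => (a.1.1, a.2.2, a.2.1.2.1))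
  have hz_of : ∀ {z : ι → ℂ}, t / 2 ≤ ‖z‖ → z ≠ 0 := fun h => norm_pos_iff.1 (by linarith)
  have hE1 : ∀ᶠ a : (X × (ι → ℂ) × (ι → ℂ)) × ℝ in 𝓝 (((0, 0, ε₀) : X × (ι → ℂ) × (ι → ℂ)), (0 : ℝ)),
      ∀ b ∈ Q₁ ∪ Q₂, Φ a b ≠ 0 := by
    refine eventually_forall_ne_zero hΦ hQc ?_
    rintro ⟨w, s⟩ hb
    simp only [Φ]
    rw [homPar_base]
    rcases hb with ⟨hw | hw, hs⟩ | ⟨hw, hs⟩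
    · exact S.wall_ne hk (by linarith) hC hw.1 hw.2.2 (Or.inl (hz_of hw.2.1))
    · have hw2 : ‖w.2.1‖ = R := hw.2
      have : outerCut R w.2.1 = 1 := by rw [outerCut, hw2]; simp
      rw [this, mul_one, sub_add_cancel]
      exact S.outer_ne hk hq hq1 hεN (by linarith) one_ne_zero
    · obtain rfl : s = 1 := hs
      rw [sub_self, zero_mul, zero_add, one_smul]
      exact S.shell_ne hk hq hq1 hε htρ hclose hw.1.1 hw.2.2 (hz_of hw.2.1)
  rw [nhds_prod_eq] at hE1
  obtain ⟨P, hP, hPgen⟩ := (mem_closure_iff_nhds.1 ((dense_compl_badParams k q K hk hq v₀ vz S.lip₀ S.lipz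
    S.equiv₀ S.equivz) (0, 0, ε₀))) _ hE1.curry
  have hE1' : ∀ᶠ c : ℝ in 𝓝 0, ∀ b ∈ Q₁ ∪ Q₂, Φ (P, c) b ≠ 0 := hP
  have hE2 : ∀ᶠ c : ℝ in 𝓝 0, ∀ w ∈ {w | w ∈ extBox X ι R C ∧ t ≤ ‖w.2.1‖}, Φ (P, c) (w, 1) ≠ 0 := by
    refine eventually_forall_ne_zero (Φ := fun c w => Φ (P, c) (w, 1)) ?_ ?_ ?_
    · exact hΦ.comp (by fun_prop : Continuous fun a : ℝ × (X × (ι → ℂ) × ℂ) => ((P, a.1), (a.2, (1 : ℝ))))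
    · simp only [ofPred_and]
      exact hbc.inter_right (isClosed_le continuous_const (by fun_prop))
    · rintro w ⟨-, hw⟩ h0
      simp only [Φ] at h0
      rw [homPar_one_of_le ε₀ ht0 R P hw, sysMap_eq_zero] at h0
      refine hPgen ⟨w.1, w.2.1, w.2.2, hz_of (by linarith), h0.1, h0.2.1, ?_⟩
      simpa [weightedSum] using h0.2.2
  have hE3 : ∀ᶠ c : ℝ in 𝓝 0, ∀ i j, c < ‖weightedSum q ε₀ ((M i).vec j)‖ * (t / 2 / ‖(M i).vec j‖) ^ q j := by
    refine eventually_all.2 fun i => eventually_all.2 fun j => ?_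
    have h1 : 0 < ‖(M i).vec j‖ := norm_pos_iff.2 ((M i).vec_ne j)
    have h2 : 0 < ‖weightedSum q ε₀ ((M i).vec j)‖ := norm_pos_iff.2 (hε i j)
    exact eventually_lt_nhds (by positivity)
  filter_upwards [nhdsWithin_le_nhds hE1', nhdsWithin_le_nhds hE2, nhdsWithin_le_nhds hE3, self_mem_nhdsWithin]
    with c h1 h2 h3 hc
  have hc0 : 0 < c := hc
  have hcont : ∀ s, Continuous fun w : X × (ι → ℂ) × ℂ => sysMap v₀ vz q (homPar ε₀ t R P s w.2.1) c w := fun s => by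
    refine continuous_sysMap S.lip₀.continuous S.lipz.continuous ?_ continuous_const continuous_id
    exact (continuous_homPar ε₀ t R).comp (by fun_prop : Continuous fun w : X × (ι → ℂ) × ℂ => (P, s, w.2.1))
  have hinner := S.deg_inner hk hq hq1 hε (R := R) (C := C) (by linarith) ht0 (by linarith) htρ hclose hC P hc0 h3
    (fun w hw hzw => by
      rcases le_total t ‖w.2.1‖ with h | h
      · exact h2 w ⟨hw, h⟩
      · exact h1 (w, 1) (Or.inr ⟨⟨hw, hzw, h⟩, rfl⟩))
  have hfr : ∀ w ∈ frontier (extDom X ι R C), ∀ s ∈ Icc (0:ℝ) 1,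
      sysMap v₀ vz q (homPar ε₀ t R P s w.2.1) c w ≠ 0 := by
    intro w hw s hs
    obtain ⟨hwb, hwall⟩ := frontier_extDom hw
    rcases le_or_gt (t / 2) ‖w.2.1‖ with h | h
    · refine h1 (w, s) (Or.inl ⟨?_, hs⟩)
      rcases hwall with hh | hh | hh
      · exact Or.inl ⟨hwb, h, Or.inl hh⟩
      · exact Or.inr ⟨hwb, hh⟩
      · exact Or.inl ⟨hwb, h, Or.inr hh⟩
    · rw [homPar_of_le ε₀ ht0 R P s h.le]
      refine S.wall_ne hk (by linarith) hC hwb ?_ ?_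
      · rcases hwall with hh | hh | hh
        · exact Or.inl hh
        · linarith
        · exact Or.inr hh
      · by_cases hz : w.2.1 = 0
        · right
          rw [hz, weightedSum_zero_right q hq1, zero_add]
          exact_mod_cast hc0.ne'
        · exact Or.inl hz
  have hhom := deg_homotopy (hcont 0) (hcont 1) (isOpen_extDom R C) (isBounded_extDom R C) (fun w hw s hs => by
    rw [sysMap_homPar]
    exact hfr w hw s hs)
  refine ⟨?_, fun w hw => by simpa only [homPar_zero] using hfr w hw 0 ⟨le_rfl, zero_le_one⟩⟩
  rw [← hinner, hhom]
  simp only [homPar_zero]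

end LinSys

section Main
variable {X ι κ : Type*} [NormedAddCommGroup X] [NormedSpace ℝ X] [Fintype ι]
    [DecidableEq ι] [FiniteDimensional ℝ X] {k : ι → ℕ}

/-- The linear system attached to a linear model. -/
lemma LinModel.linSys (N : LinModel X k) {R₀ : ℝ} (hR₀ : 0 < R₀)
    (horth : ∀ z, ∑ i, (k i : ℝ) * (starRingEnd ℂ (z i) * N.op z i).im = 0)
    (heq : ∀ z (θ : ℂ), ‖θ‖ = 1 → N.op (rot k θ z) = rot k θ (N.op z)) :
    LinSys k (fun w => N.A w.1) (fun w => N.op w.2) (fun _ : Unit => 0) (fun _ => N) N R₀ 1 where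
  lip₀ := (N.A.lipschitz.comp LipschitzWith.prod_fst).locallyLipschitz
  lipz := (((LinearMap.toContinuousLinearMap N.op).lipschitz).comp LipschitzWith.prod_snd).locallyLipschitz
  equiv₀ := fun _ _ _ _ => rfl
  equivz := fun _ z θ hθ => heq z θ hθ
  orth := fun _ z => horth z
  inj := fun _ _ _ => rfl
  zeros := fun _ _ h0 hz => ⟨(), N.A_injective h0, N.op_injective hz⟩
  rho_pos := one_pos
  lin := fun _ x z _ _ => by simp
  R_pos := hR₀
  inf := fun _ _ _ => ⟨rfl, rfl⟩

end Main

namespace LinSys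
variable {X ι κ : Type*} [NormedAddCommGroup X] [NormedSpace ℝ X] [Fintype ι]
    [DecidableEq ι] [FiniteDimensional ℝ X] {k : ι → ℕ} {v₀ : X × (ι → ℂ) → X} {vz : X × (ι → ℂ) → ι → ℂ} {p : κ → X}
    {M : κ → LinModel X k} {N : LinModel X k} {R₀ ρ : ℝ} (S : LinSys k v₀ vz p M N R₀ ρ)
    [Fintype κ] [MeasurableSpace X] [BorelSpace X] [SecondCountableTopology X]
include S

lemma linSys_inf : LinSys k (fun w => N.A w.1) (fun w => N.op w.2) (fun _ : Unit => 0) (fun _ => N) N R₀ 1 := by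
  have hrot : ∀ z (θ : ℂ), ‖θ‖ = 1 → ‖rot k θ z‖ = ‖z‖ := fun z θ hθ => by
    simp only [rot, Pi.norm_def]
    congr 2
    funext i
    rw [← NNReal.coe_inj, coe_nnnorm, norm_mul, norm_pow, hθ, one_pow, one_mul, coe_nnnorm]
  have hsc : ∀ z : ι → ℂ, z ≠ 0 → ∃ s : ℝ, 0 < s ∧ R₀ ≤ ‖(s : ℂ) • z‖ := fun z hz => by
    have hz' := norm_pos_iff.2 hz
    have hR := S.R_pos
    refine ⟨R₀ / ‖z‖, by positivity, ?_⟩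
    rw [norm_smul, Complex.norm_real, norm_of_nonneg (by positivity), div_mul_cancel₀ _ hz'.ne']
  refine N.linSys S.R_pos (fun z => ?_) (fun z θ hθ => ?_)
  · by_cases hz : z = 0
    · simp [hz]
    obtain ⟨s, hs, hsR⟩ := hsc z hz
    have h := S.orth 0 ((s : ℂ) • z)
    rw [(S.inf 0 _ (Or.inr hsR)).2, map_smul] at h
    have h2 : s ^ 2 * ∑ i, (k i : ℝ) * (starRingEnd ℂ (z i) * N.op z i).im = 0 := by
      rw [← h, Finset.mul_sum]
      refine Finset.sum_congr rfl fun i _ => ?_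
      simp
      ring
    exact (mul_eq_zero.1 h2).resolve_left (by positivity)
  · by_cases hz : z = 0
    · have : rot k θ (0 : ι → ℂ) = 0 := by funext i; simp [rot]
      rw [hz, map_zero, this, map_zero]
    obtain ⟨s, hs, hsR⟩ := hsc z hz
    have hs0 : (s : ℂ) ≠ 0 := by exact_mod_cast hs.ne'
    have h := S.equivz 0 ((s : ℂ) • z) θ hθ
    rw [(S.inf 0 _ (Or.inr hsR)).2, (S.inf 0 _ (Or.inr (by rwa [hrot _ _ hθ]))).2] at h
    have hr : ∀ y, rot k θ ((s : ℂ) • y) = (s : ℂ) • rot k θ y := fun y => by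
      funext i; simp only [rot, Pi.smul_apply, smul_eq_mul]; ring
    rw [hr, map_smul, map_smul, hr] at h
    exact smul_right_injective _ hs0 h

lemma exists_growth (hk : ∀ i, 1 ≤ k i) (R : ℝ) :
    ∃ C, ∀ x z, ‖x‖ ≤ R → ‖z‖ ≤ R → z ≠ 0 → ‖vz (x, z)‖ < C * ‖z‖ := by
  have hcpt : IsCompact (Metric.closedBall (0 : X × (ι → ℂ)) R) := isCompact_closedBall _ _
  obtain ⟨L, hL⟩ := (S.lipz.locallyLipschitzOn (s := Metric.closedBall (0 : X × (ι → ℂ)) R)).exists_lipschitzOnWith_of_compact hcpt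
  refine ⟨L + 1, fun x z hx hz hz0 => ?_⟩
  have h1 : (x, z) ∈ Metric.closedBall (0 : X × (ι → ℂ)) R := by
    rw [mem_closedBall_zero_iff, Prod.norm_def]; exact max_le hx hz
  have h2 : (x, (0 : ι → ℂ)) ∈ Metric.closedBall (0 : X × (ι → ℂ)) R := by
    rw [mem_closedBall_zero_iff, Prod.norm_def, norm_zero]; exact max_le hx ((norm_nonneg _).trans hx)
  have := hL.dist_le_mul _ h1 _ h2
  rw [S.vz_zero hk, dist_zero_right, dist_eq_norm, Prod.mk_sub_mk, sub_self, sub_zero, Prod.norm_def, norm_zero,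
    max_eq_right (norm_nonneg _)] at this
  have hzp : 0 < ‖z‖ := norm_pos_iff.2 hz0
  calc ‖vz (x, z)‖ ≤ L * ‖z‖ := this
    _ < (L + 1) * ‖z‖ := by nlinarith

lemma deg_outer_eq {q : ι → ℕ} {ε₀ : ι → ℂ} {R C c : ℝ} (hR : R₀ + 2 ≤ R) (hc0 : 0 < c)
    (hfr : ∀ w ∈ frontier (extDom X ι R C), sysMap v₀ vz q (0, 0, outerCut R w.2.1 • ε₀) c w ≠ 0) :
    deg (fun w => sysMap v₀ vz q (0, 0, outerCut R w.2.1 • ε₀) c w) (extDom X ι R C) =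
      deg (fun w => sysMap (fun w => N.A w.1) (fun w => N.op w.2) q (0, 0, outerCut R w.2.1 • ε₀) c w)
        (extDom X ι R C ∩ {w | R₀ < ‖w.2.1‖}) := by
  set U : Set (X × (ι → ℂ) × ℂ) := extDom X ι R C ∩ {w | R₀ < ‖w.2.1‖} with hU
  have hUo : IsOpen U := (isOpen_extDom _ _).inter (isOpen_lt continuous_const (by fun_prop))
  have h1 : deg (fun w => sysMap v₀ vz q (0, 0, outerCut R w.2.1 • ε₀) c w) (extDom X ι R C) =
      deg (fun w => sysMap v₀ vz q (0, 0, outerCut R w.2.1 • ε₀) c w) U := by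
    have := deg_additive (h := fun w => sysMap v₀ vz q (0, 0, outerCut R w.2.1 • ε₀) c w)
      (Ω := extDom X ι R C) (κ := Unit) ?_ (isBounded_extDom _ _) (isOpen_extDom _ _) (fun _ => U)
      (fun _ => hUo) (fun _ => inter_subset_left) ?_ ?_
    · simpa using this
    · refine continuous_sysMap S.lip₀.continuous S.lipz.continuous ?_ continuous_const continuous_id
      have := continuous_outerCut (ι := ι) R
      fun_prop
    · intro i j hij; exact absurd (Subsingleton.elim i j) hij
    · intro w hw hw0
      refine ⟨(), ?_, ?_⟩
      · by_contra hnot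
        refine hfr w ?_ hw0
        rw [(isOpen_extDom _ _).frontier_eq]; exact ⟨hw, hnot⟩
      · change R₀ < ‖w.2.1‖
        by_contra! h
        have h3 := (sysMap_eq_zero.1 hw0).2.2
        have : outerCut R w.2.1 = 0 := max_eq_left (by linarith)
        rw [this] at h3
        simp only [weightedSum, zero_smul, Pi.zero_apply, zero_mul, Finset.sum_const_zero, zero_add] at h3
        exact hc0.ne' (by exact_mod_cast h3)
  rw [h1]
  refine deg_congr fun w hw => ?_
  have hwU : R₀ ≤ ‖w.2.1‖ := by
    have hcl : IsClosed {w : X × (ι → ℂ) × ℂ | R₀ ≤ ‖w.2.1‖} := isClosed_le continuous_const (by fun_prop)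
    exact closure_minimal (fun w hw => (show R₀ < ‖w.2.1‖ from hw.2).le) hcl hw
  obtain ⟨ha, hb⟩ := S.inf w.1 w.2.1 (Or.inr hwU)
  simp only [sysMap, ha, hb]

/-- The `S¹`-degree identity. -/
theorem sum_index_eq {q : ι → ℕ} {K : ℕ} (hk : ∀ i, 1 ≤ k i) (hq : ∀ i, k i * q i = K) (hq1 : ∀ i, 1 ≤ q i) :
    ∑ i, (M i).index q = N.index q := by
  obtain ⟨ε₀, hε₀⟩ := exists_weightedSum_ne_zero (κ := Option κ) (fun a => a.elim N M) q
  have hε : ∀ i j, weightedSum q ε₀ ((M i).vec j) ≠ 0 := fun i j => hε₀ (some i) j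
  have hεN : ∀ j, weightedSum q ε₀ (N.vec j) ≠ 0 := fun j => hε₀ none j
  have S' := S.linSys_inf
  set R := R₀ + 2 with hR
  obtain ⟨C₁, hC₁⟩ := S.exists_growth hk R
  obtain ⟨C₂, hC₂⟩ := S'.exists_growth hk R
  have h1 := S.eventually_deg_outer hk hq hq1 hε hεN (C := max C₁ C₂) hR.ge fun x z hx hz hz0 =>
    (hC₁ x z hx hz hz0).trans_le (mul_le_mul_of_nonneg_right (le_max_left _ _) (norm_nonneg _))
  have h2 := S'.eventually_deg_outer hk hq hq1 (fun _ => hεN) hεN (C := max C₁ C₂) hR.ge fun x z hx hz hz0 =>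
    (hC₂ x z hx hz hz0).trans_le (mul_le_mul_of_nonneg_right (le_max_right _ _) (norm_nonneg _))
  obtain ⟨c, h1, h2, hc⟩ := (h1.and (h2.and self_mem_nhdsWithin)).exists
  have hc0 : (0:ℝ) < c := hc
  rw [Finset.univ_unique, Finset.sum_singleton] at h2
  rw [← h1.1, ← h2.1, S.deg_outer_eq hR.ge hc0 h1.2, S'.deg_outer_eq hR.ge hc0 h2.2]

end LinSys

end

section
open MeasureTheory Set Topology Filter
open scoped ContDiff

section Paste
variable {W κ : Type*} [NormedAddCommGroup W] [NormedSpace ℝ W] [Fintype κ]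

/-- Cut-off equal to `1` on the ball of radius `ρ` around `c` and to `0` outside the double ball. -/
noncomputable def nearCut (c : W) (ρ : ℝ) (w : W) : ℝ := max 0 (min 1 (2 - ‖w - c‖ / ρ))

/-- Cut-off equal to `0` on the ball of radius `R` and to `1` outside the double ball. -/
noncomputable def farCut (R : ℝ) (w : W) : ℝ := max 0 (min 1 (‖w‖ / R - 1))

lemma nearCut_nonneg (c : W) (ρ : ℝ) (w : W) : 0 ≤ nearCut c ρ w := le_max_left _ _
lemma nearCut_le_one (c : W) (ρ : ℝ) (w : W) : nearCut c ρ w ≤ 1 := max_le zero_le_one (min_le_left _ _)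
lemma farCut_nonneg (R : ℝ) (w : W) : 0 ≤ farCut R w := le_max_left _ _
lemma farCut_le_one (R : ℝ) (w : W) : farCut R w ≤ 1 := max_le zero_le_one (min_le_left _ _)

lemma nearCut_eq_one {c : W} {ρ : ℝ} (hρ : 0 < ρ) {w : W} (h : ‖w - c‖ ≤ ρ) : nearCut c ρ w = 1 := by
  have : ‖w - c‖ / ρ ≤ 1 := (div_le_one hρ).2 h
  rw [nearCut, min_eq_left (by linarith), max_eq_right zero_le_one]

lemma nearCut_eq_zero {c : W} {ρ : ℝ} (hρ : 0 < ρ) {w : W} (h : 2 * ρ ≤ ‖w - c‖) : nearCut c ρ w = 0 := by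
  have : 2 ≤ ‖w - c‖ / ρ := (le_div_iff₀ hρ).2 h
  exact max_eq_left ((min_le_right _ _).trans (by linarith))

lemma farCut_eq_one {R : ℝ} (hR : 0 < R) {w : W} (h : 2 * R ≤ ‖w‖) : farCut R w = 1 := by
  have : 2 ≤ ‖w‖ / R := (le_div_iff₀ hR).2 h
  rw [farCut, min_eq_left (by linarith), max_eq_right zero_le_one]

lemma farCut_eq_zero {R : ℝ} (hR : 0 < R) {w : W} (h : ‖w‖ ≤ R) : farCut R w = 0 := by
  have : ‖w‖ / R ≤ 1 := (div_le_one hR).2 h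
  exact max_eq_left ((min_le_right _ _).trans (by linarith))

lemma locallyLipschitz_nearCut (c : W) (ρ : ℝ) : LocallyLipschitz (nearCut c ρ) := by
  have h1 : LocallyLipschitz fun w : W => ‖w - c‖ :=
    (lipschitzWith_one_norm.comp (LipschitzWith.id.sub (LipschitzWith.const c))).locallyLipschitz
  have h2 : ContDiff ℝ 1 fun x : ℝ => 2 - x / ρ := by fun_prop
  exact (LocallyLipschitz.const 0).max ((LocallyLipschitz.const 1).min (h2.locallyLipschitz.comp h1))

lemma locallyLipschitz_farCut (R : ℝ) : LocallyLipschitz (farCut R : W → ℝ) := by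
  have h2 : ContDiff ℝ 1 fun x : ℝ => x / R - 1 := by fun_prop
  exact (LocallyLipschitz.const 0).max ((LocallyLipschitz.const 1).min
    (h2.locallyLipschitz.comp lipschitzWith_one_norm.locallyLipschitz))

/-- The centres of the linear zones; the zone at infinity is centred at `0`. -/
def zoneCenter (P : κ → W) (o : Option κ) : W := o.elim 0 P

/-- The cut-off functions of the linear zones. -/
noncomputable def zoneCut (P : κ → W) (ρ R : ℝ) (o : Option κ) (w : W) : ℝ :=
  o.elim (farCut R w) fun i => nearCut (P i) ρ w

/-- The map `v` made linear near the points `P i` and near infinity. -/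
noncomputable def pasteMap (v : W → W) (P : κ → W) (L : Option κ → W →L[ℝ] W) (ρ R : ℝ) (w : W) : W :=
  v w + ∑ o, zoneCut P ρ R o w • (L o (w - zoneCenter P o) - v w)

lemma zoneCut_nonneg (P : κ → W) (ρ R : ℝ) (o : Option κ) (w : W) : 0 ≤ zoneCut P ρ R o w := by
  cases o
  exacts [farCut_nonneg R w, nearCut_nonneg _ _ w]

lemma zoneCut_le_one (P : κ → W) (ρ R : ℝ) (o : Option κ) (w : W) : zoneCut P ρ R o w ≤ 1 := by
  cases o
  exacts [farCut_le_one R w, nearCut_le_one _ _ w]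

lemma locallyLipschitz_pasteMap [FiniteDimensional ℝ W] {v : W → W} (hv : LocallyLipschitz v) (P : κ → W)
    (L : Option κ → W →L[ℝ] W) (ρ R : ℝ) : LocallyLipschitz (pasteMap v P L ρ R) := by
  have h1 : ∀ o, LocallyLipschitz (zoneCut P ρ R o) := fun o => by
    cases o
    exacts [locallyLipschitz_farCut R, locallyLipschitz_nearCut _ _]
  have h2 : ∀ o, LocallyLipschitz fun w => zoneCut P ρ R o w • (L o (w - zoneCenter P o) - v w) := fun o => by
    have : ContDiff ℝ 1 fun a : ℝ × W × W => a.1 • (L o (a.2.1 - zoneCenter P o) - a.2.2) := by fun_prop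
    exact this.locallyLipschitz.comp ((h1 o).prodMk (LocallyLipschitz.id.prodMk hv))
  have hadd : ContDiff ℝ 1 fun a : W × W => a.1 + a.2 := by fun_prop
  have h3 : ∀ s : Finset (Option κ), LocallyLipschitz fun w =>
      ∑ o ∈ s, zoneCut P ρ R o w • (L o (w - zoneCenter P o) - v w) := fun s => by
    classical
    induction s using Finset.induction_on with
    | empty => simpa using LocallyLipschitz.const (0 : W)
    | insert a s ha ih =>
      simp only [Finset.sum_insert ha]
      exact hadd.locallyLipschitz.comp ((h2 a).prodMk ih)
  exact hadd.locallyLipschitz.comp (hv.prodMk (h3 Finset.univ))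

lemma pasteMap_of_zone {v : W → W} {P : κ → W} {L : Option κ → W →L[ℝ] W} {ρ R : ℝ} {w : W} {o : Option κ}
    (h : ∀ o', o' ≠ o → zoneCut P ρ R o' w = 0) :
    pasteMap v P L ρ R w = v w + zoneCut P ρ R o w • (L o (w - zoneCenter P o) - v w) := by
  rw [pasteMap, Finset.sum_eq_single o (fun o' _ ho' => by rw [h o' ho', zero_smul])
    (fun h => absurd (Finset.mem_univ o) h)]

/-- Making a map linear near its zeros and near infinity without creating new zeros. -/
lemma exists_pasteMap [FiniteDimensional ℝ W] {v : W → W} {P : κ → W} (hP : Function.Injective P)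
    (hv : ∀ w, v w = 0 → ∃ i, w = P i) {L₀ : Option κ → W →L[ℝ] W} (hL₀ : ∀ o, Function.Injective (L₀ o))
    (hnear : ∀ i, (fun w => v w - L₀ (some i) (w - P i)) =o[𝓝 (P i)] fun w => w - P i)
    (hfar : (fun w => v w - L₀ none w) =o[Bornology.cobounded W] fun w => w) :
    ∃ η > 0, ∀ L : Option κ → W →L[ℝ] W, (∀ o, ‖L o - L₀ o‖ ≤ η) → ∃ ρ R : ℝ, 0 < ρ ∧ 0 < R ∧
      (∀ w, pasteMap v P L ρ R w = 0 → ∃ i, w = P i) ∧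
      (∀ i w, ‖w - P i‖ < ρ → pasteMap v P L ρ R w = L (some i) (w - P i)) ∧
      (∀ w, 2 * R ≤ ‖w‖ → pasteMap v P L ρ R w = L none w) := by
  have hm : ∀ o, ∃ m > 0, ∀ y, m * ‖y‖ ≤ ‖L₀ o y‖ := fun o => by
    obtain ⟨K, hK, hK'⟩ := LinearMap.exists_antilipschitzWith (L₀ o : W →ₗ[ℝ] W) (LinearMap.ker_eq_bot.2 (hL₀ o))
    refine ⟨(K : ℝ)⁻¹, by positivity, fun y => ?_⟩
    have h1 := hK'.le_mul_dist y 0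
    rw [map_zero, dist_zero_right, dist_zero_right] at h1
    rw [inv_mul_le_iff₀ (by positivity)]
    exact h1
  choose m hm0 hm using hm
  obtain ⟨m', hm'0, hm'⟩ : ∃ m' > 0, ∀ o, m' ≤ m o := by
    obtain ⟨o, ho⟩ := Finite.exists_min m
    exact ⟨m o, hm0 o, ho⟩
  refine ⟨m' / 4, by positivity, fun L hL => ?_⟩
  have e1 : ∀ᶠ r in 𝓝[>] (0:ℝ), ∀ i, ∀ w, ‖w - P i‖ < 2 * r →
      ‖v w - L₀ (some i) (w - P i)‖ ≤ m' / 4 * ‖w - P i‖ := by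
    refine eventually_all.2 fun i => ?_
    obtain ⟨δ, hδ, h⟩ := Metric.eventually_nhds_iff.1 ((hnear i).def (c := m' / 4) (by positivity))
    filter_upwards [Ioo_mem_nhdsGT (show (0:ℝ) < δ / 2 by positivity)] with r hr w hw
    exact h (by rw [dist_eq_norm]; linarith [hr.2])
  have e2 : ∀ᶠ r in 𝓝[>] (0:ℝ), ∀ i j, i ≠ j → 4 * r < ‖P i - P j‖ := by
    refine eventually_all.2 fun i => eventually_all.2 fun j => ?_
    by_cases hij : i = j
    · simp [hij]
    · have : 0 < ‖P i - P j‖ := norm_pos_iff.2 (sub_ne_zero.2 (hP.ne hij))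
      filter_upwards [Ioo_mem_nhdsGT (show (0:ℝ) < ‖P i - P j‖ / 4 by positivity)] with r hr _
      linarith [hr.2]
  obtain ⟨ρ, e1, e2, hρ⟩ := (e1.and (e2.and self_mem_nhdsWithin)).exists
  have hρ0 : (0:ℝ) < ρ := hρ
  have e3 : ∀ᶠ R in atTop, ∀ w, R < ‖w‖ → ‖v w - L₀ none w‖ ≤ m' / 4 * ‖w‖ := by
    have := hfar.def (c := m' / 4) (by positivity)
    rw [← comap_norm_atTop, eventually_comap, eventually_atTop] at this
    obtain ⟨R, hR⟩ := this
    filter_upwards [eventually_ge_atTop R] with R' hR' w hw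
    exact hR _ (hR'.trans hw.le) w rfl
  have e4 : ∀ᶠ R in atTop, ∀ i, ‖P i‖ + 2 * ρ < R := eventually_all.2 fun i => eventually_gt_atTop _
  obtain ⟨R, e3, e4, hR⟩ := (e3.and (e4.and (eventually_gt_atTop (0:ℝ)))).exists
  have hnot : ∀ w o, zoneCut P ρ R o w ≠ 0 → ∀ o', o' ≠ o → zoneCut P ρ R o' w = 0 := by
    have hnear0 : ∀ {i w}, nearCut (P i) ρ w ≠ 0 → ‖w - P i‖ < 2 * ρ := fun {i w} h => by
      by_contra! hc; exact h (nearCut_eq_zero hρ0 hc)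
    rintro w (_ | i) h (_ | j) hne
    · exact absurd rfl hne
    · refine nearCut_eq_zero hρ0 ?_
      have : R < ‖w‖ := by by_contra! hc; exact h (farCut_eq_zero hR hc)
      have := e4 j
      have := norm_sub_norm_le w (P j)
      linarith
    · refine farCut_eq_zero hR ?_
      have := hnear0 h
      have := e4 i
      have := norm_sub_norm_le w (P i)
      linarith
    · refine nearCut_eq_zero hρ0 ?_
      have h1 := hnear0 h
      have h2 := e2 i j fun hc => hne (by rw [hc])
      have h3 : ‖P i - P j‖ ≤ ‖w - P i‖ + ‖w - P j‖ := by
        rw [norm_sub_rev w (P i)]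
        calc ‖P i - P j‖ = ‖(P i - w) + (w - P j)‖ := by congr 1; abel
          _ ≤ _ := norm_add_le _ _
      linarith
  refine ⟨ρ, R, hρ0, hR, fun w hw => ?_, fun i w hw => ?_, fun w hw => ?_⟩
  · by_cases hall : ∀ o, zoneCut P ρ R o w = 0
    · refine hv w ?_
      rw [pasteMap_of_zone (o := none) fun o' _ => hall o', hall, zero_smul, add_zero] at hw
      exact hw
    · push Not at hall
      obtain ⟨o, ho⟩ := hall
      rw [pasteMap_of_zone (hnot w o ho)] at hw
      have hest : ‖v w - L₀ o (w - zoneCenter P o)‖ ≤ m' / 4 * ‖w - zoneCenter P o‖ := by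
        rcases o with _ | i
        · simp only [zoneCenter, Option.elim, sub_zero]
          refine e3 w ?_
          by_contra! hc; exact ho (farCut_eq_zero hR hc)
        · refine e1 i w ?_
          by_contra! hc; exact ho (nearCut_eq_zero hρ0 hc)
      set y := w - zoneCenter P o with hy
      set c := zoneCut P ρ R o w with hc
      have hc0 : 0 ≤ c := zoneCut_nonneg P ρ R o w
      have hc1 : c ≤ 1 := zoneCut_le_one P ρ R o w
      have h1 : L₀ o y = -((1 - c) • (v w - L₀ o y) + c • (L o - L₀ o) y) := by
        rw [_root_.sub_apply, eq_neg_iff_add_eq_zero, ← hw]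
        module
      have h2 : ‖(L o - L₀ o) y‖ ≤ m' / 4 * ‖y‖ :=
        ((L o - L₀ o).le_opNorm y).trans (mul_le_mul_of_nonneg_right (hL o) (norm_nonneg _))
      have h3 : ‖L₀ o y‖ ≤ (1 - c) * (m' / 4 * ‖y‖) + c * (m' / 4 * ‖y‖) := by
        rw [h1, norm_neg]
        refine (norm_add_le _ _).trans (add_le_add ?_ ?_)
        · rw [norm_smul, norm_of_nonneg (by linarith)]
          exact mul_le_mul_of_nonneg_left hest (by linarith)
        · rw [norm_smul, norm_of_nonneg hc0]
          exact mul_le_mul_of_nonneg_left h2 hc0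
      have h4 := (mul_le_mul_of_nonneg_right (hm' o) (norm_nonneg y)).trans (hm o y)
      have h5 : y = 0 := by
        rw [← norm_eq_zero]
        nlinarith [norm_nonneg y]
      rcases o with _ | i
      · exfalso
        refine ho (farCut_eq_zero hR ?_)
        have : w = 0 := (sub_zero w).symm.trans h5
        rw [this, norm_zero]; exact hR.le
      · exact ⟨i, sub_eq_zero.1 h5⟩
  · have h1 : zoneCut P ρ R (some i) w = 1 := nearCut_eq_one hρ0 hw.le
    rw [pasteMap_of_zone (hnot w (some i) (by rw [h1]; exact one_ne_zero)), h1, one_smul]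
    simp [zoneCenter]
  · have h1 : zoneCut P ρ R none w = 1 := farCut_eq_one hR hw
    rw [pasteMap_of_zone (hnot w none (by rw [h1]; exact one_ne_zero)), h1, one_smul]
    simp [zoneCenter]

end Paste

end

section
open MeasureTheory Set Topology Filter
open scoped ContDiff

/-- A linear model without the assumption that the spectrum is simple, but with a unitary
diagonalization. -/
structure PreModel (X : Type*) [NormedAddCommGroup X] [NormedSpace ℝ X] {ι : Type*} [Fintype ι]
    [DecidableEq ι] (k : ι → ℕ) where
  A : X →L[ℝ] X
  det_ne : A.det ≠ 0
  Y : (ι → ℂ) ≃ₗ[ℂ] (ι → ℂ)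
  b : ι → ℝ
  b_ne : ∀ j, b j ≠ 0
  weight : ∀ i j, Y.symm (Pi.single j 1) i ≠ 0 → k i = k j
  comm : ∀ (θ : ℂ) z, Y (rot k θ z) = rot k θ (Y z)
  isom : ∀ z z', ∑ i, (k i : ℂ) * (starRingEnd ℂ (z i) * z' i) =
    ∑ j, (k j : ℂ) * (starRingEnd ℂ (Y z j) * Y z' j)

namespace PreModel
variable {X ι κ : Type*} [NormedAddCommGroup X] [NormedSpace ℝ X] [Fintype ι]
  [DecidableEq ι] {k : ι → ℕ} (G : PreModel X k)

/-- The operator on the weight spaces with prescribed spectrum. -/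
def diagOp (b : ι → ℝ) : (ι → ℂ) →ₗ[ℂ] (ι → ℂ) :=
  G.Y.symm.toLinearMap ∘ₗ (LinearMap.pi fun j => (b j : ℂ) • LinearMap.proj j) ∘ₗ G.Y.toLinearMap

lemma Y_diagOp (b : ι → ℝ) (z : ι → ℂ) (j : ι) : G.Y (G.diagOp b z) j = b j * G.Y z j := by
  simp [diagOp]

/-- The full linear map with prescribed spectrum on the weight spaces. -/
noncomputable def zoneMap (b : ι → ℝ) : X × (ι → ℂ) →L[ℝ] X × (ι → ℂ) :=
  G.A.prodMap (LinearMap.toContinuousLinearMap ((G.diagOp b).restrictScalars ℝ))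

lemma zoneMap_apply (b : ι → ℝ) (w : X × (ι → ℂ)) : G.zoneMap b w = (G.A w.1, G.diagOp b w.2) := rfl

lemma zoneMap_injective [FiniteDimensional ℝ X] {b : ι → ℝ} (hb : ∀ j, b j ≠ 0) : Function.Injective (G.zoneMap b) := by
  rw [injective_iff_map_eq_zero]
  rintro ⟨x, z⟩ h
  rw [zoneMap_apply, Prod.mk_eq_zero] at h
  refine Prod.ext ?_ ?_
  · have hu : IsUnit (G.A : X →ₗ[ℝ] X).det := isUnit_iff_ne_zero.2 G.det_ne
    have := (LinearMap.equivOfIsUnitDet hu).injective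
    apply this
    simpa using h.1
  · apply G.Y.injective
    funext j
    have := G.Y_diagOp b z j
    rw [h.2, map_zero, Pi.zero_apply, eq_comm, mul_eq_zero] at this
    simpa [hb j] using this

lemma diagOp_rot (b : ι → ℝ) (θ : ℂ) (z : ι → ℂ) : G.diagOp b (rot k θ z) = rot k θ (G.diagOp b z) := by
  apply G.Y.injective
  funext j
  rw [Y_diagOp, comm, comm]
  simp only [rot, Y_diagOp]
  ring

lemma diagOp_orth (b : ι → ℝ) (z : ι → ℂ) :
    ∑ i, (k i : ℝ) * (starRingEnd ℂ (z i) * G.diagOp b z i).im = 0 := by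
  have h := congrArg Complex.im (G.isom z (G.diagOp b z))
  rw [Complex.im_sum, Complex.im_sum] at h
  have h1 : ∀ i, ((k i : ℂ) * (starRingEnd ℂ (z i) * G.diagOp b z i)).im =
      (k i : ℝ) * (starRingEnd ℂ (z i) * G.diagOp b z i).im := fun i => by
    rw [← Complex.ofReal_natCast, Complex.im_ofReal_mul]
  simp only [h1] at h
  rw [h]
  refine Finset.sum_eq_zero fun j _ => ?_
  rw [Y_diagOp]
  have : (k j : ℂ) * (starRingEnd ℂ (G.Y z j) * ((b j : ℂ) * G.Y z j)) =
      ((k j * (b j * Complex.normSq (G.Y z j)) : ℝ) : ℂ) := by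
    push_cast
    rw [← Complex.mul_conj]
    ring
  rw [this, Complex.ofReal_im]

/-- The contribution of `G` to the degree. -/
noncomputable def index (q : ι → ℕ) : ℝ :=
  (SignType.sign G.A.det : ℝ) * ∑ j with G.b j < 0, (q j : ℝ)

lemma exists_perturbation {η : ℝ} (hη : 0 < η) : ∃ M : LinModel X k, M.A = G.A ∧ M.Y = G.Y ∧
    (∀ j, M.b j < 0 ↔ G.b j < 0) ∧ ‖G.zoneMap M.b - G.zoneMap G.b‖ ≤ η := by
  let e : ι → ℝ := fun j => (Fintype.equivFin ι j : ℕ)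
  have he : Function.Injective e := fun i j h => by
    have : ((Fintype.equivFin ι i : ℕ) : ℝ) = (Fintype.equivFin ι j : ℕ) := h
    exact (Fintype.equivFin ι).injective (Fin.ext (by exact_mod_cast this))
  let b : ℝ → ι → ℝ := fun s j => G.b j + s * e j
  have hcont : ∀ j, Continuous fun s => b s j := fun j => by simp only [b]; fun_prop
  have hb0 : ∀ j, b 0 j = G.b j := fun j => by simp [b]
  have e1 : ∀ᶠ s in 𝓝[>] (0:ℝ), ∀ i j, i ≠ j → b s i ≠ b s j := by
    refine eventually_all.2 fun i => eventually_all.2 fun j => ?_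
    by_cases hij : i = j
    · simp [hij]
    by_cases hbb : G.b i = G.b j
    · filter_upwards [self_mem_nhdsWithin] with s hs _ h
      have h' : s * e i = s * e j := by simpa [b, hbb] using h
      exact hij (he (mul_left_cancel₀ (ne_of_gt hs) h'))
    · have h1 : Continuous fun s => b s i - b s j := (hcont i).sub (hcont j)
      have := h1.continuousAt.eventually_ne (x := 0) (y := 0) (by rw [hb0, hb0]; exact sub_ne_zero.2 hbb)
      filter_upwards [nhdsWithin_le_nhds this] with s hs _ h
      exact hs (sub_eq_zero.2 h)
  have e2 : ∀ᶠ s in 𝓝[>] (0:ℝ), ∀ j, b s j ≠ 0 ∧ (b s j < 0 ↔ G.b j < 0) := by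
    refine eventually_all.2 fun j => nhdsWithin_le_nhds ?_
    rcases lt_or_gt_of_ne (G.b_ne j) with h | h
    · filter_upwards [(hcont j).continuousAt.eventually_lt (x₀ := 0) continuousAt_const (by rwa [hb0])] with s hs
      exact ⟨hs.ne, iff_of_true hs h⟩
    · filter_upwards [continuousAt_const.eventually_lt (x₀ := 0) (hcont j).continuousAt (by rwa [hb0])] with s hs
      exact ⟨hs.ne', iff_of_false hs.not_gt h.not_gt⟩
  have e3 : ∀ᶠ s in 𝓝[>] (0:ℝ), ‖G.zoneMap (b s) - G.zoneMap G.b‖ ≤ η := by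
    let D : X × (ι → ℂ) →L[ℝ] X × (ι → ℂ) :=
      (0 : X →L[ℝ] X).prodMap (LinearMap.toContinuousLinearMap ((G.diagOp e).restrictScalars ℝ))
    have hD : ∀ s, G.zoneMap (b s) - G.zoneMap G.b = s • D := fun s => by
      refine ContinuousLinearMap.ext fun w => ?_
      refine Prod.ext ?_ ?_
      · change G.A w.1 - G.A w.1 = s • (0 : X)
        rw [sub_self, smul_zero]
      · change G.diagOp (b s) w.2 - G.diagOp G.b w.2 = s • G.diagOp e w.2
        rw [← Complex.coe_smul]
        apply G.Y.injective
        funext j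
        rw [map_sub, map_smul, Pi.sub_apply, Pi.smul_apply, Y_diagOp, Y_diagOp, Y_diagOp, smul_eq_mul]
        simp only [b]
        push_cast
        ring
    have hc : Continuous fun s : ℝ => |s| * ‖D‖ := by fun_prop
    have := hc.continuousAt.eventually_lt (x₀ := (0:ℝ)) (g := fun _ => η) continuousAt_const (by simpa using hη)
    filter_upwards [nhdsWithin_le_nhds this] with s hs
    rw [hD, norm_smul, Real.norm_eq_abs]; exact hs.le
  obtain ⟨s, e1, e2, e3⟩ := (e1.and (e2.and e3)).exists
  exact ⟨⟨G.A, G.det_ne, G.Y, b s, fun i j h => by_contra fun hij => e1 i j hij h, fun j => (e2 j).1, G.weight⟩,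
    rfl, rfl, fun j => (e2 j).2, e3⟩

lemma index_eq {M : LinModel X k} (hA : M.A = G.A) (hb : ∀ j, M.b j < 0 ↔ G.b j < 0) (q : ι → ℕ) :
    M.index q = G.index q := by
  simp only [index, LinModel.index, hA, hb]

end PreModel

lemma norm_rot {ι : Type*} [Fintype ι] (k : ι → ℕ) {θ : ℂ} (hθ : ‖θ‖ = 1) (z : ι → ℂ) : ‖rot k θ z‖ = ‖z‖ := by
  simp only [rot, Pi.norm_def]
  congr 2
  funext i
  rw [← NNReal.coe_inj, coe_nnnorm, norm_mul, norm_pow, hθ, one_pow, one_mul, coe_nnnorm]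

/-- The `S¹`-degree identity for equivariant maps with nondegenerate linearizations at the zeros and
at infinity. -/
theorem sum_index_eq_of_asymptotics {X ι κ : Type*} [NormedAddCommGroup X] [NormedSpace ℝ X] [Fintype ι]
    [DecidableEq ι] [FiniteDimensional ℝ X] [Fintype κ] [MeasurableSpace X] [BorelSpace X]
    [SecondCountableTopology X] {k : ι → ℕ} {v : X × (ι → ℂ) → X × (ι → ℂ)} (hlip : LocallyLipschitz v)
    (hrot : ∀ x z (θ : ℂ), ‖θ‖ = 1 → v (x, rot k θ z) = ((v (x, z)).1, rot k θ (v (x, z)).2))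
    (horth : ∀ x z, ∑ i, (k i : ℝ) * (starRingEnd ℂ (z i) * (v (x, z)).2 i).im = 0)
    {P : κ → X} (hP : Function.Injective P) (hzeros : ∀ w, v w = 0 → ∃ i, w = (P i, 0))
    (G : Option κ → PreModel X k)
    (hnear : ∀ i, (fun w => v w - (G (some i)).zoneMap (G (some i)).b (w - (P i, 0))) =o[𝓝 (P i, 0)]
      fun w => w - (P i, 0))
    (hfar : (fun w => v w - (G none).zoneMap (G none).b w) =o[Bornology.cobounded _] fun w => w)
    {q : ι → ℕ} {K : ℕ} (hk : ∀ i, 1 ≤ k i) (hq : ∀ i, k i * q i = K) (hq1 : ∀ i, 1 ≤ q i) :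
    ∑ i, (G (some i)).index q = (G none).index q := by
  set P' : κ → X × (ι → ℂ) := fun i => (P i, 0) with hP'
  obtain ⟨η, hη, hpaste⟩ := exists_pasteMap (P := P') (fun i j h => hP (congrArg Prod.fst h)) hzeros
    (L₀ := fun o => (G o).zoneMap (G o).b) (fun o => (G o).zoneMap_injective (G o).b_ne) hnear hfar
  choose M hMA hMY hMb hM using fun o => (G o).exists_perturbation hη
  obtain ⟨ρ, R, hρ, hR, hz, hlin, hinf⟩ := hpaste (fun o => (G o).zoneMap (M o).b) hM
  set v' := pasteMap v P' (fun o => (G o).zoneMap (M o).b) ρ R with hv'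
  have hop : ∀ o, (M o).op = (G o).diagOp (M o).b := fun o => by
    rw [LinModel.op, PreModel.diagOp, hMY]
  have hcen : ∀ o, ∃ x, zoneCenter P' o = (x, 0) := by
    rintro (_ | i)
    exacts [⟨0, rfl⟩, ⟨P i, rfl⟩]
  choose cen hcen using hcen
  have hlip' : LocallyLipschitz v' := locallyLipschitz_pasteMap hlip _ _ _ _
  have hcut : ∀ o x z θ, ‖θ‖ = 1 → zoneCut P' ρ R o (x, rot k θ z) = zoneCut P' ρ R o (x, z) := by
    rintro (_ | i) x z θ hθ
    · simp only [zoneCut, Option.elim, farCut, Prod.norm_def, norm_rot k hθ]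
    · simp only [zoneCut, Option.elim, nearCut, hP', Prod.mk_sub_mk, sub_zero, Prod.norm_def, norm_rot k hθ]
  have hfst : ∀ x z, (v' (x, z)).1 = (v (x, z)).1 + ∑ o, zoneCut P' ρ R o (x, z) •
      ((G o).A (x - cen o) - (v (x, z)).1) := fun x z => by
    simp only [hv', pasteMap, Prod.fst_add, Prod.fst_sum, Prod.smul_fst, Prod.fst_sub, PreModel.zoneMap_apply, hcen]
  have hsnd : ∀ x z i, (v' (x, z)).2 i = (v (x, z)).2 i + ∑ o, (zoneCut P' ρ R o (x, z) : ℂ) *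
      ((G o).diagOp (M o).b z i - (v (x, z)).2 i) := fun x z i => by
    simp only [hv', pasteMap, Prod.snd_add, Prod.snd_sum, Prod.smul_snd, Prod.snd_sub, PreModel.zoneMap_apply, hcen,
      sub_zero, Pi.add_apply, Finset.sum_apply, Pi.smul_apply, Pi.sub_apply, Complex.real_smul]
  have S : LinSys k (fun w => (v' w).1) (fun w => (v' w).2) P (fun i => M (some i)) (M none) (2 * R) ρ :=
    { lip₀ := LipschitzWith.prod_fst.locallyLipschitz.comp hlip'
      lipz := LipschitzWith.prod_snd.locallyLipschitz.comp hlip'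
      equiv₀ := fun x z θ hθ => by
        simp only [hfst, hcut _ _ _ _ hθ, hrot x z θ hθ]
      equivz := fun x z θ hθ => by
        funext i
        simp only [hsnd, hcut _ _ _ _ hθ, hrot x z θ hθ, PreModel.diagOp_rot, rot, ← mul_sub]
        rw [mul_add, Finset.mul_sum]
        congr 1
        exact Finset.sum_congr rfl fun o _ => by ring
      orth := fun x z => by
        have h1 : ∀ i, (k i : ℝ) * (starRingEnd ℂ (z i) * (v' (x, z)).2 i).im =
            (k i : ℝ) * (starRingEnd ℂ (z i) * (v (x, z)).2 i).im + ∑ o, zoneCut P' ρ R o (x, z) *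
            ((k i : ℝ) * (starRingEnd ℂ (z i) * (G o).diagOp (M o).b z i).im -
              (k i : ℝ) * (starRingEnd ℂ (z i) * (v (x, z)).2 i).im) := fun i => by
          rw [hsnd, mul_add, Complex.add_im, mul_add, Finset.mul_sum, Complex.im_sum, Finset.mul_sum]
          congr 1
          refine Finset.sum_congr rfl fun o _ => ?_
          rw [mul_left_comm, Complex.im_ofReal_mul, mul_sub, Complex.sub_im]
          ring
        simp only [h1]
        rw [Finset.sum_add_distrib, horth, Finset.sum_comm, zero_add]
        refine Finset.sum_eq_zero fun o _ => ?_
        rw [← Finset.mul_sum, Finset.sum_sub_distrib, horth, PreModel.diagOp_orth, sub_zero, mul_zero]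
      inj := hP
      zeros := fun x z h0 h1 => by
        obtain ⟨i, hi⟩ := hz (x, z) (Prod.ext h0 h1)
        exact ⟨i, congrArg Prod.fst hi, congrArg Prod.snd hi⟩
      rho_pos := hρ
      lin := fun i x z hx hz => by
        have := hlin i (x, z) (by
          rw [hP', Prod.mk_sub_mk, sub_zero, Prod.norm_def]; exact max_lt hx hz)
        rw [this, hop, hMA, PreModel.zoneMap_apply]
        simp [hP']
      R_pos := by positivity
      inf := fun x z h => by
        have := hinf (x, z) (by rw [Prod.norm_def]; exact le_max_iff.2 h)
        rw [this, hop, hMA, PreModel.zoneMap_apply]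
        exact ⟨rfl, rfl⟩ }
  have := S.sum_index_eq hk hq hq1
  simpa only [PreModel.index_eq _ (hMA _) (hMb _)] using this

end

section
open MeasureTheory Set Topology Filter
open scoped ContDiff

/-- The exponential of frequency `m`. -/
noncomputable def wave (m : ℤ) (t : ℝ) : ℂ := Complex.exp ((m * t : ℝ) * Complex.I)

lemma norm_wave (m : ℤ) (t : ℝ) : ‖wave m t‖ = 1 := Complex.norm_exp_ofReal_mul_I _

@[fun_prop]
lemma continuous_wave (m : ℤ) : Continuous (wave m) := by unfold wave; fun_prop

lemma wave_mul (m m' : ℤ) (t : ℝ) : wave m t * wave m' t = wave (m + m') t := by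
  rw [wave, wave, wave, ← Complex.exp_add]; congr 1; push_cast; ring

lemma conj_wave (m : ℤ) (t : ℝ) : starRingEnd ℂ (wave m t) = wave (-m) t := by
  rw [wave, wave, ← Complex.exp_conj, map_mul, Complex.conj_ofReal, Complex.conj_I]; congr 1; push_cast; ring

lemma wave_add (m : ℤ) (t s : ℝ) : wave m (t + s) = wave m t * wave m s := by
  rw [wave, wave, wave, ← Complex.exp_add]; congr 1; push_cast; ring

lemma wave_natCast (k : ℕ) (s : ℝ) : wave k s = wave 1 s ^ k := by
  rw [wave, wave, ← Complex.exp_nat_mul]; congr 1; push_cast; ring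

lemma wave_two_pi (m : ℤ) : wave m (2 * π) = 1 := by
  rw [wave, ← Complex.exp_int_mul_two_pi_mul_I m]; congr 1; push_cast; ring

lemma wave_periodic (m : ℤ) : Function.Periodic (wave m) (2 * π) := fun t => by
  rw [wave_add, wave_two_pi, mul_one]

lemma wave_zero_left (t : ℝ) : wave 0 t = 1 := by simp [wave]

lemma hasDerivAt_wave (m : ℤ) (t : ℝ) : HasDerivAt (wave m) (m * Complex.I * wave m t) t := by
  have h1 : HasDerivAt (fun t : ℝ => ((m * t : ℝ) : ℂ) * Complex.I) (m * Complex.I) t := by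
    have := ((hasDerivAt_id t).const_mul (m : ℝ)).ofReal_comp.mul_const Complex.I
    simpa using this
  have := h1.cexp
  unfold wave
  rw [mul_comm]
  exact this

lemma integral_wave (m : ℤ) : ∫ t in (0:ℝ)..2 * π, wave m t = if m = 0 then (2 * π : ℂ) else 0 := by
  split_ifs with h
  · subst h; simp [wave_zero_left]
  · have hm : (m * Complex.I : ℂ) ≠ 0 := mul_ne_zero (by exact_mod_cast h) Complex.I_ne_zero
    have h1 := intervalIntegral.integral_eq_sub_of_hasDerivAt (a := 0) (b := 2 * π)
      (fun t _ => hasDerivAt_wave m t) (by apply Continuous.intervalIntegrable; fun_prop)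
    rw [intervalIntegral.integral_const_mul, wave_two_pi] at h1
    have h2 : wave m 0 = 1 := by simp [wave]
    rw [h2, sub_self] at h1
    exact (mul_eq_zero.1 h1).resolve_left hm

section Coef
variable {n : ℕ}

/-- The mean of a curve. -/
noncomputable def coefMean (h : ℝ → EuclideanSpace ℝ (Fin n)) : EuclideanSpace ℝ (Fin n) :=
  (2 * π)⁻¹ • ∫ t in (0:ℝ)..2 * π, h t

/-- The Fourier coefficients of a real function. -/
noncomputable def coef (k : ℕ) (h : ℝ → ℝ) : ℂ := (π : ℂ)⁻¹ * ∫ t in (0:ℝ)..2 * π, (h t : ℂ) * wave (-k) t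

/-- The trigonometric polynomial with given coefficients. -/
noncomputable def curve {N : ℕ} (w : EuclideanSpace ℝ (Fin n) × (Fin N × Fin n → ℂ)) (t : ℝ) :
    EuclideanSpace ℝ (Fin n) :=
  WithLp.toLp 2 fun l => w.1 l + ∑ i : Fin N, (w.2 (i, l) * wave ((i : ℕ) + 1 : ℕ) t).re

lemma curve_apply {N : ℕ} (w : EuclideanSpace ℝ (Fin n) × (Fin N × Fin n → ℂ)) (t : ℝ) (l : Fin n) :
    curve w t l = w.1 l + ∑ i : Fin N, (w.2 (i, l) * wave ((i : ℕ) + 1 : ℕ) t).re := rfl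

@[fun_prop]
lemma continuous_curve {N : ℕ} (w : EuclideanSpace ℝ (Fin n) × (Fin N × Fin n → ℂ)) : Continuous (curve w) := by
  unfold curve
  refine (PiLp.continuous_toLp 2 _).comp (continuous_pi fun l => ?_)
  refine continuous_const.add (continuous_finsetSum _ fun i _ => Complex.continuous_re.comp ?_)
  fun_prop

lemma curve_periodic {N : ℕ} (w : EuclideanSpace ℝ (Fin n) × (Fin N × Fin n → ℂ)) :
    Function.Periodic (curve w) (2 * π) := fun t => by
  ext l
  simp only [curve_apply, wave_periodic _ t]

lemma norm_le_of_coord {x : EuclideanSpace ℝ (Fin n)} {C : ℝ} (hx : ∀ l, |x l| ≤ C) : ‖x‖ ≤ n * C := by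
  have h1 : x = ∑ l, x l • EuclideanSpace.single l (1:ℝ) := by
    ext m
    simp [Pi.single_apply]
  rw [h1]
  refine (norm_sum_le _ _).trans ?_
  calc ∑ l : Fin n, ‖x l • EuclideanSpace.single l (1:ℝ)‖ ≤ ∑ _l : Fin n, C :=
        Finset.sum_le_sum fun l _ => by
          rw [norm_smul, PiLp.norm_single, norm_one, mul_one]; exact hx l
    _ = n * C := by simp

lemma abs_coord_le (x : EuclideanSpace ℝ (Fin n)) (l : Fin n) : |x l| ≤ ‖x‖ := PiLp.norm_apply_le x l

lemma norm_coefMean_le {h : ℝ → EuclideanSpace ℝ (Fin n)} {C : ℝ} (hC : ∀ t, ‖h t‖ ≤ C) : ‖coefMean h‖ ≤ C := by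
  have hp := pi_pos
  have h1 := intervalIntegral.norm_integral_le_of_norm_le_const (a := 0) (b := 2 * π) (f := h) (C := C)
    fun t _ => hC t
  rw [coefMean, norm_smul, norm_inv, norm_of_nonneg (by positivity), inv_mul_le_iff₀ (by positivity)]
  rw [sub_zero, abs_of_pos (by positivity)] at h1
  linarith

lemma norm_coef_le {h : ℝ → ℝ} {C : ℝ} (k : ℕ) (hC : ∀ t, |h t| ≤ C) : ‖coef k h‖ ≤ 2 * C := by
  have hp := pi_pos
  have h1 := intervalIntegral.norm_integral_le_of_norm_le_const (a := 0) (b := 2 * π)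
    (f := fun t => (h t : ℂ) * wave (-k) t) (C := C)
    fun t _ => by rw [norm_mul, norm_wave, mul_one, Complex.norm_real]; exact hC t
  rw [coef, norm_mul, norm_inv, Complex.norm_real, norm_of_nonneg hp.le, inv_mul_le_iff₀ hp]
  rw [sub_zero, abs_of_pos (by positivity)] at h1
  linarith

lemma coefMean_sub {h h' : ℝ → EuclideanSpace ℝ (Fin n)} (hh : Continuous h) (hh' : Continuous h') :
    coefMean (fun t => h t - h' t) = coefMean h - coefMean h' := by
  rw [coefMean, coefMean, coefMean, intervalIntegral.integral_sub (hh.intervalIntegrable _ _)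
    (hh'.intervalIntegrable _ _), smul_sub]

lemma coef_sub {h h' : ℝ → ℝ} (hh : Continuous h) (hh' : Continuous h') (k : ℕ) :
    coef k (fun t => h t - h' t) = coef k h - coef k h' := by
  rw [coef, coef, coef, ← mul_sub, ← intervalIntegral.integral_sub]
  · congr 2
    funext t
    push_cast
    ring
  all_goals
    apply Continuous.intervalIntegrable
    fun_prop

lemma coef_sum {κ : Type*} (s : Finset κ) (c : κ → ℝ) {h : κ → ℝ → ℝ} (hh : ∀ i, Continuous (h i)) (k : ℕ) :
    coef k (fun t => ∑ i ∈ s, c i * h i t) = ∑ i ∈ s, (c i : ℂ) * coef k (h i) := by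
  simp only [coef]
  rw [← intervalIntegral.integral_congr (g := fun t => ∑ i ∈ s, (c i : ℂ) * ((h i t : ℂ) * wave (-k) t)) (f := _)
    (fun t _ => by push_cast; rw [Finset.sum_mul]; exact Finset.sum_congr rfl fun i _ => by ring) |>.symm]
  rw [intervalIntegral.integral_finsetSum]
  · rw [Finset.mul_sum]
    refine Finset.sum_congr rfl fun i _ => ?_
    rw [intervalIntegral.integral_const_mul]
    ring
  · intro i _
    have := hh i
    apply Continuous.intervalIntegrable
    fun_prop

lemma coef_curve {N : ℕ} (w : EuclideanSpace ℝ (Fin n) × (Fin N × Fin n → ℂ)) (i : Fin N) (l : Fin n) :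
    coef (i + 1) (fun t => curve w t l) = w.2 (i, l) := by
  have hp : (π : ℂ) ≠ 0 := by exact_mod_cast pi_ne_zero
  have h1 : ∀ t, ((curve w t l : ℝ) : ℂ) * wave (-((i + 1 : ℕ) : ℤ)) t = (w.1 l : ℂ) * wave (-((i + 1 : ℕ) : ℤ)) t +
      ∑ j : Fin N, (w.2 (j, l) / 2 * wave (((j + 1 : ℕ) : ℤ) - ((i + 1 : ℕ) : ℤ)) t +
        starRingEnd ℂ (w.2 (j, l)) / 2 * wave (-((j + 1 : ℕ) : ℤ) - ((i + 1 : ℕ) : ℤ)) t) := fun t => by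
    rw [curve_apply, Complex.ofReal_add, add_mul, Complex.ofReal_sum, Finset.sum_mul]
    congr 1
    refine Finset.sum_congr rfl fun j _ => ?_
    rw [sub_eq_add_neg, sub_eq_add_neg, ← wave_mul, ← wave_mul, Complex.re_eq_add_conj, map_mul, conj_wave]
    ring
  rw [coef, intervalIntegral.integral_congr fun t _ => h1 t, intervalIntegral.integral_add,
    intervalIntegral.integral_const_mul, integral_wave, if_neg (by omega), mul_zero, zero_add,
    intervalIntegral.integral_finsetSum]
  · rw [Finset.sum_eq_single i]
    · rw [intervalIntegral.integral_add, intervalIntegral.integral_const_mul, intervalIntegral.integral_const_mul,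
        integral_wave, integral_wave, if_pos (by omega), if_neg (by omega)]
      · field_simp
        ring
      all_goals
        apply Continuous.intervalIntegrable
        fun_prop
    · intro j _ hj
      have hj' : (j : ℕ) ≠ i := fun h => hj (Fin.ext h)
      rw [intervalIntegral.integral_add, intervalIntegral.integral_const_mul, intervalIntegral.integral_const_mul,
        integral_wave, integral_wave, if_neg (by omega), if_neg (by omega)]
      · simp
      all_goals
        apply Continuous.intervalIntegrable
        fun_prop
    · simp
  all_goals
    intros
    apply Continuous.intervalIntegrable
    fun_prop

lemma coefMean_apply {h : ℝ → EuclideanSpace ℝ (Fin n)} (hh : Continuous h) (l : Fin n) :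
    coefMean h l = (2 * π)⁻¹ * ∫ t in (0:ℝ)..2 * π, h t l := by
  have := (EuclideanSpace.proj (𝕜 := ℝ) l).intervalIntegral_comp_comm (hh.intervalIntegrable (0:ℝ) (2 * π) (μ := volume))
  rw [coefMean, PiLp.smul_apply, smul_eq_mul]
  congr 1
  exact this.symm

lemma coefMean_curve {N : ℕ} (w : EuclideanSpace ℝ (Fin n) × (Fin N × Fin n → ℂ)) : coefMean (curve w) = w.1 := by
  have hp := pi_pos
  ext l
  rw [coefMean_apply (continuous_curve w)]
  simp only [curve_apply]
  rw [intervalIntegral.integral_add, intervalIntegral.integral_finsetSum]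
  · rw [Finset.sum_eq_zero]
    · rw [intervalIntegral.integral_const, sub_zero, add_zero, smul_eq_mul]
      field_simp
    · intro i _
      have h1 := Complex.reCLM.intervalIntegral_comp_comm (μ := volume) (a := 0) (b := 2 * π)
        (f := fun t => w.2 (i, l) * wave ((i : ℕ) + 1 : ℕ) t) (by apply Continuous.intervalIntegrable; fun_prop)
      rw [intervalIntegral.integral_const_mul, integral_wave, if_neg (by omega), mul_zero, map_zero] at h1
      exact h1
  · intro i _
    apply Continuous.intervalIntegrable
    exact Complex.continuous_re.comp (by fun_prop)
  · apply Continuous.intervalIntegrable; fun_prop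
  · apply Continuous.intervalIntegrable
    exact continuous_finsetSum _ fun i _ => Complex.continuous_re.comp (by fun_prop)

lemma coefMean_clm (L : EuclideanSpace ℝ (Fin n) →L[ℝ] EuclideanSpace ℝ (Fin n))
    {h : ℝ → EuclideanSpace ℝ (Fin n)} (hh : Continuous h) : coefMean (fun t => L (h t)) = L (coefMean h) := by
  rw [coefMean, coefMean, map_smul, L.intervalIntegral_comp_comm (hh.intervalIntegrable _ _)]

end Coef

end

section
open MeasureTheory Set Topology Filter
open scoped ContDiff

/-- An orthonormal diagonalization of a nondegenerate, nonresonant linear map. -/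
structure SpecData (n : ℕ) where
  L : EuclideanSpace ℝ (Fin n) →L[ℝ] EuclideanSpace ℝ (Fin n)
  e : OrthonormalBasis (Fin n) ℝ (EuclideanSpace ℝ (Fin n))
  a : Fin n → ℝ
  eig : ∀ l x, ⟪e l, L x⟫ = a l * ⟪e l, x⟫
  a_ne : ∀ l, a l ≠ 0
  res : ∀ l, ∀ k : ℕ, 1 ≤ k → a l ≠ (k : ℝ) ^ 2

/-- The weights of the Fourier modes. -/
def freq (N n : ℕ) (i : Fin N × Fin n) : ℕ := i.1 + 1

section Gal
variable {n : ℕ}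

/-- The Fourier coefficients of a curve up to order `N`. -/
noncomputable def fourierPart (N : ℕ) (h : ℝ → EuclideanSpace ℝ (Fin n)) :
    EuclideanSpace ℝ (Fin n) × (Fin N × Fin n → ℂ) :=
  (coefMean h, fun i => coef (i.1 + 1) fun t => h t i.2)

/-- The Galerkin approximation of order `N` of `u'' + f u = 0`. -/
noncomputable def gal {N : ℕ} (f : EuclideanSpace ℝ (Fin n) → EuclideanSpace ℝ (Fin n))
    (w : EuclideanSpace ℝ (Fin n) × (Fin N × Fin n → ℂ)) : EuclideanSpace ℝ (Fin n) × (Fin N × Fin n → ℂ) :=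
  (0, fun i => (freq N n i : ℂ) ^ 2 * w.2 i) - fourierPart N fun t => f (curve w t)

lemma fourierPart_sub (N : ℕ) {h h' : ℝ → EuclideanSpace ℝ (Fin n)} (hh : Continuous h) (hh' : Continuous h') :
    fourierPart N (fun t => h t - h' t) = fourierPart N h - fourierPart N h' := by
  refine Prod.ext (coefMean_sub hh hh') (funext fun i => ?_)
  exact coef_sub (h := fun t => h t i.2) (h' := fun t => h' t i.2) (by fun_prop) (by fun_prop) (i.1 + 1)

lemma norm_fourierPart_le (N : ℕ) {h : ℝ → EuclideanSpace ℝ (Fin n)} {C : ℝ} (hC : ∀ t, ‖h t‖ ≤ C) :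
    ‖fourierPart N h‖ ≤ 2 * C := by
  have hC0 : 0 ≤ C := (norm_nonneg _).trans (hC 0)
  rw [Prod.norm_def]
  refine max_le ((norm_coefMean_le hC).trans (by linarith)) ?_
  exact (pi_norm_le_iff_of_nonneg (by linarith)).2 fun i =>
    norm_coef_le _ fun t => (abs_coord_le _ _).trans (hC t)

lemma gal_sub_gal {N : ℕ} {f g : EuclideanSpace ℝ (Fin n) → EuclideanSpace ℝ (Fin n)} (hf : Continuous f)
    (hg : Continuous g) (w : EuclideanSpace ℝ (Fin n) × (Fin N × Fin n → ℂ)) :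
    gal f w - gal g w = fourierPart N fun t => g (curve w t) - f (curve w t) := by
  rw [fourierPart_sub N (by fun_prop) (by fun_prop), gal, gal]
  abel

lemma curve_sub_const {N : ℕ} (w : EuclideanSpace ℝ (Fin n) × (Fin N × Fin n → ℂ)) (p : EuclideanSpace ℝ (Fin n))
    (t : ℝ) : curve (w - (p, 0)) t = curve w t - p := by
  ext l
  simp only [curve_apply, PiLp.sub_apply, Prod.fst_sub, Prod.snd_sub, sub_zero]
  ring

lemma gal_comp_sub {N : ℕ} (f : EuclideanSpace ℝ (Fin n) → EuclideanSpace ℝ (Fin n))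
    (p : EuclideanSpace ℝ (Fin n)) (w : EuclideanSpace ℝ (Fin n) × (Fin N × Fin n → ℂ)) :
    gal (fun y => f (y - p)) w = gal f (w - (p, 0)) := by
  simp only [gal, curve_sub_const, Prod.snd_sub, sub_zero]

lemma norm_curve_le_of_coord {N : ℕ} {w : EuclideanSpace ℝ (Fin n) × (Fin N × Fin n → ℂ)} {B : ℝ}
    (hB : ∀ i l, ‖w.2 (i, l)‖ ≤ B * (1 / ((i : ℕ) + 1 : ℝ) ^ 2)) (hB0 : 0 ≤ B) (t : ℝ) :
    ‖curve w t‖ ≤ n * (‖w.1‖ + B * ∑' i : ℕ, 1 / ((i : ℝ) + 1) ^ 2) := by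
  have hs : Summable fun i : ℕ => 1 / ((i : ℝ) + 1) ^ 2 := by
    have := (summable_nat_add_iff 1).2 (Real.summable_one_div_nat_pow.2 (by norm_num : 1 < 2))
    simpa using this
  refine norm_le_of_coord fun l => ?_
  rw [curve_apply]
  refine (abs_add_le _ _).trans (add_le_add (abs_coord_le _ _) ((Finset.abs_sum_le_sum_abs _ _).trans ?_))
  calc ∑ i : Fin N, |(w.2 (i, l) * wave ((i : ℕ) + 1 : ℕ) t).re| ≤ ∑ i : Fin N, B * (1 / (((i : ℕ) : ℝ) + 1) ^ 2) :=
        Finset.sum_le_sum fun i _ => (Complex.abs_re_le_norm _).trans (by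
          rw [norm_mul, norm_wave, mul_one]; exact hB i l)
    _ = B * ∑ i ∈ Finset.range N, 1 / ((i : ℝ) + 1) ^ 2 := by
        rw [← Finset.mul_sum, Fin.sum_univ_eq_sum_range (fun i : ℕ => 1 / ((i : ℝ) + 1) ^ 2)]
    _ ≤ _ := mul_le_mul_of_nonneg_left (hs.sum_le_tsum _ fun i _ => by positivity) hB0

lemma norm_curve_le {N : ℕ} (w : EuclideanSpace ℝ (Fin n) × (Fin N × Fin n → ℂ)) (t : ℝ) :
    ‖curve w t‖ ≤ n * (1 + N) * ‖w‖ := by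
  rw [mul_assoc]
  refine norm_le_of_coord fun l => ?_
  rw [curve_apply, add_mul, one_mul]
  refine (abs_add_le _ _).trans (add_le_add ((abs_coord_le _ _).trans (norm_fst_le w))
    ((Finset.abs_sum_le_sum_abs _ _).trans ?_))
  calc ∑ i : Fin N, |(w.2 (i, l) * wave ((i : ℕ) + 1 : ℕ) t).re| ≤ ∑ _i : Fin N, ‖w‖ :=
        Finset.sum_le_sum fun i _ => (Complex.abs_re_le_norm _).trans (by
          rw [norm_mul, norm_wave, mul_one]; exact (norm_le_pi_norm _ _).trans (norm_snd_le w))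
    _ = N * ‖w‖ := by simp

end Gal

namespace SpecData
variable {n : ℕ} (D : SpecData n)

lemma inner_eq (l : Fin n) (x : EuclideanSpace ℝ (Fin n)) : ⟪D.e l, x⟫ = ∑ m, D.e l m * x m := by
  rw [PiLp.inner_apply]
  exact Finset.sum_congr rfl fun m _ => by simp [mul_comm]

lemma sum_mul_row (l l' : Fin n) : ∑ m, D.e l m * D.e l' m = if l = l' then 1 else 0 := by
  rw [← inner_eq]; exact orthonormal_iff_ite.1 D.e.orthonormal l l'

lemma sum_mul_col (m m' : Fin n) : ∑ l, D.e l m * D.e l m' = if m = m' then 1 else 0 := by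
  let O : Matrix (Fin n) (Fin n) ℝ := Matrix.of fun l m => D.e l m
  have h1 : O * O.transpose = 1 := by
    ext l l'
    rw [Matrix.mul_apply, Matrix.one_apply]
    exact D.sum_mul_row l l'
  have h3 : O.transpose * O = 1 := mul_eq_one_comm.1 h1
  have h2 : (O.transpose * O) m m' = (1 : Matrix (Fin n) (Fin n) ℝ) m m' := by rw [h3]
  rw [Matrix.mul_apply, Matrix.one_apply] at h2
  exact h2

lemma abs_entry_le (l m : Fin n) : |D.e l m| ≤ 1 :=
  (abs_coord_le _ _).trans (D.e.orthonormal.norm_eq_one l).le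

lemma det_neg : (-D.L).det = ∏ l, (-D.a l) := by
  rw [ContinuousLinearMap.det, ← LinearMap.det_toMatrix D.e.toBasis]
  have : LinearMap.toMatrix D.e.toBasis D.e.toBasis ((-D.L : EuclideanSpace ℝ (Fin n) →L[ℝ] _) :
      EuclideanSpace ℝ (Fin n) →ₗ[ℝ] _) = Matrix.diagonal fun l => -D.a l := by
    ext l l'
    rw [LinearMap.toMatrix_apply, Matrix.diagonal_apply]
    simp only [OrthonormalBasis.coe_toBasis, OrthonormalBasis.coe_toBasis_repr_apply, OrthonormalBasis.repr_apply_apply]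
    change ⟪D.e l, -(D.L (D.e l'))⟫ = _
    rw [inner_neg_right, D.eig, orthonormal_iff_ite.1 D.e.orthonormal l l']
    split_ifs <;> simp
  rw [this, Matrix.det_diagonal]

/-- The passage to eigencoordinates in every Fourier mode. -/
noncomputable def coordEquiv (N : ℕ) : (Fin N × Fin n → ℂ) ≃ₗ[ℂ] (Fin N × Fin n → ℂ) where
  toFun z i := ∑ m, (D.e i.2 m : ℂ) * z (i.1, m)
  invFun z i := ∑ l, (D.e l i.2 : ℂ) * z (i.1, l)
  map_add' z z' := by
    funext i
    simp only [Pi.add_apply, mul_add, Finset.sum_add_distrib]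
  map_smul' c z := by
    funext i
    simp only [Pi.smul_apply, smul_eq_mul, RingHom.id_apply, Finset.mul_sum]
    exact Finset.sum_congr rfl fun m _ => by ring
  left_inv z := by
    funext i
    simp only [Finset.mul_sum]
    rw [Finset.sum_comm]
    have h1 : ∀ m, ∑ l, (D.e l i.2 : ℂ) * ((D.e l m : ℂ) * z (i.1, m)) =
        (if i.2 = m then 1 else 0 : ℝ) * z (i.1, m) := fun m => by
      rw [← D.sum_mul_col, Complex.ofReal_sum, Finset.sum_mul]
      exact Finset.sum_congr rfl fun l _ => by push_cast; ring
    simp only [h1, apply_ite Complex.ofReal, Complex.ofReal_one, Complex.ofReal_zero, ite_mul]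
    simp
  right_inv z := by
    funext i
    simp only [Finset.mul_sum]
    rw [Finset.sum_comm]
    have h1 : ∀ l, ∑ m, (D.e i.2 m : ℂ) * ((D.e l m : ℂ) * z (i.1, l)) =
        (if i.2 = l then 1 else 0 : ℝ) * z (i.1, l) := fun l => by
      rw [← D.sum_mul_row, Complex.ofReal_sum, Finset.sum_mul]
      exact Finset.sum_congr rfl fun m _ => by push_cast; ring
    simp only [h1, apply_ite Complex.ofReal, Complex.ofReal_one, Complex.ofReal_zero, ite_mul]
    simp

lemma coordEquiv_apply {N : ℕ} (z : Fin N × Fin n → ℂ) (i : Fin N × Fin n) :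
    D.coordEquiv N z i = ∑ m, (D.e i.2 m : ℂ) * z (i.1, m) := rfl

lemma coordEquiv_symm_apply {N : ℕ} (z : Fin N × Fin n → ℂ) (i : Fin N × Fin n) :
    (D.coordEquiv N).symm z i = ∑ l, (D.e l i.2 : ℂ) * z (i.1, l) := rfl

/-- The linear model of the Galerkin map attached to `D`. -/
noncomputable def preModel (N : ℕ) : PreModel (EuclideanSpace ℝ (Fin n)) (freq N n) where
  A := -D.L
  det_ne := by
    rw [D.det_neg]
    exact Finset.prod_ne_zero_iff.2 fun l _ => neg_ne_zero.2 (D.a_ne l)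
  Y := D.coordEquiv N
  b i := (freq N n i : ℝ) ^ 2 - D.a i.2
  b_ne i := sub_ne_zero.2 (D.res i.2 _ (Nat.succ_pos _)).symm
  weight i j h := by
    rw [coordEquiv_symm_apply] at h
    obtain ⟨l, -, hl⟩ := Finset.exists_ne_zero_of_sum_ne_zero h
    have := right_ne_zero_of_mul hl
    rw [Pi.single_apply] at this
    have h2 : (i.1, l) = j := by by_contra hc; exact this (if_neg hc)
    rw [← h2]
    rfl
  comm θ z := by
    funext i
    simp only [coordEquiv_apply, rot, Finset.mul_sum]
    exact Finset.sum_congr rfl fun m _ => by simp only [freq]; ring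
  isom z z' := by
    rw [Fintype.sum_prod_type, Fintype.sum_prod_type]
    refine Finset.sum_congr rfl fun i _ => ?_
    simp only [freq, coordEquiv_apply, ← Finset.mul_sum]
    congr 1
    have h1 : ∀ l, starRingEnd ℂ (∑ m, (D.e l m : ℂ) * z (i, m)) * ∑ m', (D.e l m' : ℂ) * z' (i, m') =
        ∑ m, ∑ m', (D.e l m * D.e l m' : ℝ) * (starRingEnd ℂ (z (i, m)) * z' (i, m')) := fun l => by
      rw [map_sum, Finset.sum_mul_sum]
      refine Finset.sum_congr rfl fun m _ => Finset.sum_congr rfl fun m' _ => ?_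
      rw [map_mul, Complex.conj_ofReal]
      push_cast
      ring
    simp only [h1]
    rw [Finset.sum_comm]
    refine Finset.sum_congr rfl fun m _ => ?_
    rw [Finset.sum_comm]
    have h2 : ∀ m', ∑ l, ((D.e l m * D.e l m' : ℝ) : ℂ) * (starRingEnd ℂ (z (i, m)) * z' (i, m')) =
        if m = m' then starRingEnd ℂ (z (i, m)) * z' (i, m') else 0 := fun m' => by
      rw [← Finset.sum_mul, ← Complex.ofReal_sum, D.sum_mul_col]
      split_ifs <;> simp
    simp only [h2]
    simp

lemma gal_eq_zoneMap {N : ℕ} (w : EuclideanSpace ℝ (Fin n) × (Fin N × Fin n → ℂ)) :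
    gal D.L w = (D.preModel N).zoneMap (D.preModel N).b w := by
  refine Prod.ext ?_ ?_
  · rw [PreModel.zoneMap_apply]
    change 0 - coefMean (fun t => D.L (curve w t)) = -(D.L w.1)
    rw [coefMean_clm _ (continuous_curve w), coefMean_curve, zero_sub]
  · rw [PreModel.zoneMap_apply]
    apply (D.preModel N).Y.injective
    funext i
    rw [PreModel.Y_diagOp]
    change ∑ m, (D.e i.2 m : ℂ) * ((freq N n i : ℂ) ^ 2 * w.2 (i.1, m) - coef (i.1 + 1) (fun t => D.L (curve w t) m)) =
      (((freq N n i : ℝ) ^ 2 - D.a i.2 : ℝ) : ℂ) * ∑ m, (D.e i.2 m : ℂ) * w.2 (i.1, m)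
    have h1 : ∑ m, (D.e i.2 m : ℂ) * coef (i.1 + 1) (fun t => D.L (curve w t) m) =
        D.a i.2 * ∑ m, (D.e i.2 m : ℂ) * w.2 (i.1, m) := by
      rw [← coef_sum _ _ fun m => by fun_prop]
      simp only [← inner_eq, D.eig]
      simp only [inner_eq, Finset.mul_sum, ← mul_assoc]
      rw [coef_sum _ (fun m => D.a i.2 * D.e i.2 m) fun m => by fun_prop]
      refine Finset.sum_congr rfl fun m _ => ?_
      rw [coef_curve]
      push_cast
      ring
    simp only [mul_sub, Finset.sum_sub_distrib]
    rw [h1]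
    push_cast
    rw [sub_mul]
    congr 1
    rw [Finset.mul_sum]
    exact Finset.sum_congr rfl fun m _ => by ring

end SpecData

end

section
open MeasureTheory Set Topology Filter
open scoped ContDiff

section GalProps
variable {n N : ℕ}

lemma curve_sub (w w' : EuclideanSpace ℝ (Fin n) × (Fin N × Fin n → ℂ)) (t : ℝ) :
    curve (w - w') t = curve w t - curve w' t := by
  ext l
  simp only [curve_apply, PiLp.sub_apply, Prod.fst_sub, Prod.snd_sub, Pi.sub_apply, sub_mul, Complex.sub_re,
    Finset.sum_sub_distrib]
  ring

lemma locallyLipschitz_gal {f : EuclideanSpace ℝ (Fin n) → EuclideanSpace ℝ (Fin n)} (hf : LocallyLipschitz f) :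
    LocallyLipschitz (gal (N := N) f) := fun w₀ => by
  have hcf : Continuous f := hf.continuous
  set c : ℝ := n * (1 + N) with hc
  have hc0 : 0 ≤ c := by positivity
  obtain ⟨K, hK⟩ := hf.locallyLipschitzOn.exists_lipschitzOnWith_of_compact
    (isCompact_closedBall (0 : EuclideanSpace ℝ (Fin n)) (c * (‖w₀‖ + 1)))
  refine ⟨(N ^ 2 + 2 * (K * c)).toNNReal, Metric.closedBall w₀ 1, Metric.closedBall_mem_nhds _ one_pos,
    LipschitzOnWith.of_dist_le_mul fun w hw w' hw' => ?_⟩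
  have hmem : ∀ v ∈ Metric.closedBall w₀ 1, ∀ t, curve v t ∈
      Metric.closedBall (0 : EuclideanSpace ℝ (Fin n)) (c * (‖w₀‖ + 1)) := fun v hv t => by
    rw [mem_closedBall_zero_iff]
    refine (norm_curve_le v t).trans (mul_le_mul_of_nonneg_left ?_ hc0)
    have := norm_le_norm_add_norm_sub' v w₀
    rw [mem_closedBall_iff_norm] at hv
    linarith
  rw [Real.coe_toNNReal _ (by positivity), dist_eq_norm, dist_eq_norm]
  have h1 : gal f w - gal f w' = (0, fun i => (freq N n i : ℂ) ^ 2 * (w - w').2 i) -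
      fourierPart N fun t => f (curve w t) - f (curve w' t) := by
    rw [fourierPart_sub N (by fun_prop) (by fun_prop), gal, gal, sub_sub_sub_comm]
    congr 1
    refine Prod.ext (by simp) (funext fun i => ?_)
    simp [mul_sub]
  rw [h1, add_mul]
  refine (norm_sub_le _ _).trans (add_le_add ?_ ?_)
  · rw [Prod.norm_def, norm_zero]
    refine max_le (by positivity) ((pi_norm_le_iff_of_nonneg (by positivity)).2 fun i => ?_)
    rw [norm_mul, norm_pow, Complex.norm_natCast]
    have h2 : (freq N n i : ℝ) ≤ N := by
      exact_mod_cast (i.1.2 : (i.1 : ℕ) + 1 ≤ N)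
    gcongr
    exact (norm_le_pi_norm _ _).trans (norm_snd_le (w - w'))
  · rw [mul_assoc]
    refine norm_fourierPart_le N fun t => ?_
    have h2 := hK.dist_le_mul _ (hmem w hw t) _ (hmem w' hw' t)
    rw [dist_eq_norm, dist_eq_norm, ← curve_sub] at h2
    refine h2.trans ?_
    rw [mul_assoc]
    exact mul_le_mul_of_nonneg_left (norm_curve_le _ t) K.2

lemma gal_near {f : EuclideanSpace ℝ (Fin n) → EuclideanSpace ℝ (Fin n)} (hf : Continuous f) (D : SpecData n)
    {p : EuclideanSpace ℝ (Fin n)} (hp : f p = 0) (hD : HasFDerivAt f D.L p) :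
    (fun w => gal (N := N) f w - (D.preModel N).zoneMap (D.preModel N).b (w - (p, 0)))
      =o[𝓝 (p, 0)] fun w => w - (p, 0) := by
  set c : ℝ := n * (1 + N) with hc
  have hc0 : 0 ≤ c := by positivity
  rw [Asymptotics.isLittleO_iff]
  intro ε hε
  have h1 := (Asymptotics.isLittleO_iff.1 hD.isLittleO) (c := ε / (2 * (c + 1))) (by positivity)
  obtain ⟨δ, hδ, h1⟩ := Metric.eventually_nhds_iff.1 h1
  rw [Metric.eventually_nhds_iff]
  refine ⟨δ / (c + 1), by positivity, fun w hw => ?_⟩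
  have hcur : ∀ t, ‖curve w t - p‖ ≤ c * ‖w - (p, 0)‖ := fun t => by
    rw [← curve_sub_const]; exact norm_curve_le _ t
  have hL : Continuous fun y => D.L (y - p) := by fun_prop
  rw [← D.gal_eq_zoneMap, ← gal_comp_sub, gal_sub_gal hf hL]
  have hb := norm_fourierPart_le N (h := fun t => D.L (curve w t - p) - f (curve w t))
    (C := ε / (2 * (c + 1)) * (c * ‖w - (p, 0)‖)) fun t => by
      have h3 := hcur t
      rw [dist_eq_norm, lt_div_iff₀ (by positivity)] at hw
      have h2 := h1 (y := curve w t) (by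
        rw [dist_eq_norm]
        refine h3.trans_lt (lt_of_le_of_lt ?_ hw)
        nlinarith [norm_nonneg (w - (p, (0 : Fin N × Fin n → ℂ)))])
      rw [hp, sub_zero] at h2
      rw [norm_sub_rev]
      exact h2.trans (mul_le_mul_of_nonneg_left h3 (by positivity))
  refine hb.trans ?_
  have : 2 * (ε / (2 * (c + 1)) * (c * ‖w - (p, (0 : Fin N × Fin n → ℂ))‖)) =
      ε * ‖w - (p, (0 : Fin N × Fin n → ℂ))‖ * (c / (c + 1)) := by
    field_simp
  rw [this]
  exact mul_le_of_le_one_right (by positivity) ((div_le_one (by positivity)).2 (by linarith))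

lemma gal_far {f : EuclideanSpace ℝ (Fin n) → EuclideanSpace ℝ (Fin n)} (hf : Continuous f) (D : SpecData n)
    (hD : ∀ ε > 0, ∃ C, ∀ y, ‖f y - D.L y‖ ≤ ε * ‖y‖ + C) :
    (fun w => gal (N := N) f w - (D.preModel N).zoneMap (D.preModel N).b w)
      =o[Bornology.cobounded _] fun w => w := by
  set c : ℝ := n * (1 + N) with hc
  have hc0 : 0 ≤ c := by positivity
  rw [Asymptotics.isLittleO_iff]
  intro ε hε
  obtain ⟨C, hC⟩ := hD (ε / (4 * (c + 1))) (by positivity)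
  have h1 := tendsto_norm_cobounded_atTop (E := EuclideanSpace ℝ (Fin n) × (Fin N × Fin n → ℂ))
    |>.eventually_ge_atTop (4 * C / ε)
  filter_upwards [h1] with w hw
  rw [div_le_iff₀ hε] at hw
  have hL : Continuous fun y => D.L y := by fun_prop
  rw [← D.gal_eq_zoneMap, gal_sub_gal hf hL]
  have hb := norm_fourierPart_le N (h := fun t => D.L (curve w t) - f (curve w t))
    (C := ε / (4 * (c + 1)) * (c * ‖w‖) + C) fun t => by
      rw [norm_sub_rev]
      refine (hC _).trans (add_le_add_left ?_ _)
      exact mul_le_mul_of_nonneg_left (norm_curve_le _ t) (by positivity)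
  refine hb.trans ?_
  have : 2 * (ε / (4 * (c + 1)) * (c * ‖w‖) + C) = ε * ‖w‖ / 2 * (c / (c + 1)) + 2 * C := by
    field_simp
    ring
  rw [this]
  have h5 : ε * ‖w‖ / 2 * (c / (c + 1)) ≤ ε * ‖w‖ / 2 :=
    mul_le_of_le_one_right (by positivity) ((div_le_one (by positivity)).2 (by linarith))
  linarith

lemma exists_wave_eq {θ : ℂ} (hθ : ‖θ‖ = 1) : ∃ s, wave 1 s = θ :=
  ⟨θ.arg, by
    have := Complex.norm_mul_exp_arg_mul_I θ
    rw [hθ, Complex.ofReal_one, one_mul] at this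
    rw [wave, Int.cast_one, one_mul]
    exact this⟩

lemma curve_rot (x : EuclideanSpace ℝ (Fin n)) (z : Fin N × Fin n → ℂ) (s t : ℝ) :
    curve (x, rot (freq N n) (wave 1 s) z) t = curve (x, z) (t + s) := by
  ext l
  simp only [curve_apply, rot, freq, wave_add]
  congr 1
  refine Finset.sum_congr rfl fun i _ => ?_
  rw [wave_natCast _ s]
  congr 1
  ring

lemma coef_add_right {h : ℝ → ℝ} (hp : Function.Periodic h (2 * π)) (k : ℕ) (s : ℝ) :
    coef k (fun t => h (t + s)) = wave 1 s ^ k * coef k h := by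
  have h1 : ∀ t, ((h (t + s) : ℝ) : ℂ) * wave (-k) t = wave 1 s ^ k * ((h (t + s) : ℂ) * wave (-k) (t + s)) := by
    intro t
    have h2 : wave 1 s ^ k * wave (-k) s = 1 := by rw [← wave_natCast, wave_mul, add_neg_cancel, wave_zero_left]
    rw [wave_add]
    linear_combination -((h (t + s) : ℂ) * wave (-k) t) * h2
  have hper : Function.Periodic (fun t => (h t : ℂ) * wave (-k) t) (2 * π) := fun t => by
    simp only [hp t, wave_periodic (-k) t]
  rw [coef, coef, intervalIntegral.integral_congr fun t _ => h1 t, intervalIntegral.integral_const_mul,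
    intervalIntegral.integral_comp_add_right (fun t => (h t : ℂ) * wave (-k) t), zero_add, add_comm (2 * π) s,
    hper.intervalIntegral_add_eq s 0, zero_add]
  ring

lemma coefMean_add_right {h : ℝ → EuclideanSpace ℝ (Fin n)} (hp : Function.Periodic h (2 * π)) (s : ℝ) :
    coefMean (fun t => h (t + s)) = coefMean h := by
  rw [coefMean, coefMean, intervalIntegral.integral_comp_add_right, zero_add, add_comm (2 * π) s,
    hp.intervalIntegral_add_eq s 0, zero_add]

lemma gal_rot (f : EuclideanSpace ℝ (Fin n) → EuclideanSpace ℝ (Fin n)) (x : EuclideanSpace ℝ (Fin n))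
    (z : Fin N × Fin n → ℂ) {θ : ℂ} (hθ : ‖θ‖ = 1) :
    gal f (x, rot (freq N n) θ z) = ((gal f (x, z)).1, rot (freq N n) θ (gal f (x, z)).2) := by
  obtain ⟨s, rfl⟩ := exists_wave_eq hθ
  have hper : Function.Periodic (fun t => f (curve (x, z) t)) (2 * π) := fun t => by
    simp only [curve_periodic (x, z) t]
  simp only [gal, curve_rot]
  refine Prod.ext ?_ (funext fun i => ?_)
  · change 0 - coefMean (fun t => (fun t => f (curve (x, z) t)) (t + s)) = 0 - coefMean _
    rw [coefMean_add_right hper]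
  · change (freq N n i : ℂ) ^ 2 * (wave 1 s ^ freq N n i * z i) -
        coef (i.1 + 1) (fun t => (fun t => f (curve (x, z) t) i.2) (t + s)) =
      wave 1 s ^ freq N n i * ((freq N n i : ℂ) ^ 2 * z i - coef (i.1 + 1) fun t => f (curve (x, z) t) i.2)
    have hper' : Function.Periodic (fun t => f (curve (x, z) t) i.2) (2 * π) := fun t => by
      simp only [curve_periodic (x, z) t]
    rw [coef_add_right hper']
    simp only [freq]
    ring

lemma hasDerivAt_curve (w : EuclideanSpace ℝ (Fin n) × (Fin N × Fin n → ℂ)) (t : ℝ) :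
    HasDerivAt (curve w) (WithLp.toLp 2 fun l => ∑ i : Fin N,
      (w.2 (i, l) * ((((i : ℕ) + 1 : ℕ) : ℤ) * Complex.I * wave ((i : ℕ) + 1 : ℕ) t)).re) t := by
  have h1 : HasDerivAt (fun t l => w.1 l + ∑ i : Fin N, (w.2 (i, l) * wave ((i : ℕ) + 1 : ℕ) t).re)
      (fun l => ∑ i : Fin N, (w.2 (i, l) * ((((i : ℕ) + 1 : ℕ) : ℤ) * Complex.I * wave ((i : ℕ) + 1 : ℕ) t)).re) t := by
    refine hasDerivAt_pi.2 fun l => ?_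
    refine HasDerivAt.const_add _ (HasDerivAt.fun_sum fun i _ => ?_)
    exact Complex.reCLM.hasFDerivAt.comp_hasDerivAt t ((hasDerivAt_wave _ t).const_mul _)
  exact (PiLp.continuousLinearEquiv 2 ℝ (fun _ : Fin n => ℝ)).symm.hasFDerivAt.comp_hasDerivAt t h1

lemma sum_freq_mul_im_coef {V : EuclideanSpace ℝ (Fin n) → ℝ} {f : EuclideanSpace ℝ (Fin n) → EuclideanSpace ℝ (Fin n)}
    (hf : Continuous f) (hV : ∀ y, HasGradientAt V (f y) y) (w : EuclideanSpace ℝ (Fin n) × (Fin N × Fin n → ℂ)) :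
    ∑ i, (freq N n i : ℝ) *
      (starRingEnd ℂ (w.2 i) * coef (i.1 + 1) fun t => f (curve w t) i.2).im = 0 := by
  have h1 : ∀ i : Fin N × Fin n, (freq N n i : ℝ) *
      (starRingEnd ℂ (w.2 i) * coef (i.1 + 1) fun t => f (curve w t) i.2).im =
      π⁻¹ * ∫ t in (0:ℝ)..2 * π, f (curve w t) i.2 *
        (w.2 i * ((((i.1 : ℕ) + 1 : ℕ) : ℤ) * Complex.I * wave ((i.1 : ℕ) + 1 : ℕ) t)).re := fun i => by
    have h2 := Complex.imCLM.intervalIntegral_comp_comm (μ := volume) (a := 0) (b := 2 * π)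
      (f := fun t => starRingEnd ℂ (w.2 i) * ((f (curve w t) i.2 : ℂ) * wave (-((i.1 : ℕ) + 1 : ℕ)) t))
      (by apply Continuous.intervalIntegrable; fun_prop)
    rw [intervalIntegral.integral_const_mul] at h2
    have h3 : (starRingEnd ℂ (w.2 i) * coef (i.1 + 1) fun t => f (curve w t) i.2).im =
        π⁻¹ * ∫ t in (0:ℝ)..2 * π,
          (starRingEnd ℂ (w.2 i) * ((f (curve w t) i.2 : ℂ) * wave (-((i.1 : ℕ) + 1 : ℕ)) t)).im := by
      refine Eq.trans ?_ (congrArg (π⁻¹ * ·) h2.symm)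
      rw [coef, mul_left_comm, ← Complex.ofReal_inv, Complex.im_ofReal_mul]
      rfl
    rw [h3, mul_left_comm, ← intervalIntegral.integral_const_mul]
    congr 1
    refine intervalIntegral.integral_congr fun t _ => ?_
    have h4 : starRingEnd ℂ (w.2 i) * ((f (curve w t) i.2 : ℂ) * wave (-((i.1 : ℕ) + 1 : ℕ)) t) =
        (f (curve w t) i.2 : ℂ) * starRingEnd ℂ (w.2 i * wave ((i.1 : ℕ) + 1 : ℕ) t) := by
      rw [map_mul, conj_wave]; ring
    have h5 : w.2 i * ((((i.1 : ℕ) + 1 : ℕ) : ℤ) * Complex.I * wave ((i.1 : ℕ) + 1 : ℕ) t) =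
        ((freq N n i : ℝ) : ℂ) * (Complex.I * (w.2 i * wave ((i.1 : ℕ) + 1 : ℕ) t)) := by
      simp only [freq]; push_cast; ring
    simp only [h4, h5, Complex.im_ofReal_mul, Complex.re_ofReal_mul, Complex.conj_im, Complex.I_mul_re]
    ring
  simp only [h1]
  rw [← Finset.mul_sum, ← intervalIntegral.integral_finsetSum]
  · have h6 : ∀ t ∈ uIcc (0:ℝ) (2 * π), HasDerivAt (fun t => V (curve w t)) (∑ i : Fin N × Fin n, f (curve w t) i.2 *
        (w.2 i * ((((i.1 : ℕ) + 1 : ℕ) : ℤ) * Complex.I * wave ((i.1 : ℕ) + 1 : ℕ) t)).re) t := fun t _ => by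
      have h7 := (hV (curve w t)).hasFDerivAt.comp_hasDerivAt t (hasDerivAt_curve w t)
      refine h7.congr_deriv ?_
      rw [InnerProductSpace.toDual_apply_apply, PiLp.inner_apply, Fintype.sum_prod_type_right]
      refine Finset.sum_congr rfl fun l _ => ?_
      refine Eq.trans ?_ (Finset.mul_sum (f := fun i : Fin N =>
        (w.2 (i, l) * ((((i : ℕ) + 1 : ℕ) : ℤ) * Complex.I * wave ((i : ℕ) + 1 : ℕ) t)).re) Finset.univ (f (curve w t) l))
      exact mul_comm _ _
    rw [intervalIntegral.integral_eq_sub_of_hasDerivAt h6]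
    · have := curve_periodic w 0
      rw [zero_add] at this
      rw [this, sub_self, mul_zero]
    · apply Continuous.intervalIntegrable
      refine continuous_finsetSum _ fun i _ => Continuous.mul (by fun_prop) (Complex.continuous_re.comp (by fun_prop))
  · intro i _
    apply Continuous.intervalIntegrable
    exact Continuous.mul (by fun_prop) (Complex.continuous_re.comp (by fun_prop))

lemma gal_orth {V : EuclideanSpace ℝ (Fin n) → ℝ} {f : EuclideanSpace ℝ (Fin n) → EuclideanSpace ℝ (Fin n)}
    (hf : Continuous f) (hV : ∀ y, HasGradientAt V (f y) y) (x : EuclideanSpace ℝ (Fin n)) (z : Fin N × Fin n → ℂ) :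
    ∑ i, (freq N n i : ℝ) * (starRingEnd ℂ (z i) * (gal f (x, z)).2 i).im = 0 := by
  rw [← neg_eq_zero, ← sum_freq_mul_im_coef hf hV (x, z), ← Finset.sum_neg_distrib]
  refine Finset.sum_congr rfl fun i _ => ?_
  rw [← mul_neg]
  congr 1
  change -(starRingEnd ℂ (z i) * ((freq N n i : ℂ) ^ 2 * z i - coef (i.1 + 1) fun t => f (curve (x, z) t) i.2)).im =
    (starRingEnd ℂ (z i) * coef (i.1 + 1) fun t => f (curve (x, z) t) i.2).im
  have h1 : starRingEnd ℂ (z i) * ((freq N n i : ℂ) ^ 2 * z i) = ((freq N n i ^ 2 * Complex.normSq (z i) : ℝ) : ℂ) := by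
    rw [mul_left_comm, ← Complex.normSq_eq_conj_mul_self]
    push_cast
    ring
  rw [mul_sub, h1, Complex.sub_im, Complex.ofReal_im, zero_sub, neg_neg]

end GalProps

end

section
open MeasureTheory Set Topology Filter
open scoped ContDiff

lemma le_two_mul_of_contracting {g : ℝ → ℝ} {s₀ b : ℝ} (h0 : ∀ t, g t ≤ s₀)
    (h : ∀ s, (∀ t, g t ≤ s) → ∀ t, g t ≤ s / 2 + b) (t : ℝ) : g t ≤ 2 * b := by
  have hbdd : BddAbove (range g) := ⟨s₀, by rintro _ ⟨t, rfl⟩; exact h0 t⟩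
  have h1 : ⨆ t, g t ≤ (⨆ t, g t) / 2 + b := ciSup_le (h _ (le_ciSup hbdd))
  have h2 := le_ciSup hbdd t
  linarith

namespace SpecData
variable {n : ℕ} (D : SpecData n)

lemma exists_gap : ∃ c : ℝ, 0 < c ∧ ∀ l, 1 ≤ c * |D.a l| ∧ ∀ k : ℕ, 1 ≤ k → (k : ℝ) ^ 2 ≤ c * |(k : ℝ) ^ 2 - D.a l| := by
  have h1 : ∀ l, ∃ c : ℝ, 0 < c ∧ 1 ≤ c * |D.a l| ∧ ∀ k : ℕ, 1 ≤ k → (k : ℝ) ^ 2 ≤ c * |(k : ℝ) ^ 2 - D.a l| := fun l => by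
    have h2 : Tendsto (fun k : ℕ => |D.a l / ((k : ℝ) ^ 2 - D.a l)|) atTop (𝓝 |0|) := by
      refine (Tendsto.div_atTop tendsto_const_nhds ?_).abs
      exact tendsto_atTop_add_const_right _ _ ((tendsto_pow_atTop two_ne_zero).comp tendsto_natCast_atTop_atTop)
    obtain ⟨M, hM⟩ := h2.bddAbove_range
    have ha : 0 < |D.a l| := abs_pos.2 (D.a_ne l)
    have hM0 : 0 ≤ M := (abs_nonneg _).trans (hM ⟨0, rfl⟩)
    refine ⟨1 + M + |D.a l|⁻¹, by positivity, ?_, fun k hk => ?_⟩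
    · rw [add_mul, inv_mul_cancel₀ ha.ne']
      exact le_add_of_nonneg_left (by positivity)
    · have hne : (k : ℝ) ^ 2 - D.a l ≠ 0 := sub_ne_zero.2 (D.res l k hk).symm
      have hpos : 0 < |(k : ℝ) ^ 2 - D.a l| := abs_pos.2 hne
      have h3 : |D.a l| ≤ M * |(k : ℝ) ^ 2 - D.a l| := by
        rw [← div_le_iff₀ hpos, ← abs_div]
        exact hM ⟨k, rfl⟩
      have h4 := le_abs_self ((k : ℝ) ^ 2 - D.a l)
      have h5 := le_abs_self (D.a l)
      have h6 : 0 ≤ |D.a l|⁻¹ * |(k : ℝ) ^ 2 - D.a l| := by positivity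
      rw [add_mul, add_mul]
      linarith
  choose c hc h1 h2 using h1
  refine ⟨1 + ∑ l, c l, by have := Finset.sum_nonneg fun l (_ : l ∈ Finset.univ) => (hc l).le; positivity, fun l => ?_⟩
  have h3 : c l ≤ 1 + ∑ l, c l := by
    have := Finset.single_le_sum (fun l _ => (hc l).le) (Finset.mem_univ l)
    linarith
  exact ⟨(h1 l).trans (mul_le_mul_of_nonneg_right h3 (abs_nonneg _)),
    fun k hk => (h2 l k hk).trans (mul_le_mul_of_nonneg_right h3 (abs_nonneg _))⟩

lemma norm_le_of_inner {x : EuclideanSpace ℝ (Fin n)} {C : ℝ} (hx : ∀ l, |⟪D.e l, x⟫| ≤ C) : ‖x‖ ≤ n * C := by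
  rw [← D.e.sum_repr' x]
  refine (norm_sum_le _ _).trans ?_
  calc ∑ l, ‖⟪D.e l, x⟫ • D.e l‖ ≤ ∑ _l : Fin n, C :=
        Finset.sum_le_sum fun l _ => by
          rw [norm_smul, D.e.orthonormal.norm_eq_one, mul_one]; exact hx l
    _ = n * C := by simp

/-- The uniform invertibility of the Galerkin approximations of the linear problem. -/
lemma exists_resolvent_bound : ∃ C : ℝ, 0 < C ∧ ∀ (N : ℕ) (w : EuclideanSpace ℝ (Fin n) × (Fin N × Fin n → ℂ))
    (h : ℝ → EuclideanSpace ℝ (Fin n)) (s : ℝ), (∀ t, ‖h t‖ ≤ s) → gal D.L w = fourierPart N h →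
    ‖w.1‖ ≤ C * s ∧ (∀ i l, ‖w.2 (i, l)‖ ≤ C * s * (1 / ((i : ℕ) + 1 : ℝ) ^ 2)) ∧ ∀ t, ‖curve w t‖ ≤ C * s := by
  obtain ⟨c, hc, hgap⟩ := D.exists_gap
  set S : ℝ := ∑' i : ℕ, 1 / ((i : ℝ) + 1) ^ 2 with hS
  have hS0 : 0 ≤ S := tsum_nonneg fun i => by positivity
  set C₀ : ℝ := n * c + n * (n * (2 * c)) with hC₀
  have hC₀0 : 0 ≤ C₀ := by positivity
  refine ⟨1 + C₀ + n * (C₀ + C₀ * S), by positivity, fun N w h s hs hw => ?_⟩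
  have hs0 : 0 ≤ s := (norm_nonneg _).trans (hs 0)
  have hx : ‖w.1‖ ≤ C₀ * s := by
    have h1 : -(D.L w.1) = coefMean h := by
      have := congrArg Prod.fst hw
      rw [D.gal_eq_zoneMap, PreModel.zoneMap_apply] at this
      exact this
    have h2 : ‖w.1‖ ≤ n * (c * s) := D.norm_le_of_inner fun l => by
      have h3 : |D.a l| * |⟪D.e l, w.1⟫| ≤ s := by
        rw [← abs_mul, ← D.eig, ← abs_neg, ← inner_neg_right, h1]
        refine (abs_real_inner_le_norm _ _).trans ?_
        rw [D.e.orthonormal.norm_eq_one, one_mul]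
        exact norm_coefMean_le hs
      calc |⟪D.e l, w.1⟫| = 1 * |⟪D.e l, w.1⟫| := (one_mul _).symm
        _ ≤ c * |D.a l| * |⟪D.e l, w.1⟫| := mul_le_mul_of_nonneg_right (hgap l).1 (abs_nonneg _)
        _ = c * (|D.a l| * |⟪D.e l, w.1⟫|) := mul_assoc _ _ _
        _ ≤ c * s := mul_le_mul_of_nonneg_left h3 hc.le
    refine h2.trans ?_
    rw [hC₀, add_mul, mul_assoc]
    exact le_add_of_nonneg_right (by positivity)
  have hz : ∀ i l, ‖w.2 (i, l)‖ ≤ C₀ * s * (1 / ((i : ℕ) + 1 : ℝ) ^ 2) := by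
    have h1 : ∀ i : Fin N × Fin n, (((freq N n i : ℝ) ^ 2 - D.a i.2 : ℝ) : ℂ) * D.coordEquiv N w.2 i =
        ∑ m, (D.e i.2 m : ℂ) * coef (i.1 + 1) fun t => h t m := fun i => by
      have h2 := congrFun (congrArg (D.coordEquiv N) (congrArg Prod.snd hw)) i
      rw [D.gal_eq_zoneMap, PreModel.zoneMap_apply] at h2
      exact ((D.preModel N).Y_diagOp _ _ i).symm.trans h2
    have h3 : ∀ i : Fin N × Fin n, ‖D.coordEquiv N w.2 i‖ ≤ n * (2 * c) * s * (1 / ((i.1 : ℕ) + 1 : ℝ) ^ 2) := fun i => by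
      have hk : (0:ℝ) < ((i.1 : ℕ) + 1 : ℝ) ^ 2 := by positivity
      have h4 : |(freq N n i : ℝ) ^ 2 - D.a i.2| * ‖D.coordEquiv N w.2 i‖ ≤ n * (2 * s) := by
        have := congrArg norm (h1 i)
        rw [norm_mul, Complex.norm_real, norm_eq_abs] at this
        rw [this]
        refine (norm_sum_le _ _).trans ?_
        calc ∑ m, ‖(D.e i.2 m : ℂ) * coef (i.1 + 1) fun t => h t m‖ ≤ ∑ _m : Fin n, 2 * s :=
              Finset.sum_le_sum fun m _ => by
                rw [norm_mul, Complex.norm_real, norm_eq_abs]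
                refine (mul_le_of_le_one_left (norm_nonneg _) (D.abs_entry_le _ _)).trans ?_
                exact norm_coef_le _ fun t => (abs_coord_le _ _).trans (hs t)
          _ = n * (2 * s) := by simp
      have h5 := (hgap i.2).2 (freq N n i) (Nat.succ_pos _)
      have h6 : (freq N n i : ℝ) = (i.1 : ℕ) + 1 := by simp [freq]
      rw [mul_one_div, le_div_iff₀ hk, mul_comm, ← h6]
      calc (freq N n i : ℝ) ^ 2 * ‖D.coordEquiv N w.2 i‖
          ≤ c * |(freq N n i : ℝ) ^ 2 - D.a i.2| * ‖D.coordEquiv N w.2 i‖ :=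
            mul_le_mul_of_nonneg_right h5 (norm_nonneg _)
        _ = c * (|(freq N n i : ℝ) ^ 2 - D.a i.2| * ‖D.coordEquiv N w.2 i‖) := mul_assoc _ _ _
        _ ≤ c * (n * (2 * s)) := mul_le_mul_of_nonneg_left h4 hc.le
        _ = n * (2 * c) * s := by ring
    intro i l
    rw [← (D.coordEquiv N).symm_apply_apply w.2, D.coordEquiv_symm_apply]
    refine (norm_sum_le _ _).trans ?_
    calc ∑ m, ‖(D.e m l : ℂ) * D.coordEquiv N w.2 (i, m)‖
        ≤ ∑ _m : Fin n, n * (2 * c) * s * (1 / ((i : ℕ) + 1 : ℝ) ^ 2) :=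
          Finset.sum_le_sum fun m _ => by
            rw [norm_mul, Complex.norm_real, norm_eq_abs]
            exact (mul_le_of_le_one_left (norm_nonneg _) (D.abs_entry_le _ _)).trans (h3 (i, m))
      _ = n * (n * (2 * c)) * s * (1 / ((i : ℕ) + 1 : ℝ) ^ 2) := by simp; ring
      _ ≤ _ := by
        gcongr
        rw [hC₀]
        exact le_add_of_nonneg_left (by positivity)
  have h1 : C₀ * s ≤ (1 + C₀ + n * (C₀ + C₀ * S)) * s := by
    gcongr
    have : 0 ≤ n * (C₀ + C₀ * S) := by positivity
    linarith
  refine ⟨hx.trans h1, fun i l => (hz i l).trans (by gcongr), fun t => ?_⟩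
  refine (norm_curve_le_of_coord hz (by positivity) t).trans ?_
  calc n * (‖w.1‖ + C₀ * s * S) ≤ n * (C₀ * s + C₀ * s * S) := by gcongr
    _ = n * (C₀ + C₀ * S) * s := by ring
    _ ≤ _ := by
      gcongr
      linarith

/-- Zeros of the Galerkin maps of an asymptotically linear field are uniformly bounded. -/
lemma exists_apriori_bound {f : EuclideanSpace ℝ (Fin n) → EuclideanSpace ℝ (Fin n)} (hf : Continuous f)
    (hD : ∀ ε > 0, ∃ C, ∀ y, ‖f y - D.L y‖ ≤ ε * ‖y‖ + C) :
    ∃ M : ℝ, 0 ≤ M ∧ ∀ (N : ℕ) (w : EuclideanSpace ℝ (Fin n) × (Fin N × Fin n → ℂ)), gal f w = 0 →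
      ‖w.1‖ ≤ M ∧ ∀ i l, ‖w.2 (i, l)‖ ≤ M * (1 / ((i : ℕ) + 1 : ℝ) ^ 2) := by
  obtain ⟨C, hC, hres⟩ := D.exists_resolvent_bound
  obtain ⟨C₀, hC₀⟩ := hD (1 / (2 * C)) (by positivity)
  have hC₀0 : 0 ≤ C₀ := by
    have := (norm_nonneg _).trans (hC₀ 0)
    simpa using this
  refine ⟨C * (1 / (2 * C) * (2 * (C * C₀)) + C₀), by positivity, fun N w hw => ?_⟩
  have hL : Continuous fun y => D.L y := by fun_prop
  have h1 : gal D.L w = fourierPart N fun t => f (curve w t) - D.L (curve w t) := by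
    rw [← gal_sub_gal hL hf, hw, sub_zero]
  have h2 : ∀ s, (∀ t, ‖curve w t‖ ≤ s) → ∀ t, ‖f (curve w t) - D.L (curve w t)‖ ≤ 1 / (2 * C) * s + C₀ :=
    fun s hs t => (hC₀ _).trans (by gcongr; exact hs t)
  have h3 : ∀ t, ‖curve w t‖ ≤ 2 * (C * C₀) := by
    refine le_two_mul_of_contracting (norm_curve_le w) fun s hs t => ?_
    have := (hres N w _ _ (h2 s hs) h1).2.2 t
    refine this.trans (le_of_eq ?_)
    field_simp
  have h4 := hres N w _ _ (h2 _ h3) h1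
  exact ⟨h4.1, h4.2.1⟩

/-- A nondegenerate, nonresonant zero is isolated uniformly among the zeros of the Galerkin maps. -/
lemma exists_isolating_radius {f : EuclideanSpace ℝ (Fin n) → EuclideanSpace ℝ (Fin n)} (hf : Continuous f)
    {p : EuclideanSpace ℝ (Fin n)} (hp : f p = 0) (hD : HasFDerivAt f D.L p) :
    ∃ δ : ℝ, 0 < δ ∧ ∀ (N : ℕ) (w : EuclideanSpace ℝ (Fin n) × (Fin N × Fin n → ℂ)), gal f w = 0 →
      (∀ t, ‖curve w t - p‖ ≤ δ) → w = (p, 0) := by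
  obtain ⟨C, hC, hres⟩ := D.exists_resolvent_bound
  have h1 := (Asymptotics.isLittleO_iff.1 hD.isLittleO) (c := 1 / (2 * C)) (by positivity)
  obtain ⟨δ, hδ, h1⟩ := Metric.eventually_nhds_iff.1 h1
  refine ⟨δ / 2, by positivity, fun N w hw hwδ => ?_⟩
  have hL : Continuous fun y => D.L (y - p) := by fun_prop
  have h2 : gal D.L (w - (p, 0)) = fourierPart N fun t => f (curve w t) - D.L (curve w t - p) := by
    rw [← gal_sub_gal hL hf, hw, sub_zero, gal_comp_sub]
  have h3 : ∀ s, (∀ t, ‖curve (w - (p, 0)) t‖ ≤ s) → ∀ t, ‖f (curve w t) - D.L (curve w t - p)‖ ≤ 1 / (2 * C) * s :=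
    fun s hs t => by
      have h4 := h1 (y := curve w t) (by rw [dist_eq_norm]; exact (hwδ t).trans_lt (by linarith))
      rw [hp, sub_zero] at h4
      have h5 := hs t
      rw [curve_sub_const] at h5
      exact h4.trans (by gcongr)
  have h4 : ∀ t, ‖curve (w - (p, 0)) t‖ ≤ 2 * 0 := by
    refine le_two_mul_of_contracting (s₀ := δ / 2) (fun t => by rw [curve_sub_const]; exact hwδ t) fun s hs t => ?_
    have := (hres N _ _ _ (h3 s hs) h2).2.2 t
    refine this.trans (le_of_eq ?_)
    field_simp
    ring
  have h5 := hres N _ _ _ (h3 _ h4) h2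
  simp only [mul_zero, zero_mul] at h5
  rw [← sub_eq_zero]
  refine Prod.ext (norm_le_zero_iff.1 h5.1) (funext fun i => norm_le_zero_iff.1 (h5.2.1 i.1 i.2))

end SpecData

end

section
open MeasureTheory Set Topology Filter
open scoped ContDiff

instance fact_two_pi_pos : Fact (0 < 2 * π) := ⟨by positivity⟩

lemma fourier_eq_wave (m : ℤ) (t : ℝ) : fourier m (t : AddCircle (2 * π)) = wave m t := by
  rw [fourier_coe_apply, wave]
  congr 1
  have : (π : ℂ) ≠ 0 := by exact_mod_cast pi_ne_zero
  push_cast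
  field_simp

/-- Pointwise convergence of the real Fourier series. -/
lemma hasSum_fourier_of_summable {Y : ℝ → ℝ} (hY : Continuous Y) (hp : Function.Periodic Y (2 * π))
    (hs : Summable fun k : ℕ => coef (k + 1) Y) (t : ℝ) :
    HasSum (fun k : ℕ => (coef (k + 1) Y * wave (k + 1 : ℕ) t).re) (Y t - (2 * π)⁻¹ * ∫ t in (0:ℝ)..2 * π, Y t) := by
  have hpi : (π : ℂ) ≠ 0 := by exact_mod_cast pi_ne_zero
  have hpC : Function.Periodic (fun t => (Y t : ℂ)) (2 * π) := fun t => by simp only [hp t]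
  have hcont : Continuous hpC.lift :=
    (show Continuous fun t => (Y t : ℂ) by fun_prop).quotient_lift _
  let g : C(AddCircle (2 * π), ℂ) := ⟨hpC.lift, hcont⟩
  have hg : ∀ s : ℝ, g (s : AddCircle (2 * π)) = Y s := fun s => hpC.lift_coe s
  have hc : ∀ m : ℤ, fourierCoeff g m = (2 * π : ℂ)⁻¹ * ∫ t in (0:ℝ)..2 * π, (Y t : ℂ) * wave (-m) t := fun m => by
    rw [fourierCoeff_eq_intervalIntegral g m 0, zero_add, Complex.real_smul]
    congr 1
    · push_cast; rw [one_div]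
    · refine intervalIntegral.integral_congr fun t _ => ?_
      simp only [fourier_eq_wave, hg, smul_eq_mul]
      ring
  have hc1 : ∀ k : ℕ, fourierCoeff g (k + 1 : ℕ) = coef (k + 1) Y / 2 := fun k => by
    rw [hc, coef]; field_simp
  have hc2 : ∀ k : ℕ, fourierCoeff g (-((k + 1 : ℕ) : ℤ)) = starRingEnd ℂ (coef (k + 1) Y) / 2 := fun k => by
    rw [hc, coef, map_mul, ← Complex.ofReal_inv, Complex.conj_ofReal]
    have h1 := (Complex.conjCLE : ℂ →L[ℝ] ℂ).intervalIntegral_comp_comm (μ := volume) (a := 0) (b := 2 * π)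
      (f := fun t => (Y t : ℂ) * wave (-(k + 1 : ℕ)) t) (by apply Continuous.intervalIntegrable; fun_prop)
    refine Eq.trans ?_ (congrArg (fun c => ((π⁻¹ : ℝ) : ℂ) * c / 2) h1)
    simp only [ContinuousLinearEquiv.coe_coe, Complex.conjCLE_apply]
    simp only [map_mul, Complex.conj_ofReal, conj_wave]
    push_cast
    field_simp
  have hsum : Summable (fourierCoeff g) := by
    refine Summable.of_nat_of_neg ?_ ?_
    · rw [← summable_nat_add_iff 1]
      simp only [hc1]
      exact hs.div_const 2
    · rw [← summable_nat_add_iff 1]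
      simp only [hc2]
      exact (((Complex.conjCLE.summable).2 hs)).div_const 2
  have h1 := (has_pointwise_sum_fourier_series_of_summable hsum (t : AddCircle (2 * π))).nat_add_neg
  rw [← hasSum_nat_add_iff' 1] at h1
  have h2 : ∀ k : ℕ, fourierCoeff g (k + 1 : ℕ) • fourier ((k + 1 : ℕ) : ℤ) (t : AddCircle (2 * π)) +
      fourierCoeff g (-((k + 1 : ℕ) : ℤ)) • fourier (-((k + 1 : ℕ) : ℤ)) (t : AddCircle (2 * π)) =
      ((coef (k + 1) Y * wave (k + 1 : ℕ) t).re : ℂ) := fun k => by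
    rw [hc1, hc2, fourier_eq_wave, fourier_eq_wave, Complex.re_eq_add_conj, map_mul, conj_wave, smul_eq_mul, smul_eq_mul]
    ring
  simp only [h2] at h1
  rw [Finset.sum_range_one, hg] at h1
  simp only [Nat.cast_zero, neg_zero, fourier_eq_wave, wave_zero_left, smul_eq_mul, mul_one, hc,
    intervalIntegral.integral_ofReal] at h1
  have h3 : (Y t : ℂ) + (2 * π : ℂ)⁻¹ * ((∫ t in (0:ℝ)..2 * π, Y t : ℝ) : ℂ) -
      ((2 * π : ℂ)⁻¹ * ((∫ t in (0:ℝ)..2 * π, Y t : ℝ) : ℂ) + (2 * π : ℂ)⁻¹ * ((∫ t in (0:ℝ)..2 * π, Y t : ℝ) : ℂ)) =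
      ((Y t - (2 * π)⁻¹ * ∫ t in (0:ℝ)..2 * π, Y t : ℝ) : ℂ) := by
    push_cast; ring
  rw [h3] at h1
  exact_mod_cast h1

lemma coef_deriv {Y G : ℝ → ℝ} (hd : ∀ t, HasDerivAt Y (G t) t) (hG : Continuous G)
    (hp : Function.Periodic Y (2 * π)) (k : ℕ) : coef k G = k * Complex.I * coef k Y := by
  have hY : Continuous Y := continuous_iff_continuousAt.2 fun t => (hd t).continuousAt
  have h1 := intervalIntegral.integral_deriv_mul_eq_sub_of_hasDeriv_right (a := 0) (b := 2 * π)
    (u := fun t => (Y t : ℂ)) (v := wave (-k)) (u' := fun t => (G t : ℂ))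
    (v' := fun t => ((-k : ℤ) : ℂ) * Complex.I * wave (-k) t)
    (by fun_prop) (by fun_prop)
    (fun t _ => (hd t).ofReal_comp.hasDerivWithinAt)
    (fun t _ => (hasDerivAt_wave (-k) t).hasDerivWithinAt)
    (by apply Continuous.intervalIntegrable; fun_prop) (by apply Continuous.intervalIntegrable; fun_prop)
  have h2 := hp 0
  rw [zero_add] at h2
  have h3 : wave (-k) 0 = 1 := by simp [wave]
  rw [h2, wave_two_pi, h3, sub_self, intervalIntegral.integral_add] at h1
  · rw [coef, coef, eq_neg_of_add_eq_zero_left h1, ← intervalIntegral.integral_neg, mul_left_comm]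
    congr 1
    rw [← intervalIntegral.integral_const_mul]
    refine intervalIntegral.integral_congr fun t _ => ?_
    push_cast
    ring
  all_goals
    apply Continuous.intervalIntegrable
    fun_prop

lemma exists_periodic_primitive {h : ℝ → ℝ} (hh : Continuous h) (hp : Function.Periodic h (2 * π))
    (h0 : ∫ t in (0:ℝ)..2 * π, h t = 0) :
    ∃ P : ℝ → ℝ, (∀ t, HasDerivAt P (h t) t) ∧ Function.Periodic P (2 * π) ∧ ∫ t in (0:ℝ)..2 * π, P t = 0 := by
  set Q : ℝ → ℝ := fun t => ∫ s in (0:ℝ)..t, h s with hQ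
  have hQd : ∀ t, HasDerivAt Q (h t) t := fun t =>
    intervalIntegral.integral_hasDerivAt_right (hh.intervalIntegrable _ _) (hh.stronglyMeasurableAtFilter _ _) hh.continuousAt
  have hQc : Continuous Q := continuous_iff_continuousAt.2 fun t => (hQd t).continuousAt
  have hpos : (0:ℝ) < 2 * π := by positivity
  refine ⟨fun t => Q t - (2 * π)⁻¹ * ∫ t in (0:ℝ)..2 * π, Q t, fun t => (hQd t).sub_const _, fun t => ?_, ?_⟩
  · have h1 : Q (t + 2 * π) = Q t := by
      rw [hQ]
      change ∫ s in (0:ℝ)..(t + 2 * π), h s = ∫ s in (0:ℝ)..t, h s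
      rw [← intervalIntegral.integral_add_adjacent_intervals (hh.intervalIntegrable 0 t) (hh.intervalIntegrable t _),
        hp.intervalIntegral_add_eq t 0, zero_add, h0, add_zero]
    simp only [h1]
  · rw [intervalIntegral.integral_sub (hQc.intervalIntegrable _ _) (by simp), intervalIntegral.integral_const,
      sub_zero, smul_eq_mul]
    field_simp
    ring

/-- The Fourier series solution of `y'' = -h`. -/
lemma exists_hasSum_double_primitive {h : ℝ → ℝ} (hh : Continuous h) (hp : Function.Periodic h (2 * π))
    (h0 : ∫ t in (0:ℝ)..2 * π, h t = 0) :
    ∃ Y G : ℝ → ℝ, (∀ t, HasDerivAt Y (G t) t) ∧ (∀ t, HasDerivAt G (-h t) t) ∧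
      ∀ t, HasSum (fun k : ℕ => (coef (k + 1) h / ((k : ℂ) + 1) ^ 2 * wave (k + 1 : ℕ) t).re) (Y t) := by
  obtain ⟨G, hGd, hGp, hG0⟩ := exists_periodic_primitive (h := fun t => -h t) hh.neg
    (fun t => by simp only [hp t]) (by rw [intervalIntegral.integral_neg, h0, neg_zero])
  have hGc : Continuous G := continuous_iff_continuousAt.2 fun t => (hGd t).continuousAt
  obtain ⟨Y, hYd, hYp, hY0⟩ := exists_periodic_primitive hGc hGp hG0
  have hYc : Continuous Y := continuous_iff_continuousAt.2 fun t => (hYd t).continuousAt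
  have h1 : ∀ k : ℕ, coef (k + 1) Y = coef (k + 1) h / ((k : ℂ) + 1) ^ 2 := fun k => by
    have h2 := coef_deriv hGd hh.neg hGp (k + 1)
    rw [coef_deriv hYd hGc hYp] at h2
    have h3 : coef (k + 1) (fun t => -h t) = -coef (k + 1) h := by
      simp [coef]
    rw [h3] at h2
    have hk : ((k : ℂ) + 1) ≠ 0 := by exact_mod_cast Nat.succ_ne_zero k
    rw [eq_div_iff (pow_ne_zero 2 hk)]
    push_cast at h2
    linear_combination h2 + ((k : ℂ) + 1) ^ 2 * coef (k + 1) Y * Complex.I_sq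
  refine ⟨Y, G, hYd, hGd, fun t => ?_⟩
  obtain ⟨C, hC⟩ : ∃ C, ∀ t, |h t| ≤ C := by
    obtain ⟨C, hC⟩ := (hp.compact_of_continuous (by positivity) hh).exists_bound_of_continuousOn (f := fun x : ℝ => x)
      continuousOn_id
    exact ⟨C, fun t => hC _ ⟨t, rfl⟩⟩
  have hs : Summable fun k : ℕ => coef (k + 1) Y := by
    have hs1 : Summable fun i : ℕ => 1 / ((i : ℝ) + 1) ^ 2 := by
      have := (summable_nat_add_iff 1).2 (Real.summable_one_div_nat_pow.2 (by norm_num : 1 < 2))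
      simpa using this
    refine Summable.of_norm_bounded (hs1.mul_left (2 * C)) fun k => ?_
    rw [h1, norm_div, norm_pow, mul_one_div]
    have : ‖(k : ℂ) + 1‖ = (k : ℝ) + 1 := by
      have := Complex.norm_natCast (k + 1)
      push_cast at this
      exact this
    rw [this]
    gcongr
    exact norm_coef_le _ hC
  have h4 := hasSum_fourier_of_summable hYc hYp hs t
  rw [hY0, mul_zero, sub_zero] at h4
  simpa only [h1] using h4

end

section
open MeasureTheory Set Topology Filter
open scoped ContDiff

lemma tendsto_coef {h : ℕ → ℝ → ℝ} {h' : ℝ → ℝ} {B : ℝ} (hh : ∀ j, Continuous (h j)) (hB : ∀ j t, |h j t| ≤ B)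
    (hlim : ∀ t, Tendsto (fun j => h j t) atTop (𝓝 (h' t))) (k : ℕ) :
    Tendsto (fun j => coef k (h j)) atTop (𝓝 (coef k h')) := by
  refine Tendsto.const_mul _ (intervalIntegral.tendsto_integral_filter_of_dominated_convergence (fun _ => B)
    (Eventually.of_forall fun j => ?_) (Eventually.of_forall fun j => Eventually.of_forall fun t _ => ?_) (by simp)
    (Eventually.of_forall fun t _ => ?_))
  · have := hh j
    exact Continuous.aestronglyMeasurable (by fun_prop)
  · rw [norm_mul, norm_wave, mul_one, Complex.norm_real]
    exact hB j t
  · exact ((Complex.continuous_ofReal.tendsto _).comp (hlim t)).mul_const _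

lemma summable_inv_sq : Summable fun i : ℕ => 1 / ((i : ℝ) + 1) ^ 2 := by
  have := (summable_nat_add_iff 1).2 (Real.summable_one_div_nat_pow.2 (by norm_num : 1 < 2))
  simpa using this

section Limit
variable {n : ℕ}

lemma tendsto_coefMean {h : ℕ → ℝ → EuclideanSpace ℝ (Fin n)} {h' : ℝ → EuclideanSpace ℝ (Fin n)} {B : ℝ}
    (hh : ∀ j, Continuous (h j)) (hB : ∀ j t, ‖h j t‖ ≤ B)
    (hlim : ∀ t, Tendsto (fun j => h j t) atTop (𝓝 (h' t))) :
    Tendsto (fun j => coefMean (h j)) atTop (𝓝 (coefMean h')) :=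
  Tendsto.const_smul (intervalIntegral.tendsto_integral_filter_of_dominated_convergence (fun _ => B)
    (Eventually.of_forall fun j => (hh j).aestronglyMeasurable)
    (Eventually.of_forall fun j => Eventually.of_forall fun t _ => hB j t) (by simp)
    (Eventually.of_forall fun t _ => hlim t)) _

/-- Extension of the coefficients of a trigonometric polynomial by zero. -/
noncomputable def extendCoef {N : ℕ} (z : Fin N × Fin n → ℂ) (i : ℕ × Fin n) : ℂ :=
  if h : i.1 < N then z (⟨i.1, h⟩, i.2) else 0

/-- The curve with given Fourier coefficients. -/
noncomputable def curveSeries (x : EuclideanSpace ℝ (Fin n)) (z : ℕ × Fin n → ℂ) (t : ℝ) : EuclideanSpace ℝ (Fin n) :=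
  WithLp.toLp 2 fun l => x l + ∑' i : ℕ, (z (i, l) * wave (i + 1 : ℕ) t).re

lemma curveSeries_extendCoef {N : ℕ} (w : EuclideanSpace ℝ (Fin n) × (Fin N × Fin n → ℂ)) (t : ℝ) :
    curveSeries w.1 (extendCoef w.2) t = curve w t := by
  ext l
  rw [curve_apply]
  change w.1 l + _ = _
  congr 1
  rw [tsum_eq_sum (s := Finset.range N) fun i hi => by
    simp only [Finset.mem_range] at hi
    simp [extendCoef, hi], ← Fin.sum_univ_eq_sum_range]
  refine Finset.sum_congr rfl fun i _ => ?_
  simp [extendCoef]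

/-- The set of coefficients with quadratic decay. -/
def coefBox (n : ℕ) (M : ℝ) : Set (EuclideanSpace ℝ (Fin n) × (ℕ × Fin n → ℂ)) :=
  Metric.closedBall 0 M ×ˢ univ.pi fun i => Metric.closedBall 0 (M * (1 / ((i.1 : ℝ) + 1) ^ 2))

lemma mem_coefBox {M : ℝ} {w : EuclideanSpace ℝ (Fin n) × (ℕ × Fin n → ℂ)} :
    w ∈ coefBox n M ↔ ‖w.1‖ ≤ M ∧ ∀ i, ‖w.2 i‖ ≤ M * (1 / ((i.1 : ℝ) + 1) ^ 2) := by
  simp [coefBox, mem_prod]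

lemma isCompact_coefBox (M : ℝ) : IsCompact (coefBox n M) :=
  (isCompact_closedBall _ _).prod (isCompact_univ_pi fun _ => isCompact_closedBall _ _)

lemma summable_coefBox {M : ℝ} {w : EuclideanSpace ℝ (Fin n) × (ℕ × Fin n → ℂ)} (hw : w ∈ coefBox n M) (l : Fin n)
    (t : ℝ) : Summable fun i : ℕ => (w.2 (i, l) * wave (i + 1 : ℕ) t).re :=
  Summable.of_norm_bounded (summable_inv_sq.mul_left M) fun i => by
    refine (Complex.abs_re_le_norm _).trans ?_
    rw [norm_mul, norm_wave, mul_one]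
    exact (mem_coefBox.1 hw).2 (i, l)

/-- Coefficientwise convergence in a box implies uniform convergence of the curves. -/
lemma exists_uniform_bound_curveSeries {M : ℝ} {w : ℕ → EuclideanSpace ℝ (Fin n) × (ℕ × Fin n → ℂ)}
    {w' : EuclideanSpace ℝ (Fin n) × (ℕ × Fin n → ℂ)} (hw : ∀ j, w j ∈ coefBox n M) (hw' : w' ∈ coefBox n M)
    (hlim : Tendsto w atTop (𝓝 w')) :
    ∃ η : ℕ → ℝ, Tendsto η atTop (𝓝 0) ∧ ∀ j t, ‖curveSeries (w j).1 (w j).2 t - curveSeries w'.1 w'.2 t‖ ≤ η j := by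
  have hd : ∀ j l (i : ℕ), ‖(w j).2 (i, l) - w'.2 (i, l)‖ ≤ 2 * M * (1 / ((i : ℝ) + 1) ^ 2) := fun j l i => by
    have h1 := (mem_coefBox.1 (hw j)).2 (i, l)
    have h2 := (mem_coefBox.1 hw').2 (i, l)
    refine (norm_sub_le _ _).trans ?_
    linarith
  have hds : ∀ j l, Summable fun i : ℕ => ‖(w j).2 (i, l) - w'.2 (i, l)‖ := fun j l =>
    Summable.of_nonneg_of_le (fun i => norm_nonneg _) (hd j l) (summable_inv_sq.mul_left _)
  refine ⟨fun j => n * (‖(w j).1 - w'.1‖ + ∑ l, ∑' i : ℕ, ‖(w j).2 (i, l) - w'.2 (i, l)‖), ?_, fun j t => ?_⟩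
  · have h1 : Tendsto (fun j => ‖(w j).1 - w'.1‖) atTop (𝓝 0) :=
      tendsto_iff_norm_sub_tendsto_zero.1 ((continuous_fst.tendsto _).comp hlim)
    have h2 : ∀ l, Tendsto (fun j => ∑' i : ℕ, ‖(w j).2 (i, l) - w'.2 (i, l)‖) atTop (𝓝 (∑' _i : ℕ, (0:ℝ))) := fun l =>
      tendsto_tsum_of_dominated_convergence (summable_inv_sq.mul_left (2 * M))
        (fun i => tendsto_iff_norm_sub_tendsto_zero.1
          (((continuous_apply (i, l)).tendsto _).comp ((continuous_snd.tendsto _).comp hlim)))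
        (Eventually.of_forall fun j i => by rw [norm_norm]; exact hd j l i)
    have h3 := (h1.add (tendsto_finsetSum Finset.univ fun l _ => h2 l)).const_mul (n : ℝ)
    simpa using h3
  · refine norm_le_of_coord fun l => ?_
    change |((w j).1 l + _) - (w'.1 l + _)| ≤ _
    rw [add_sub_add_comm, ← (summable_coefBox (hw j) l t).tsum_sub (summable_coefBox hw' l t)]
    refine (abs_add_le _ _).trans (add_le_add (abs_coord_le ((w j).1 - w'.1) l) ?_)
    refine le_trans ?_ (Finset.single_le_sum (f := fun l => ∑' i : ℕ, ‖(w j).2 (i, l) - w'.2 (i, l)‖)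
      (fun l _ => tsum_nonneg fun i => norm_nonneg _) (Finset.mem_univ l))
    rw [← Real.norm_eq_abs]
    refine tsum_of_norm_bounded (hds j l).hasSum fun i => ?_
    rw [Real.norm_eq_abs]
    rw [← Complex.sub_re, ← sub_mul]
    refine (Complex.abs_re_le_norm _).trans ?_
    rw [norm_mul, norm_wave, mul_one]

/-- A curve whose Fourier coefficients satisfy the equation is a solution. -/
lemma curveSeries_solution {f : EuclideanSpace ℝ (Fin n) → EuclideanSpace ℝ (Fin n)} (hf : Continuous f)
    {x : EuclideanSpace ℝ (Fin n)} {z : ℕ × Fin n → ℂ} (hc : Continuous (curveSeries x z))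
    (hmean : coefMean (fun t => f (curveSeries x z t)) = 0)
    (hcoef : ∀ (k : ℕ) l, ((k : ℂ) + 1) ^ 2 * z (k, l) = coef (k + 1) fun t => f (curveSeries x z t) l) :
    Function.Periodic (curveSeries x z) (2 * π) ∧ ∃ u' : ℝ → EuclideanSpace ℝ (Fin n),
      (∀ t, HasDerivAt (curveSeries x z) (u' t) t) ∧ ∀ t, HasDerivAt u' (-f (curveSeries x z t)) t := by
  have hper : Function.Periodic (curveSeries x z) (2 * π) := fun t => by
    simp only [curveSeries, wave_periodic _ t]
  refine ⟨hper, ?_⟩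
  have hfc : Continuous fun t => f (curveSeries x z t) := by fun_prop
  have h1 : ∀ l, ∫ t in (0:ℝ)..2 * π, f (curveSeries x z t) l = 0 := fun l => by
    have h2 := coefMean_apply hfc l
    rw [hmean] at h2
    have h3 : (2 * π)⁻¹ ≠ 0 := by positivity
    exact (mul_eq_zero.1 h2.symm).resolve_left h3
  have h2 := fun l => exists_hasSum_double_primitive (h := fun t => f (curveSeries x z t) l) (by fun_prop)
    (fun t => by simp only [hper t]) (h1 l)
  choose Y G hY hG hsum using h2
  have h3 : ∀ (k : ℕ) l, coef (k + 1) (fun t => f (curveSeries x z t) l) / ((k : ℂ) + 1) ^ 2 = z (k, l) := fun k l => by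
    have hk : ((k : ℂ) + 1) ≠ 0 := by exact_mod_cast Nat.succ_ne_zero k
    rw [← hcoef, mul_div_cancel_left₀ _ (pow_ne_zero 2 hk)]
  simp only [h3] at hsum
  have h4 : curveSeries x z = fun t => WithLp.toLp 2 fun l => x l + Y l t := by
    funext t
    ext l
    change x l + _ = x l + Y l t
    rw [(hsum l t).tsum_eq]
  refine ⟨fun t => WithLp.toLp 2 fun l => G l t, fun t => ?_, fun t => ?_⟩
  · rw [h4]
    exact (PiLp.continuousLinearEquiv 2 ℝ (fun _ : Fin n => ℝ)).symm.hasFDerivAt.comp_hasDerivAt t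
      (hasDerivAt_pi.2 fun l => (hY l t).const_add (x l))
  · exact (PiLp.continuousLinearEquiv 2 ℝ (fun _ : Fin n => ℝ)).symm.hasFDerivAt.comp_hasDerivAt t
      (hasDerivAt_pi.2 fun l => hG l t)

/-- In the absence of nonconstant periodic solutions, all zeros of the Galerkin maps of high order are constants. -/
theorem exists_order_zeros_constant {κ : Type*}
    {f : EuclideanSpace ℝ (Fin n) → EuclideanSpace ℝ (Fin n)} (hf : Continuous f) (D : Option κ → SpecData n)
    {p : κ → EuclideanSpace ℝ (Fin n)} (hp : ∀ y, f y = 0 ↔ ∃ i, y = p i)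
    (hnear : ∀ i, HasFDerivAt f (D (some i)).L (p i))
    (hfar : ∀ ε > 0, ∃ C, ∀ y, ‖f y - (D none).L y‖ ≤ ε * ‖y‖ + C)
    (hno : ∀ u u' : ℝ → EuclideanSpace ℝ (Fin n), (∀ t, HasDerivAt u (u' t) t) → (∀ t, HasDerivAt u' (-f (u t)) t) →
      Function.Periodic u (2 * π) → ∃ c, ∀ t, u t = c) :
    ∃ N₀, ∀ N ≥ N₀, ∀ w : EuclideanSpace ℝ (Fin n) × (Fin N × Fin n → ℂ), gal f w = 0 → ∃ i, w = (p i, 0) := by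
  by_contra hcon
  push Not at hcon
  choose N hN w hw hwne using hcon
  obtain ⟨M, hM0, hM⟩ := (D none).exists_apriori_bound hf hfar
  have hbox : ∀ j, ((w j).1, extendCoef (w j).2) ∈ coefBox n M := fun j => by
    have h1 := hM _ _ (hw j)
    refine mem_coefBox.2 ⟨h1.1, fun i => ?_⟩
    simp only [extendCoef]
    split_ifs with h
    · exact h1.2 ⟨i.1, h⟩ i.2
    · rw [norm_zero]; positivity
  obtain ⟨v, hv, φ, hφ, hlim⟩ := (isCompact_coefBox M).tendsto_subseq hbox
  obtain ⟨η, hη, hη'⟩ := exists_uniform_bound_curveSeries (fun j => hbox (φ j)) hv hlim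
  simp only [curveSeries_extendCoef] at hη'
  set u := curveSeries v.1 v.2 with hu
  have hunif : TendstoUniformly (fun j => curve (w (φ j))) u atTop := by
    rw [Metric.tendstoUniformly_iff]
    intro ε hε
    filter_upwards [hη.eventually (gt_mem_nhds hε)] with j hj t
    rw [dist_comm, dist_eq_norm]
    exact (hη' j t).trans_lt hj
  have huc : Continuous u := hunif.continuous (Eventually.of_forall fun j => continuous_curve _).frequently
  obtain ⟨B, hB⟩ : ∃ B, ∀ j t, ‖f (curve (w j) t)‖ ≤ B := by
    obtain ⟨B, hB⟩ := (isCompact_closedBall (0 : EuclideanSpace ℝ (Fin n))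
      (n * (M + M * ∑' i : ℕ, 1 / ((i : ℝ) + 1) ^ 2))).exists_bound_of_continuousOn hf.continuousOn
    refine ⟨B, fun j t => hB _ (mem_closedBall_zero_iff.2 ?_)⟩
    have h1 := hM _ _ (hw j)
    refine (norm_curve_le_of_coord h1.2 hM0 t).trans ?_
    gcongr
    exact h1.1
  have hpt : ∀ t, Tendsto (fun j => f (curve (w (φ j)) t)) atTop (𝓝 (f (u t))) := fun t =>
    (hf.tendsto _).comp (hunif.tendsto_at t)
  have hcc : ∀ j, Continuous fun t => f (curve (w j) t) := fun j => by fun_prop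
  have hmean : coefMean (fun t => f (u t)) = 0 := by
    refine tendsto_nhds_unique (tendsto_coefMean (fun j => hcc (φ j)) (fun j t => hB (φ j) t) hpt) ?_
    refine tendsto_const_nhds.congr fun j => ?_
    have := congrArg Prod.fst (hw (φ j))
    simp only [gal, fourierPart, Prod.fst_sub, zero_sub, Prod.fst_zero, neg_eq_zero] at this
    exact this.symm
  have hcoef : ∀ (k : ℕ) l, ((k : ℂ) + 1) ^ 2 * v.2 (k, l) = coef (k + 1) fun t => f (u t) l := fun k l => by
    have h1 : Tendsto (fun j => coef (k + 1) fun t => f (curve (w (φ j)) t) l) atTop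
        (𝓝 (coef (k + 1) fun t => f (u t) l)) :=
      tendsto_coef (fun j => by have := hcc (φ j); fun_prop) (fun j t => (abs_coord_le _ _).trans (hB (φ j) t))
        (fun t => ((EuclideanSpace.proj (𝕜 := ℝ) l).continuous.tendsto _).comp (hpt t)) (k + 1)
    have h2 : Tendsto (fun j => ((k : ℂ) + 1) ^ 2 * extendCoef (w (φ j)).2 (k, l)) atTop
        (𝓝 (((k : ℂ) + 1) ^ 2 * v.2 (k, l))) :=
      (((continuous_apply (k, l)).tendsto _).comp ((continuous_snd.tendsto _).comp hlim)).const_mul _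
    refine tendsto_nhds_unique (h2.congr' ?_) h1
    filter_upwards [eventually_gt_atTop k] with j hj
    have hk : k < N (φ j) := hj.trans_le ((hφ.id_le j).trans (hN (φ j)))
    have h3 := congrFun (congrArg Prod.snd (hw (φ j))) (⟨k, hk⟩, l)
    simp only [gal, fourierPart, Prod.snd_sub, Pi.sub_apply, Prod.snd_zero, Pi.zero_apply, freq] at h3
    rw [sub_eq_zero] at h3
    rw [← h3, extendCoef, dif_pos hk]
    push_cast
    rfl
  obtain ⟨hper, u', hu1, hu2⟩ := curveSeries_solution hf huc hmean hcoef
  obtain ⟨c, hc⟩ := hno u u' hu1 hu2 hper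
  have hfc : f c = 0 := by
    have h1 : ∀ t, u' t = 0 := fun t => by
      refine (hu1 t).unique ?_
      have h0 : u = fun _ => c := funext hc
      change HasDerivAt u 0 t
      rw [h0]
      exact hasDerivAt_const t c
    have h2 := hu2 0
    rw [show u' = fun _ => 0 from funext h1] at h2
    have h3 := h2.unique (hasDerivAt_const (0:ℝ) (0 : EuclideanSpace ℝ (Fin n)))
    change -f (u 0) = 0 at h3
    rw [hc, neg_eq_zero] at h3
    exact h3
  obtain ⟨i, rfl⟩ := (hp c).1 hfc
  obtain ⟨δ, hδ, hiso⟩ := (D (some i)).exists_isolating_radius hf hfc (hnear i)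
  obtain ⟨j, hj⟩ := (hη.eventually (gt_mem_nhds hδ)).exists
  refine hwne (φ j) i (hiso _ _ (hw (φ j)) fun t => ?_)
  have := hη' j t
  rw [hc] at this
  exact this.trans hj.le

end Limit

end

section
open MeasureTheory Set Topology Filter
open scoped ContDiff

namespace SpecData
variable {n : ℕ}

/-- The number of eigenvalues above `k ^ 2`. -/
noncomputable def count (D : SpecData n) (k : ℕ) : ℕ := (Finset.univ.filter fun l => (k : ℝ) ^ 2 < D.a l).card

/-- The sign of the determinant of `-L`. -/
noncomputable def sgn (D : SpecData n) : ℤ := (-1) ^ (Finset.univ.filter fun l => 0 < D.a l).card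

lemma sign_det_neg (D : SpecData n) : ((SignType.sign (-D.L).det : SignType) : ℝ) = (D.sgn : ℝ) := by
  rw [D.det_neg, sgn, ← Finset.prod_const, Finset.prod_filter]
  have h : ∀ s : Finset (Fin n), ((SignType.sign (∏ l ∈ s, (-D.a l)) : SignType) : ℝ) =
      ((∏ l ∈ s, (if 0 < D.a l then (-1 : ℤ) else 1) : ℤ) : ℝ) := fun s => by
    induction s using Finset.induction_on with
    | empty => simp
    | insert l s hl ih =>
      rw [Finset.prod_insert hl, Finset.prod_insert hl, sign_mul, SignType.coe_mul, ih, Int.cast_mul]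
      congr 1
      rcases lt_or_gt_of_ne (D.a_ne l) with h0 | h0
      · rw [sign_pos (neg_pos.2 h0), if_neg h0.not_gt]; simp
      · rw [sign_neg (neg_neg_of_pos h0), if_pos h0]; simp
  exact h _

lemma index_preModel (D : SpecData n) (N : ℕ) (q : ℕ → ℕ) :
    (D.preModel N).index (fun i => q i.1) = D.sgn * ∑ k : Fin N, (q k : ℝ) * D.count (k + 1) := by
  rw [PreModel.index]
  change ((SignType.sign (-D.L).det : SignType) : ℝ) * _ = _
  rw [D.sign_det_neg, Finset.sum_filter, Fintype.sum_prod_type]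
  congr 1
  refine Finset.sum_congr rfl fun k _ => ?_
  rw [← Finset.sum_filter]
  change ∑ _l with _, (q k : ℝ) = _
  rw [Finset.sum_const, nsmul_eq_mul, mul_comm, count]
  congr 2
  refine congrArg Finset.card (Finset.filter_congr fun l _ => ?_)
  change ((freq N n (k, l) : ℕ) : ℝ) ^ 2 - D.a l < 0 ↔ _
  rw [sub_neg, freq]

end SpecData

variable {n : ℕ}

/-- If all `2π`-periodic solutions are constant, the weighted eigenvalue counts balance for `k = 1`
as soon as they balance for all `k ≥ 2`. -/
theorem count_one_balanced {κ : Type*} [Fintype κ] {V : EuclideanSpace ℝ (Fin n) → ℝ}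
    {f : EuclideanSpace ℝ (Fin n) → EuclideanSpace ℝ (Fin n)} (hf : LocallyLipschitz f)
    (hV : ∀ y, HasGradientAt V (f y) y) (D : Option κ → SpecData n)
    {p : κ → EuclideanSpace ℝ (Fin n)} (hinj : Function.Injective p) (hp : ∀ y, f y = 0 ↔ ∃ i, y = p i)
    (hnear : ∀ i, HasFDerivAt f (D (some i)).L (p i))
    (hfar : ∀ ε > 0, ∃ C, ∀ y, ‖f y - (D none).L y‖ ≤ ε * ‖y‖ + C)
    (hno : ∀ u u' : ℝ → EuclideanSpace ℝ (Fin n), (∀ t, HasDerivAt u (u' t) t) → (∀ t, HasDerivAt u' (-f (u t)) t) →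
      Function.Periodic u (2 * π) → ∃ c, ∀ t, u t = c)
    (hbal : ∀ k, 2 ≤ k → ∑ i, (D (some i)).sgn * (D (some i)).count k = (D none).sgn * (D none).count k) :
    ∑ i, (D (some i)).sgn * (D (some i)).count 1 = (D none).sgn * (D none).count 1 := by
  obtain ⟨N₀, hN₀⟩ := exists_order_zeros_constant hf.continuous D hp hnear hfar hno
  obtain ⟨q, hq⟩ : ∃ q : ℕ → ℕ, ∀ k, q k = (N₀ + 1).factorial / (k + 1) := ⟨_, fun _ => rfl⟩
  have hdvd : ∀ k : Fin (N₀ + 1), ((k : ℕ) + 1) ∣ (N₀ + 1).factorial := fun k => Nat.dvd_factorial (Nat.succ_pos _) k.2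
  have key := sum_index_eq_of_asymptotics (k := freq (N₀ + 1) n) (v := gal f) (locallyLipschitz_gal hf)
    (fun x z θ hθ => gal_rot f x z hθ) (gal_orth hf.continuous hV) hinj (hN₀ (N₀ + 1) (Nat.le_succ _))
    (fun o => (D o).preModel (N₀ + 1)) (fun i => gal_near hf.continuous _ ((hp _).2 ⟨i, rfl⟩) (hnear i))
    (gal_far hf.continuous _ hfar) (q := fun i => q i.1) (K := (N₀ + 1).factorial) (fun i => Nat.succ_pos _)
    (fun i => by rw [hq]; exact Nat.mul_div_cancel' (hdvd i.1))
    (fun i => by rw [hq]; exact Nat.div_pos (Nat.le_of_dvd (Nat.factorial_pos _) (hdvd i.1)) (Nat.succ_pos _))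
  simp only [SpecData.index_preModel, Fin.sum_univ_succ, mul_add, Finset.sum_add_distrib] at key
  have htail : ∑ i, ((D (some i)).sgn : ℝ) * ∑ k : Fin N₀, (q k.succ : ℝ) * (D (some i)).count (k.succ + 1) =
      (D none).sgn * ∑ k : Fin N₀, (q k.succ : ℝ) * (D none).count (k.succ + 1) := by
    simp only [Finset.mul_sum]
    rw [Finset.sum_comm]
    refine Finset.sum_congr rfl fun k _ => ?_
    have h := hbal (k.succ + 1) (by simp)
    have h' : ∑ i, ((D (some i)).sgn : ℝ) * (D (some i)).count (k.succ + 1) =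
        (D none).sgn * (D none).count (k.succ + 1) := by exact_mod_cast h
    rw [mul_left_comm, ← h', Finset.mul_sum]
    exact Finset.sum_congr rfl fun i _ => mul_left_comm _ _ _
  rw [htail, add_left_inj] at key
  have hq0 : (q 0 : ℝ) ≠ 0 := by
    rw [hq]
    simpa using Nat.factorial_ne_zero (N₀ + 1)
  have h1 : (q 0 : ℝ) * ∑ i, ((D (some i)).sgn : ℝ) * (D (some i)).count 1 =
      q 0 * ((D none).sgn * (D none).count 1) := by
    rw [Finset.mul_sum, mul_left_comm]
    refine Eq.trans (Finset.sum_congr rfl fun i _ => mul_left_comm _ _ _) key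
  have h2 := mul_left_cancel₀ hq0 h1
  exact_mod_cast h2

end

section
open MeasureTheory Set Topology Filter
open scoped ContDiff

section Assembly
variable {n : ℕ}

lemma finrank_ker_sub_smul {L : EuclideanSpace ℝ (Fin n) →L[ℝ] EuclideanSpace ℝ (Fin n)}
    {e : OrthonormalBasis (Fin n) ℝ (EuclideanSpace ℝ (Fin n))} {a : Fin n → ℝ} (h : ∀ l, L (e l) = a l • e l) (μ : ℝ) :
    Module.finrank ℝ (LinearMap.ker ((L : EuclideanSpace ℝ (Fin n) →ₗ[ℝ] EuclideanSpace ℝ (Fin n)) -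
      μ • (LinearMap.id : EuclideanSpace ℝ (Fin n) →ₗ[ℝ] EuclideanSpace ℝ (Fin n)))) =
      (Finset.univ.filter fun l => a l = μ).card := by
  have hker : LinearMap.ker ((L : EuclideanSpace ℝ (Fin n) →ₗ[ℝ] EuclideanSpace ℝ (Fin n)) -
      μ • (LinearMap.id : EuclideanSpace ℝ (Fin n) →ₗ[ℝ] EuclideanSpace ℝ (Fin n))) =
      Submodule.span ℝ (range fun l : {l // a l = μ} => e l) := by
    refine le_antisymm (fun x hx => ?_) (Submodule.span_le.2 ?_)
    · have hx' : L x - μ • x = 0 := hx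
      have hrep : L x = ∑ l, (⟪e l, x⟫ * a l) • e l := by
        conv_lhs => rw [← e.sum_repr' x]
        simp only [map_sum, map_smul, h, smul_smul]
      rw [← e.sum_repr' x]
      refine Submodule.sum_mem _ fun l _ => ?_
      by_cases hl : a l = μ
      · exact Submodule.smul_mem _ _ (Submodule.subset_span ⟨⟨l, hl⟩, rfl⟩)
      · have h1 : ⟪e l, L x - μ • x⟫ = 0 := by rw [hx', inner_zero_right]
        rw [inner_sub_right, inner_smul_right, hrep, e.orthonormal.inner_right_fintype] at h1
        have h2 : (⟪e l, x⟫ : ℝ) = 0 := by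
          have : (a l - μ) * ⟪e l, x⟫ = 0 := by linarith
          exact (mul_eq_zero.1 this).resolve_left (sub_ne_zero.2 hl)
        rw [h2, zero_smul]
        exact Submodule.zero_mem _
    · rintro _ ⟨⟨l, hl⟩, rfl⟩
      change L (e l) - μ • e l = 0
      rw [h, hl, sub_self]
  have hli : LinearIndependent ℝ fun l : {l // a l = μ} => e l :=
    e.orthonormal.linearIndependent.comp (Subtype.val : {l // a l = μ} → Fin n) Subtype.val_injective
  rw [hker, finrank_span_eq_card hli, Fintype.card_subtype]

lemma eigCountAbove_eq_card {L : EuclideanSpace ℝ (Fin n) →L[ℝ] EuclideanSpace ℝ (Fin n)}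
    {e : OrthonormalBasis (Fin n) ℝ (EuclideanSpace ℝ (Fin n))} {a : Fin n → ℝ} (h : ∀ l, L (e l) = a l • e l) (c : ℝ) :
    eigCountAbove L c = (Finset.univ.filter fun l => c < a l).card := by
  simp only [eigCountAbove, finrank_ker_sub_smul h]
  rw [Finset.card_eq_sum_card_image a, finsum_mem_eq_sum_of_inter_support_eq
    (t := (Finset.univ.filter fun l => c < a l).image a)]
  · refine Finset.sum_congr rfl fun μ hμ => congrArg _ ?_
    obtain ⟨l', hl', rfl⟩ := Finset.mem_image.1 hμ
    have := (Finset.mem_filter.1 hl').2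
    ext l
    simp only [Finset.mem_filter, Finset.mem_univ, true_and]
    exact ⟨fun hl => ⟨hl ▸ this, hl⟩, fun hl => hl.2⟩
  · ext μ
    simp only [mem_inter_iff, mem_ofPred_eq, Function.mem_support, Finset.coe_image, mem_image, Finset.coe_filter,
      Finset.mem_univ, true_and, Finset.card_ne_zero, Finset.Nonempty, Finset.mem_filter]
    constructor
    · rintro ⟨hc, l, rfl⟩
      exact ⟨⟨l, hc, rfl⟩, l, rfl⟩
    · rintro ⟨⟨l, hc, rfl⟩, -⟩
      exact ⟨hc, l, rfl⟩

lemma exists_eigenbasis {L : EuclideanSpace ℝ (Fin n) →L[ℝ] EuclideanSpace ℝ (Fin n)}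
    (hs : ∀ x y, ⟪L x, y⟫ = ⟪x, L y⟫) :
    ∃ (e : OrthonormalBasis (Fin n) ℝ (EuclideanSpace ℝ (Fin n))) (a : Fin n → ℝ), ∀ l, L (e l) = a l • e l := by
  have hS : (L : EuclideanSpace ℝ (Fin n) →ₗ[ℝ] EuclideanSpace ℝ (Fin n)).IsSymmetric := hs
  have hn : Module.finrank ℝ (EuclideanSpace ℝ (Fin n)) = n := by simp
  exact ⟨hS.eigenvectorBasis hn, hS.eigenvalues hn, fun l => hS.apply_eigenvectorBasis hn l⟩

lemma exists_eigCountAbove_eq_zero {L : EuclideanSpace ℝ (Fin n) →L[ℝ] EuclideanSpace ℝ (Fin n)}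
    (hs : ∀ x y, ⟪L x, y⟫ = ⟪x, L y⟫) : ∃ C, ∀ c ≥ C, eigCountAbove L c = 0 := by
  obtain ⟨e, a, h⟩ := exists_eigenbasis hs
  refine ⟨∑ l, |a l|, fun c hc => ?_⟩
  rw [eigCountAbove_eq_card h, Finset.card_eq_zero, Finset.filter_eq_empty_iff]
  intro l _
  exact not_lt.2 ((le_abs_self _).trans
    ((Finset.single_le_sum (f := fun l => |a l|) (fun _ _ => abs_nonneg _) (Finset.mem_univ l)).trans hc))

lemma exists_specData {L : EuclideanSpace ℝ (Fin n) →L[ℝ] EuclideanSpace ℝ (Fin n)}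
    (hs : ∀ x y, ⟪L x, y⟫ = ⟪x, L y⟫) (hinj : Function.Injective L) {c : ℝ} (hc : 0 < c)
    (hres : ∀ k : ℕ, 1 ≤ k → ∀ x, L x = ((k : ℝ) ^ 2 / c) • x → x = 0) :
    ∃ D : SpecData n, D.L = c • L ∧ (∀ k : ℕ, D.count k = eigCountAbove L ((k : ℝ) ^ 2 / c)) ∧
      D.sgn = (-1) ^ eigCountAbove L 0 := by
  obtain ⟨e, a, h⟩ := exists_eigenbasis hs
  have hne : ∀ l, e l ≠ 0 := fun l => e.orthonormal.ne_zero l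
  refine ⟨⟨c • L, e, fun l => c * a l, fun l x => ?_, fun l => ?_, fun l k hk hl => ?_⟩, rfl, fun k => ?_, ?_⟩
  · change ⟪e l, c • L x⟫ = _
    rw [inner_smul_right, ← hs, h, real_inner_smul_left, mul_assoc]
  · refine mul_ne_zero hc.ne' fun h0 => hne l (hinj ?_)
    rw [h, h0, zero_smul, map_zero]
  · refine hne l (hres k hk _ ?_)
    rw [h, ← hl, mul_div_cancel_left₀ _ hc.ne']
  · rw [eigCountAbove_eq_card h, SpecData.count]
    exact congrArg _ (Finset.filter_congr fun l _ => by rw [div_lt_iff₀' hc])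
  · rw [eigCountAbove_eq_card h, SpecData.sgn]
    exact congrArg _ (congrArg _ (Finset.filter_congr fun l _ => by rw [mul_pos_iff_of_pos_left hc]))

section Gradient
variable {V : EuclideanSpace ℝ (Fin n) → ℝ} (hV : ContDiff ℝ 2 V)
include hV

lemma contDiff_gradient : ContDiff ℝ 1 (gradient V) := by
  have h : ContDiff ℝ 1 (fderiv ℝ V) := hV.fderiv_right (m := 1) (by norm_num)
  exact (InnerProductSpace.toDual ℝ (EuclideanSpace ℝ (Fin n))).symm.contDiff.comp h

lemma hasGradientAt_of_contDiff (y : EuclideanSpace ℝ (Fin n)) : HasGradientAt V (gradient V y) y :=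
  ((hV.differentiable (by norm_num)) y).hasGradientAt

lemma hessian_symmetric (p x y : EuclideanSpace ℝ (Fin n)) :
    ⟪fderiv ℝ (gradient V) p x, y⟫ = ⟪x, fderiv ℝ (gradient V) p y⟫ := by
  have hd : DifferentiableAt ℝ (fderiv ℝ V) p :=
    ((hV.fderiv_right (m := 1) (by norm_num)).differentiable (by norm_num)) p
  have h : ∀ x, fderiv ℝ (gradient V) p x =
      (InnerProductSpace.toDual ℝ (EuclideanSpace ℝ (Fin n))).symm (fderiv ℝ (fderiv ℝ V) p x) := fun x => by
    have := ((InnerProductSpace.toDual ℝ (EuclideanSpace ℝ (Fin n))).symm.toContinuousLinearEquiv :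
      _ ≃L[ℝ] _).toContinuousLinearMap.hasFDerivAt.comp p hd.hasFDerivAt
    exact congrArg (fun A : EuclideanSpace ℝ (Fin n) →L[ℝ] EuclideanSpace ℝ (Fin n) => A x) this.fderiv
  have hsymm : IsSymmSndFDerivAt ℝ V p := hV.contDiffAt.isSymmSndFDerivAt (by simp)
  rw [real_inner_comm (fderiv ℝ (gradient V) p y) x, h, h, InnerProductSpace.toDual_symm_apply, InnerProductSpace.toDual_symm_apply]
  exact hsymm x y

end Gradient

lemma exists_asymptotic_bound {g : EuclideanSpace ℝ (Fin n) → EuclideanSpace ℝ (Fin n)} (hg : Continuous g)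
    {B : EuclideanSpace ℝ (Fin n) →L[ℝ] EuclideanSpace ℝ (Fin n)}
    (h : ∀ ε > (0 : ℝ), ∃ R : ℝ, ∀ x, R < ‖x‖ → ‖g x - B x‖ ≤ ε * ‖x‖) {ε : ℝ} (hε : 0 < ε) :
    ∃ C, ∀ y, ‖g y - B y‖ ≤ ε * ‖y‖ + C := by
  obtain ⟨R, hR⟩ := h ε hε
  obtain ⟨C, hC⟩ := (isCompact_closedBall (0 : EuclideanSpace ℝ (Fin n)) R).exists_bound_of_continuousOn
    (hg.sub B.continuous).continuousOn
  refine ⟨max C 0, fun y => ?_⟩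
  rcases lt_or_ge R ‖y‖ with hy | hy
  · exact (hR y hy).trans (le_add_of_nonneg_right (le_max_right _ _))
  · exact (hC y (mem_closedBall_zero_iff.2 hy)).trans ((le_max_left _ _).trans (le_add_of_nonneg_left (by positivity)))

/-- Rescaling time turns a solution of the rescaled equation into one of the original equation. -/
lemma rescale_solution {g : EuclideanSpace ℝ (Fin n) → EuclideanSpace ℝ (Fin n)} (hg : Continuous g) {s : ℝ} (hs : s ≠ 0)
    {u u' : ℝ → EuclideanSpace ℝ (Fin n)} (h1 : ∀ t, HasDerivAt u (u' t) t)
    (h2 : ∀ t, HasDerivAt u' (-((1 / s ^ 2) • g (u t))) t) :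
    ContDiff ℝ 2 (fun t => u (s * t)) ∧ ∀ t, deriv (deriv fun t => u (s * t)) t = -g (u (s * t)) := by
  have hlin : ∀ t, HasDerivAt (fun t : ℝ => s * t) s t := fun t => by simpa using (hasDerivAt_id t).const_mul s
  have d1 : ∀ t, HasDerivAt (fun t => u (s * t)) (s • u' (s * t)) t := fun t => (h1 (s * t)).scomp t (hlin t)
  have d2 : ∀ t, HasDerivAt (fun t => s • u' (s * t)) (-g (u (s * t))) t := fun t => by
    have h := ((h2 (s * t)).scomp t (hlin t)).const_smul s
    refine h.congr_deriv ?_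
    rw [smul_neg, smul_neg, smul_smul, smul_smul, show s * s * (1 / s ^ 2) = 1 by field_simp, one_smul]
  have e1 : deriv (fun t => u (s * t)) = fun t => s • u' (s * t) := funext fun t => (d1 t).deriv
  have e2 : deriv (fun t => s • u' (s * t)) = fun t => -g (u (s * t)) := funext fun t => (d2 t).deriv
  have hu : Continuous fun t => u (s * t) := continuous_iff_continuousAt.2 fun t => (d1 t).continuousAt
  refine ⟨?_, fun t => by rw [e1, e2]⟩
  have c1 : ContDiff ℝ 1 (fun t => s • u' (s * t)) :=
    contDiff_one_iff_deriv.2 ⟨fun t => (d2 t).differentiableAt, by rw [e2]; exact (hg.comp hu).neg⟩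
  rw [show (2 : WithTop ℕ∞) = 1 + 1 by norm_num, contDiff_succ_iff_deriv]
  exact ⟨fun t => (d1 t).differentiableAt, by simp, by rw [e1]; exact c1⟩

end Assembly

end

/-- Existence of non-stationary periodic solutions, nondegenerate nonresonant
case (Theorem 5.6). -/
theorem existence_nonstationary_periodic_solution
    (T : ℝ) (hT : 0 < T) (n q : ℕ)
    (V : EuclideanSpace ℝ (Fin n) → ℝ) (hV : ContDiff ℝ 2 V)
    -- (i) (∇V)⁻¹(0) = {p₁, …, p_q}, with nondegenerate Hessians
    (p : Fin q → EuclideanSpace ℝ (Fin n)) (hinj : Function.Injective p)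
    (hzeros : {x : EuclideanSpace ℝ (Fin n) | gradient V x = 0} = Set.range p)
    (hnd : ∀ i : Fin q, Function.Injective (fderiv ℝ (gradient V) (p i)))
    -- (ii) asymptotically linear with nondegenerate symmetric linearization B
    (B : EuclideanSpace ℝ (Fin n) →L[ℝ] EuclideanSpace ℝ (Fin n))
    (hBsym : ∀ x y : EuclideanSpace ℝ (Fin n), ⟪B x, y⟫ = ⟪x, B y⟫)
    (hBnd : Function.Injective B)
    (hasymp : ∀ ε > (0 : ℝ), ∃ R : ℝ, ∀ x : EuclideanSpace ℝ (Fin n),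
      R < ‖x‖ → ‖gradient V x - B x‖ ≤ ε * ‖x‖)
    -- (iii) no eigenvalue of B nor of any Hessian D²V(pᵢ) equals 4k²π²/T², k ≥ 1
    (hresB : ∀ k : ℕ, 1 ≤ k → ∀ x : EuclideanSpace ℝ (Fin n),
      B x = ((4 * (k : ℝ) ^ 2 * π ^ 2) / T ^ 2) • x → x = 0)
    (hresH : ∀ i : Fin q, ∀ k : ℕ, 1 ≤ k → ∀ x : EuclideanSpace ℝ (Fin n),
      fderiv ℝ (gradient V) (p i) x = ((4 * (k : ℝ) ^ 2 * π ^ 2) / T ^ 2) • x → x = 0)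
    -- (iv) the index inequality for some k ≥ 1
    (hk : ∃ k : ℕ, 1 ≤ k ∧
      ((-1 : ℤ) ^ eigCountAbove B 0 *
          eigCountAbove B ((4 * (k : ℝ) ^ 2 * π ^ 2) / T ^ 2)) ≠
        ∑ i : Fin q,
          ((-1 : ℤ) ^ eigCountAbove (fderiv ℝ (gradient V) (p i)) 0 *
            eigCountAbove (fderiv ℝ (gradient V) (p i))
              ((4 * (k : ℝ) ^ 2 * π ^ 2) / T ^ 2))) :
    -- conclusion: a non-stationary T-periodic solution of ẍ = -∇V(x) exists
    ∃ u : ℝ → EuclideanSpace ℝ (Fin n),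
      ContDiff ℝ 2 u ∧ (∀ t, u (t + T) = u t) ∧
      (∀ t, deriv (deriv u) t = -gradient V (u t)) ∧
      ¬(∃ c : EuclideanSpace ℝ (Fin n), ∀ t, u t = c) := by
  by_contra hcon
  have hgC1 := contDiff_gradient hV
  have hg : Continuous (gradient V) := hgC1.continuous
  have hzero : ∀ y, gradient V y = 0 ↔ ∃ i, y = p i := fun y => by
    have h : y ∈ {x | gradient V x = 0} ↔ y ∈ Set.range p := by rw [hzeros]
    exact h.trans ⟨fun ⟨i, hi⟩ => ⟨i, hi.symm⟩, fun ⟨i, hi⟩ => ⟨i, hi.symm⟩⟩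
  -- The linearizations at infinity and at the zeros.
  obtain ⟨L, hLn, hLs⟩ : ∃ L : Option (Fin q) → EuclideanSpace ℝ (Fin n) →L[ℝ] EuclideanSpace ℝ (Fin n),
      L none = B ∧ ∀ i, L (some i) = fderiv ℝ (gradient V) (p i) :=
    ⟨fun o => o.elim B fun i => fderiv ℝ (gradient V) (p i), rfl, fun i => rfl⟩
  have hLsym : ∀ o x y, ⟪L o x, y⟫ = ⟪x, L o y⟫ := by
    rintro (_ | i)
    · rwa [hLn]
    · rw [hLs]; exact hessian_symmetric hV (p i)
  have hLinj : ∀ o, Function.Injective (L o) := by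
    rintro (_ | i)
    · rwa [hLn]
    · rw [hLs]; exact hnd i
  have hLres : ∀ o, ∀ k : ℕ, 1 ≤ k → ∀ x, L o x = ((4 * (k : ℝ) ^ 2 * π ^ 2) / T ^ 2) • x → x = 0 := by
    rintro (_ | i)
    · rwa [hLn]
    · rw [hLs]; exact hresH i
  simp only [← hLn, ← hLs] at hk
  -- The largest order at which the counts differ.
  set S : Set ℕ := {k | 1 ≤ k ∧ ((-1 : ℤ) ^ eigCountAbove (L none) 0 *
      eigCountAbove (L none) ((4 * (k : ℝ) ^ 2 * π ^ 2) / T ^ 2)) ≠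
        ∑ i : Fin q, ((-1 : ℤ) ^ eigCountAbove (L (some i)) 0 *
            eigCountAbove (L (some i)) ((4 * (k : ℝ) ^ 2 * π ^ 2) / T ^ 2))} with hS
  choose C hC using fun o => exists_eigCountAbove_eq_zero (hLsym o)
  have hSb : BddAbove S := by
    have hlim : Filter.Tendsto (fun k : ℕ => (4 * (k : ℝ) ^ 2 * π ^ 2) / T ^ 2) Filter.atTop Filter.atTop := by
      have h : Filter.Tendsto (fun k : ℕ => (4 * π ^ 2 / T ^ 2) * (k : ℝ) ^ 2) Filter.atTop Filter.atTop :=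
        ((Filter.tendsto_pow_atTop two_ne_zero).comp tendsto_natCast_atTop_atTop).const_mul_atTop (by positivity)
      exact h.congr fun k => by ring
    obtain ⟨m, hm⟩ := Filter.eventually_atTop.1
      ((Filter.eventually_all.2 fun o => hlim.eventually_ge_atTop (C o)))
    refine ⟨m, fun k hkS => ?_⟩
    by_contra hlt
    refine hkS.2 ?_
    have h0 : ∀ o, eigCountAbove (L o) ((4 * (k : ℝ) ^ 2 * π ^ 2) / T ^ 2) = 0 := fun o =>
      hC o _ (hm k (not_le.1 hlt).le o)
    simp only [h0, Nat.cast_zero, mul_zero, Finset.sum_const_zero]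
  obtain ⟨d, hdS, hdmax⟩ : ∃ d ∈ S, ∀ k ∈ S, k ≤ d :=
    ⟨sSup S, Nat.sSup_mem hk hSb, fun k hkS => le_csSup hSb hkS⟩
  have hd1 : 1 ≤ d := hdS.1
  have hd0 : (0 : ℝ) < d := by exact_mod_cast hd1
  obtain ⟨s, hs⟩ : ∃ s : ℝ, s = 2 * π * d / T := ⟨_, rfl⟩
  have hs0 : 0 < s := by rw [hs]; positivity
  obtain ⟨c, hc⟩ : ∃ c : ℝ, c = 1 / s ^ 2 := ⟨_, rfl⟩
  have hc0 : 0 < c := by rw [hc]; positivity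
  have hthr : ∀ k : ℕ, (k : ℝ) ^ 2 / c = (4 * ((k * d : ℕ) : ℝ) ^ 2 * π ^ 2) / T ^ 2 := fun k => by
    rw [hc, hs]
    push_cast
    field_simp
    ring
  choose D hDL hDc hDs using fun o => exists_specData (hLsym o) (hLinj o) hc0
    (fun k hk1 x hx => hLres o (k * d) (Nat.mul_pos hk1 hd1) x (by rw [← hthr]; exact hx))
  simp only [hthr] at hDc
  have hfC1 : ContDiff ℝ 1 fun y => c • gradient V y := hgC1.const_smul c
  refine hdS.2 ?_
  have key := count_one_balanced (V := fun y => c * V y) (f := fun y => c • gradient V y) (p := p) (D := D)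
    hfC1.locallyLipschitz (fun y => ?_) hinj (fun y => ?_) (fun i => ?_) (fun ε hε => ?_)
    (fun u u' h1 h2 hper => ?_) (fun k hk2 => ?_)
  · simpa only [hDs, hDc, one_mul] using key.symm
  · rw [hasGradientAt_iff_hasFDerivAt, map_smul]
    exact (hasGradientAt_of_contDiff hV y).hasFDerivAt.const_mul c
  · rw [smul_eq_zero, or_iff_right hc0.ne', hzero]
  · rw [hDL, hLs]
    exact (hgC1.differentiable one_ne_zero (p i)).hasFDerivAt.const_smul c
  · obtain ⟨R, hR⟩ := exists_asymptotic_bound hg hasymp (div_pos hε hc0)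
    refine ⟨c * R, fun y => ?_⟩
    rw [hDL, hLn, _root_.smul_apply, ← smul_sub, norm_smul, Real.norm_of_nonneg hc0.le]
    refine (mul_le_mul_of_nonneg_left (hR y) hc0.le).trans_eq ?_
    field_simp
  · obtain ⟨hC2, hode⟩ := rescale_solution hg hs0.ne' h1 (fun t => by rw [← hc]; exact h2 t)
    by_contra hnc
    refine hcon ⟨fun t => u (s * t), hC2, fun t => ?_, hode, fun ⟨b, hb⟩ => hnc ⟨b, fun t => ?_⟩⟩
    · have h := hper.nat_mul d (s * t)
      refine (congrArg u ?_).trans h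
      rw [hs]
      field_simp
    · simpa only [mul_div_cancel₀ t hs0.ne'] using hb (t / s)
  · have h : k * d ∉ S := fun hmem => by
      have := hdmax _ hmem
      nlinarith
    rw [hS] at h
    simp only [Set.mem_ofPred_eq, not_and, not_not] at h
    simpa only [hDs, hDc] using (h (Nat.mul_pos (by omega) hd1)).symm
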